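/- arXiv:math/0303386 — 2 statements merged into one kernel-verified Lean document; each statement's English description precedes it below -/
import Mathlib

section
/- If w ∈ Z is a nontrivial word, then for every automorphism α ∈ Aut(F_k) we have α(w) ≠ w^{-1}. -/
/-! Common definitions: free group `FG k = F(a_1,…,a_k)`, reduced and cyclically
reduced words, Whitehead automorphisms, strict minimality, counting functions and
exponential genericity, following Kapovich–Schupp–Shpilrain. -/

/-- The free group of rank `k` on the basis `a_1,…,a_k`. -/
abbrev FG (k : ℕ) := FreeGroup (Fin k)

/-- The alphabet `Σ = {a_1,…,a_k}^{±1}`: a letter is a basis index together with a sign. -/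
abbrev Letter (k : ℕ) := Fin k × Bool

/-- The inverse of a letter. -/
def linv {k : ℕ} (x : Letter k) : Letter k := (x.1, !x.2)

/-- The length `|g|` of the reduced word representing `g`. -/
def wordLength {k : ℕ} (g : FG k) : ℕ := (FreeGroup.toWord g).length

/-- A word is (freely) reduced if it equals its free reduction. -/
def ReducedWord {k : ℕ} (w : List (Letter k)) : Prop := FreeGroup.reduce w = w

/-- A word is cyclically reduced if all of its cyclic permutations are reduced;
equivalently, `w ++ w` is reduced. -/
def CyclicallyReducedWord {k : ℕ} (w : List (Letter k)) : Prop :=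
  FreeGroup.reduce (w ++ w) = w ++ w

/-- An element of `FG k` is cyclically reduced if its reduced word is. -/
def IsCyclicallyReduced {k : ℕ} (g : FG k) : Prop :=
  CyclicallyReducedWord (FreeGroup.toWord g)

/-- `C`, the set of all cyclically reduced elements of `FG k`. -/
def Cset (k : ℕ) : Set (FG k) := {g | IsCyclicallyReduced g}

/-- The cyclic length `‖g‖`: the length of the cyclically reduced form of `g`
(the unique cyclically reduced `u` with `g = x u x⁻¹`). -/
noncomputable def cyclicLength {k : ℕ} (g : FG k) : ℕ :=
  sInf {n | ∃ x u : FG k, IsCyclicallyReduced u ∧ g = x * u * x⁻¹ ∧ wordLength u = n}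

/-- The set `Σ = {a_1,…,a_k}^{±1}` inside the free group. -/
def letterSet (k : ℕ) : Set (FG k) :=
  {g | ∃ i : Fin k, g = FreeGroup.of i ∨ g = (FreeGroup.of i)⁻¹}

/-- A Whitehead automorphism of the first kind: a relabeling automorphism,
i.e. one whose restriction to `Σ` is a permutation of `Σ`. -/
def IsRelabeling {k : ℕ} (τ : MulAut (FG k)) : Prop :=
  (⇑τ) '' letterSet k = letterSet k

/-- A Whitehead automorphism of the second kind, with multiplier `a ∈ Σ`:
`τ a = a` and `τ x ∈ {x, xa, a⁻¹x, a⁻¹xa}` for all `x ∈ Σ`. -/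
def IsWhitehead2 {k : ℕ} (τ : MulAut (FG k)) : Prop :=
  ∃ a ∈ letterSet k, τ a = a ∧
    ∀ x ∈ letterSet k, τ x = x ∨ τ x = x * a ∨ τ x = a⁻¹ * x ∨ τ x = a⁻¹ * x * a

/-- An automorphism is inner if it is conjugation by some element. -/
def IsInner {k : ℕ} (α : MulAut (FG k)) : Prop := ∃ g : FG k, α = MulAut.conj g

/-- `SM`: the set of strictly minimal cyclically reduced elements, those `w` with
`‖τ w‖ > |w|` for every non-inner Whitehead automorphism `τ` of the second kind. -/
def SM (k : ℕ) : Set (FG k) :=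
  {w | IsCyclicallyReduced w ∧
    ∀ τ : MulAut (FG k), IsWhitehead2 τ → ¬ IsInner τ → wordLength w < cyclicLength (τ w)}

/-- `SM'`: elements whose cyclically reduced form lies in `SM`. -/
def SM' (k : ℕ) : Set (FG k) := {g | ∃ x u : FG k, u ∈ SM k ∧ g = x * u * x⁻¹}

/-- `γ(n,S)`: the number of elements of `S` of length `n`. -/
noncomputable def gammaC {k : ℕ} (S : Set (FG k)) (n : ℕ) : ℕ :=
  {g ∈ S | wordLength g = n}.ncard

/-- `ρ(n,S)`: the number of elements of `S` of length at most `n`. -/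
noncomputable def rhoC {k : ℕ} (S : Set (FG k)) (n : ℕ) : ℕ :=
  {g ∈ S | wordLength g ≤ n}.ncard

/-- `B ⊆ S` is exponentially generic in `S` if `ρ(n,B)/ρ(n,S) → 1`
exponentially fast. -/
def ExpGenericIn {k : ℕ} (B S : Set (FG k)) : Prop :=
  B ⊆ S ∧ ∃ K : ℝ, 0 < K ∧ ∃ σ : ℝ, 0 < σ ∧ σ < 1 ∧
    ∀ n : ℕ, |1 - (rhoC B n : ℝ) / (rhoC S n : ℝ)| ≤ K * σ ^ n

/-- `B` is exponentially negligible in `S` if `S \ B` is exponentially generic in `S`. -/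
def ExpNegligibleIn {k : ℕ} (B S : Set (FG k)) : Prop := ExpGenericIn (S \ B) S

/-- The orbit `Aut(F_k) w`. -/
def autOrbit {k : ℕ} (w : FG k) : Set (FG k) := {g | ∃ α : MulAut (FG k), α w = g}

/-- `u` is a cyclic permutation of `v`: the reduced word of `u` is a rotation of
the reduced word of `v`. -/
def IsCyclicPerm {k : ℕ} (u v : FG k) : Prop :=
  ∃ n : ℕ, FreeGroup.toWord u = (FreeGroup.toWord v).rotate n

/-- `w` is a proper power: `w = uⁿ` for some `n ≥ 2`. -/
def IsProperPower {k : ℕ} (w : FG k) : Prop := ∃ (u : FG k) (n : ℕ), 2 ≤ n ∧ w = u ^ n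

/-- `TS`: strictly minimal cyclically reduced `w` which are not proper powers and
are not conjugate to `τ w` for any nontrivial relabeling automorphism `τ`. -/
def TS (k : ℕ) : Set (FG k) :=
  {w | w ∈ SM k ∧ ¬ IsProperPower w ∧
    ∀ τ : MulAut (FG k), IsRelabeling τ → τ ≠ 1 → ¬ IsConj (τ w) w}

/-- `TS'`: elements whose cyclically reduced form lies in `TS`. -/
def TS' (k : ℕ) : Set (FG k) := {g | ∃ x u : FG k, u ∈ TS k ∧ g = x * u * x⁻¹}

/-- `Z`: elements of `TS` such that no relabeling automorphism sends `w` to a cyclic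
permutation of `w⁻¹`. -/
def Zset (k : ℕ) : Set (FG k) :=
  {w | w ∈ TS k ∧ ¬ ∃ τ : MulAut (FG k), IsRelabeling τ ∧ IsCyclicPerm (τ w) w⁻¹}

/-- Growth entropy `H(S) = limsup ρ(n,S)^{1/n}`. -/
noncomputable def entropyH {k : ℕ} (S : Set (FG k)) : ℝ :=
  Filter.limsup (fun n : ℕ => (rhoC S n : ℝ) ^ ((n : ℝ)⁻¹)) Filter.atTop

/-- Number of occurrences of the two-letter word `xy` as a subword of `w`. -/
def countPair {k : ℕ} (w : List (Letter k)) (x y : Letter k) : ℕ :=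
  (w.zip w.tail).count (x, y)

/-- The label `ŵ_{xy}` of the edge `[x⁻¹, y]` in the weighted Whitehead graph of the
cyclically reduced word `w`: occurrences of `xy` and of `y⁻¹x⁻¹` in `wc`, where `c` is
the first letter of `w`. -/
def whLabel {k : ℕ} (w : List (Letter k)) (x y : Letter k) : ℕ :=
  countPair (w ++ w.take 1) x y + countPair (w ++ w.take 1) (linv y) (linv x)

/-- The one-relator group `G_u = ⟨a_1,…,a_k ∣ u = 1⟩`. -/
abbrev OneRel (k : ℕ) (u : FG k) := FG k ⧸ Subgroup.normalClosure ({u} : Set (FG k))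

/-- `u` is primitive: it belongs to some free basis of `FG k`, equivalently it is the
image of a basis element under an automorphism. -/
def IsPrimitive {k : ℕ} (u : FG k) : Prop :=
  ∃ (α : MulAut (FG k)) (i : Fin k), α (FreeGroup.of i) = u

section WhGen
set_option linter.unusedSectionVars false
variable {G : Type*} [Group G]

def WCob (X : Set G) (g : G) : Set G := {h | ¬ (h ∈ X ↔ g * h ∈ X)}

def WAI (X : Set G) : Prop := ∀ g, (WCob X g).Finite

noncomputable def Wpsi (g : G) (X : Set G) : ℕ := (WCob X g).ncard

noncomputable def Wi (g : G) (X : Set G) : ℝ :=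
  Filter.limUnder Filter.atTop (fun n : ℕ => (Wpsi (g ^ n) X : ℝ) / n)

lemma Wncard_pre (e : G ≃ G) (A : Set G) : {h | e h ∈ A}.ncard = A.ncard :=
  Set.ncard_congr' ((e.subtypeEquiv (fun _ => Iff.rfl)))

lemma Wfin_pre (e : G ≃ G) {A : Set G} (hA : A.Finite) : {h | e h ∈ A}.Finite :=
  hA.preimage e.injective.injOn

lemma WCob_mul_subset (X : Set G) (g g' : G) :
    WCob X (g * g') ⊆ WCob X g' ∪ {h | g' * h ∈ WCob X g} := by
  intro h hh
  simp only [WCob, Set.mem_ofPred_eq, Set.mem_union, mul_assoc] at *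
  tauto

lemma Wpsi_mul_le {X : Set G} (hX : WAI X) (g g' : G) :
    Wpsi (g * g') X ≤ Wpsi g X + Wpsi g' X := by
  have h1 : {h | g' * h ∈ WCob X g}.Finite := Wfin_pre (Equiv.mulLeft g') (hX g)
  have h2 : {h | g' * h ∈ WCob X g}.ncard = (WCob X g).ncard := Wncard_pre (Equiv.mulLeft g') _
  calc _ ≤ _ := Set.ncard_le_ncard (WCob_mul_subset X g g') ((hX g').union h1)
    _ ≤ _ := Set.ncard_union_le _ _
    _ = _ := by rw [h2, add_comm]; rfl

lemma Wi_tendsto {X : Set G} (hX : WAI X) (g : G) :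
    Filter.Tendsto (fun n : ℕ => (Wpsi (g ^ n) X : ℝ) / n) Filter.atTop (nhds (Wi g X)) := by
  have hs : Subadditive (fun n : ℕ => (Wpsi (g ^ n) X : ℝ)) := by
    intro m n
    simp only [pow_add]
    exact_mod_cast Wpsi_mul_le hX _ _
  have := hs.tendsto_lim ⟨0, by rintro _ ⟨n, rfl⟩; positivity⟩
  exact tendsto_nhds_limUnder ⟨_, this⟩

lemma Wi_eq_of_bdd {X Y : Set G} (hX : WAI X) (hY : WAI Y) (g g' : G) (C : ℕ)
    (h1 : ∀ n, Wpsi (g ^ n) X ≤ Wpsi (g' ^ n) Y + C)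
    (h2 : ∀ n, Wpsi (g' ^ n) Y ≤ Wpsi (g ^ n) X + C) : Wi g X = Wi g' Y := by
  have hC : Filter.Tendsto (fun n : ℕ => (C : ℝ) / n) Filter.atTop (nhds 0) :=
    tendsto_const_div_atTop_nhds_zero_nat _
  apply le_antisymm
  · have := (Wi_tendsto hY g').add hC
    rw [add_zero] at this
    refine le_of_tendsto_of_tendsto' (Wi_tendsto hX g) this fun n => ?_
    rw [← add_div]
    gcongr
    exact_mod_cast h1 n
  · have := (Wi_tendsto hX g).add hC
    rw [add_zero] at this
    refine le_of_tendsto_of_tendsto' (Wi_tendsto hY g') this fun n => ?_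
    rw [← add_div]
    gcongr
    exact_mod_cast h2 n

lemma Wi_congr {X Y : Set G} {g g' : G}
    (h : ∀ n, Wpsi (g ^ n) X = Wpsi (g' ^ n) Y) : Wi g X = Wi g' Y := by
  unfold Wi
  simp only [h]

lemma WCob_compl (X : Set G) (g : G) : WCob Xᶜ g = WCob X g := by
  ext h; simp only [WCob, Set.mem_ofPred_eq, Set.mem_compl_iff]; tauto

lemma WAI.compl {X : Set G} (hX : WAI X) : WAI Xᶜ := fun g => by
  rw [WCob_compl]; exact hX g

lemma Wi_compl (g : G) (X : Set G) : Wi g Xᶜ = Wi g X :=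
  Wi_congr fun n => by simp [Wpsi, WCob_compl]

lemma WAI.inter {X Y : Set G} (hX : WAI X) (hY : WAI Y) : WAI (X ∩ Y) := fun g =>
  ((hX g).union (hY g)).subset fun h hh => by
    simp only [WCob, Set.mem_ofPred_eq, Set.mem_inter_iff, Set.mem_union] at *; tauto

lemma WAI.union {X Y : Set G} (hX : WAI X) (hY : WAI Y) : WAI (X ∪ Y) := fun g =>
  ((hX g).union (hY g)).subset fun h hh => by
    simp only [WCob, Set.mem_ofPred_eq, Set.mem_union] at *; tauto

lemma Wpsi_submod {X Y : Set G} (hX : WAI X) (hY : WAI Y) (g : G) :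
    Wpsi g (X ∩ Y) + Wpsi g (X ∪ Y) ≤ Wpsi g X + Wpsi g Y := by
  unfold Wpsi
  have hI := hX.inter hY g
  have hU := hX.union hY g
  rw [← Set.ncard_union_add_ncard_inter _ _ hI hU,
    ← Set.ncard_union_add_ncard_inter _ _ (hX g) (hY g)]
  refine add_le_add (Set.ncard_le_ncard ?_ ((hX g).union (hY g)))
    (Set.ncard_le_ncard ?_ ((hX g).inter_of_left _))
  · intro h hh
    simp only [WCob, Set.mem_ofPred_eq, Set.mem_inter_iff, Set.mem_union] at *; tauto
  · intro h hh
    simp only [WCob, Set.mem_ofPred_eq, Set.mem_inter_iff, Set.mem_union] at *; tauto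

lemma Wi_submod {X Y : Set G} (hX : WAI X) (hY : WAI Y) (g : G) :
    Wi g (X ∩ Y) + Wi g (X ∪ Y) ≤ Wi g X + Wi g Y := by
  refine le_of_tendsto_of_tendsto' ((Wi_tendsto (hX.inter hY) g).add (Wi_tendsto (hX.union hY) g))
    ((Wi_tendsto hX g).add (Wi_tendsto hY g)) fun n => ?_
  rw [← add_div, ← add_div]
  apply div_le_div_of_nonneg_right _ (Nat.cast_nonneg n)
  exact_mod_cast Wpsi_submod hX hY _

/-- almost equality -/
def WAE (X Y : Set G) : Prop := {h | ¬ (h ∈ X ↔ h ∈ Y)}.Finite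

lemma WAE.symm {X Y : Set G} (h : WAE X Y) : WAE Y X :=
  h.subset fun x hx => by simp only [Set.mem_ofPred_eq] at *; tauto

lemma WCob_ae_subset (X Y : Set G) (g : G) : WCob Y g ⊆
    WCob X g ∪ ({h | ¬ (h ∈ X ↔ h ∈ Y)} ∪ {h | g * h ∈ {h | ¬ (h ∈ X ↔ h ∈ Y)}}) := by
  intro h hh
  simp only [WCob, Set.mem_ofPred_eq, Set.mem_union] at *
  tauto

lemma WAI.congr {X Y : Set G} (hX : WAI X) (h : WAE X Y) : WAI Y := fun g =>
  ((hX g).union (h.union (Wfin_pre (Equiv.mulLeft g) h))).subset (WCob_ae_subset X Y g)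

lemma Wpsi_ae_le {X Y : Set G} (hX : WAI X) (h : WAE X Y) (g : G) :
    Wpsi g Y ≤ Wpsi g X + 2 * {h | ¬ (h ∈ X ↔ h ∈ Y)}.ncard := by
  have h2 := Wncard_pre (Equiv.mulLeft g) {h | ¬ (h ∈ X ↔ h ∈ Y)}
  calc _ ≤ _ := Set.ncard_le_ncard (WCob_ae_subset X Y g)
        ((hX g).union (h.union (Wfin_pre (Equiv.mulLeft g) h)))
    _ ≤ _ := (Set.ncard_union_le _ _).trans (Nat.add_le_add_left (Set.ncard_union_le _ _) _)
    _ = _ := by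
      simp only [Equiv.coe_mulLeft] at h2
      rw [h2, two_mul]; rfl

lemma Wi_ae {X Y : Set G} (hX : WAI X) (h : WAE X Y) (g : G) : Wi g X = Wi g Y := by
  refine Wi_eq_of_bdd hX (hX.congr h) g g (2 * {h | ¬ (h ∈ X ↔ h ∈ Y)}.ncard) (fun n => ?_)
    (fun n => Wpsi_ae_le hX h _)
  have := Wpsi_ae_le (hX.congr h) h.symm (g ^ n)
  have e : {h | ¬ (h ∈ Y ↔ h ∈ X)} = {h | ¬ (h ∈ X ↔ h ∈ Y)} := by
    ext x; simp only [Set.mem_ofPred_eq]; tauto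
  rwa [e] at this

/-- right translate -/
def WT (X : Set G) (k : G) : Set G := {h | h * k ∈ X}

lemma WCob_WT (X : Set G) (k g : G) : WCob (WT X k) g = {h | Equiv.mulRight k h ∈ WCob X g} := by
  ext h; simp [WCob, WT, mul_assoc]

lemma WAI.WT {X : Set G} (hX : WAI X) (k : G) : WAI (WT X k) := fun g => by
  rw [WCob_WT]; exact Wfin_pre _ (hX g)

lemma Wi_WT (X : Set G) (k g : G) : Wi g (WT X k) = Wi g X :=
  Wi_congr fun n => by rw [Wpsi, WCob_WT, Wncard_pre]; rfl

lemma WCob_pre (α : MulAut G) (X : Set G) (g : G) :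
    WCob {h | α h ∈ X} g = {h | α.toEquiv h ∈ WCob X (α g)} := by
  ext h; simp [WCob]

lemma WAI.pre {X : Set G} (hX : WAI X) (α : MulAut G) : WAI {h | α h ∈ X} := fun g => by
  rw [WCob_pre]; exact Wfin_pre _ (hX _)

lemma Wi_pre (α : MulAut G) (X : Set G) (g : G) : Wi g {h | α h ∈ X} = Wi (α g) X :=
  Wi_congr fun n => by rw [Wpsi, WCob_pre, Wncard_pre, map_pow]; rfl

lemma Wpsi_inv (g : G) (X : Set G) : Wpsi g⁻¹ X = Wpsi g X := by
  unfold Wpsi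
  rw [← Wncard_pre (Equiv.mulLeft g) (WCob X g⁻¹)]
  congr 1
  ext h
  simp [WCob, iff_comm]

lemma Wi_conj {X : Set G} (hX : WAI X) (g k : G) : Wi (k * g * k⁻¹) X = Wi g X := by
  refine Wi_eq_of_bdd hX hX _ _ (2 * Wpsi k X) (fun n => ?_) (fun n => ?_)
  · rw [conj_pow]
    have := Wpsi_mul_le hX (k * g ^ n) k⁻¹
    have := Wpsi_mul_le hX k (g ^ n)
    have := Wpsi_inv k X
    omega
  · have e : g ^ n = k⁻¹ * (k * g * k⁻¹) ^ n * k := by rw [conj_pow]; group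
    rw [e]
    have := Wpsi_mul_le hX (k⁻¹ * (k * g * k⁻¹) ^ n) k
    have := Wpsi_mul_le hX k⁻¹ ((k * g * k⁻¹) ^ n)
    have := Wpsi_inv k X
    omega

/-- signed count -/
noncomputable def Wind (X : Set G) (h : G) : ℤ := by classical exact if h ∈ X then 1 else 0

lemma Wind_congr {X Y : Set G} {h k : G} (e : h ∈ X ↔ k ∈ Y) : Wind X h = Wind Y k := by
  unfold Wind
  by_cases h1 : h ∈ X
  · rw [if_pos h1, if_pos (e.1 h1)]
  · rw [if_neg h1, if_neg (fun h2 => h1 (e.2 h2))]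

noncomputable def Wn (g : G) (X : Set G) : ℤ := ∑ᶠ h, (Wind X (g * h) - Wind X h)

lemma Wn_supp (g : G) (X : Set G) :
    Function.support (fun h => Wind X (g * h) - Wind X h) ⊆ WCob X g := by
  intro h hh
  simp only [Function.mem_support, WCob, Set.mem_ofPred_eq] at *
  intro h'
  apply hh
  rw [Wind_congr h', sub_self]

lemma Wn_supp_fin {X : Set G} (hX : WAI X) (g : G) :
    (Function.support (fun h => Wind X (g * h) - Wind X h)).Finite := (hX g).subset (Wn_supp g X)

lemma Wn_mul {X : Set G} (hX : WAI X) (g g' : G) : Wn (g * g') X = Wn g X + Wn g' X := by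
  have e : Wn g X = ∑ᶠ h, (Wind X (g * (g' * h)) - Wind X (g' * h)) :=
    (finsum_comp_equiv (Equiv.mulLeft g') (f := fun h => Wind X (g * h) - Wind X h)).symm
  have hf : (Function.support (fun h => Wind X (g * (g' * h)) - Wind X (g' * h))).Finite :=
    Wfin_pre (Equiv.mulLeft g') (Wn_supp_fin hX g)
  rw [e, Wn, Wn, ← finsum_add_distrib hf (Wn_supp_fin hX g')]
  congr 1; ext h; rw [mul_assoc]; ring

lemma Wn_union {X Y Z : Set G} (hX : WAI X) (hY : WAI Y)
    (hZ : ∀ h, Wind Z h = Wind X h + Wind Y h) (g : G) : Wn g Z = Wn g X + Wn g Y := by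
  unfold Wn
  rw [← finsum_add_distrib (Wn_supp_fin hX g) (Wn_supp_fin hY g)]
  congr 1; ext h; rw [hZ, hZ]; ring

lemma Wn_WT (X : Set G) (k g : G) : Wn g (WT X k) = Wn g X := by
  unfold Wn
  rw [← finsum_comp_equiv (Equiv.mulRight k) (f := fun h => Wind X (g * h) - Wind X h)]
  congr 1; ext h
  exact congrArg₂ _ (Wind_congr (by simp [WT, mul_assoc])) (Wind_congr (by simp [WT]))

lemma Wn_pre (α : MulAut G) (X : Set G) (g : G) : Wn g {h | α h ∈ X} = Wn (α g) X := by
  unfold Wn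
  rw [← finsum_comp_equiv α.toEquiv (f := fun h => Wind X (α g * h) - Wind X h)]
  congr 1; ext h
  exact congrArg₂ _ (Wind_congr (by simp)) (Wind_congr (by simp))

lemma Wn_ae {X Y : Set G} (hX : WAI X) (h : WAE X Y) (g : G) : Wn g Y = Wn g X := by
  have hs : (Function.support (fun k => Wind Y k - Wind X k)).Finite := h.subset fun k hk => by
    simp only [Function.mem_support, Set.mem_ofPred_eq] at *
    intro h'; apply hk; rw [Wind_congr h', sub_self]
  have hs' : (Function.support (fun k => Wind Y (g * k) - Wind X (g * k))).Finite :=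
    Wfin_pre (Equiv.mulLeft g) hs
  have e : ∑ᶠ k, (Wind Y (g * k) - Wind X (g * k)) = ∑ᶠ k, (Wind Y k - Wind X k) :=
    finsum_comp_equiv (Equiv.mulLeft g) (f := fun k => Wind Y k - Wind X k)
  rw [← sub_eq_zero, Wn, Wn, ← finsum_sub_distrib (Wn_supp_fin (hX.congr h) g) (Wn_supp_fin hX g)]
  rw [← sub_eq_zero, ← finsum_sub_distrib hs' hs] at e
  rw [← e]
  congr 1; ext k; ring

lemma Wn_compl (X : Set G) (g : G) : Wn g Xᶜ = - Wn g X := by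
  unfold Wn
  rw [← finsum_neg_distrib]
  congr 1; ext h
  simp only [Wind, Set.mem_compl_iff]
  split_ifs <;> simp_all

end WhGen

section WhFree
variable {k : ℕ}

def Wl (x : Letter k) : FG k := FreeGroup.mk [x]

lemma Wl_true (i : Fin k) : Wl (i, true) = FreeGroup.of i := rfl

lemma Wl_linv (x : Letter k) : Wl (linv x) = (Wl x)⁻¹ := rfl

lemma Wlinv_linv (x : Letter k) : linv (linv x) = x := by simp [linv]

lemma Wlinv_ne (x : Letter k) : linv x ≠ x := by
  intro h; have := congrArg Prod.snd h; simp [linv] at this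

lemma Wmk_cons (x : Letter k) (L : List (Letter k)) :
    FreeGroup.mk (x :: L) = Wl x * FreeGroup.mk L := by
  rw [Wl, FreeGroup.mul_mk]; rfl

lemma Wl_toWord (x : Letter k) : (Wl x).toWord = [x] := rfl

lemma Wl_ne_one (x : Letter k) : Wl x ≠ 1 := by
  intro h; have := congrArg FreeGroup.toWord h; simp [Wl_toWord] at this

lemma Wl_inj {x y : Letter k} (h : Wl x = Wl y) : x = y := by
  have := congrArg FreeGroup.toWord h; simpa [Wl_toWord] using this

lemma Wl_mul (s : Letter k) (h : FG k) :
    (∃ L, h.toWord = linv s :: L ∧ (Wl s * h).toWord = L) ∨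
    ((∀ y ∈ h.toWord.head?, y ≠ linv s) ∧ (Wl s * h).toWord = s :: h.toWord) := by
  have e : (Wl s * h).toWord = FreeGroup.reduce (s :: h.toWord) := by
    rw [FreeGroup.toWord_mul, Wl_toWord]; rfl
  rw [FreeGroup.reduce.cons, FreeGroup.reduce_toWord] at e
  cases hw : h.toWord with
  | nil => right; rw [hw] at e; simpa using e
  | cons y L =>
    rw [hw] at e
    by_cases hy : y = linv s
    · left
      subst hy
      refine ⟨L, rfl, ?_⟩
      rw [e]; simp [linv]
    · right
      refine ⟨by simpa using hy, ?_⟩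
      rw [e]
      simp only
      rw [if_neg]
      rintro ⟨h1, h2⟩
      apply hy
      ext <;> simp [linv, h1, h2]

def WX (S : Set (Letter k)) : Set (FG k) := {h | ∃ y ∈ S, y ∈ h.toWord.getLast?}

lemma Wone_eq {h : FG k} : h = 1 ↔ h.toWord = [] := FreeGroup.toWord_eq_nil_iff.symm

lemma WX_one (S : Set (Letter k)) : (1 : FG k) ∉ WX S := by
  rintro ⟨y, -, hy⟩; simp at hy

lemma WX_l (S : Set (Letter k)) (x : Letter k) : Wl x ∈ WX S ↔ x ∈ S := by
  constructor
  · rintro ⟨y, hy, h⟩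
    rw [Wl_toWord] at h
    have : x = y := by simpa using h
    rwa [this]
  · intro h; exact ⟨x, h, rfl⟩

lemma WX_iff (S : Set (Letter k)) (s : Letter k) (h : FG k) (h1 : h ≠ 1) (h2 : Wl s * h ≠ 1) :
    Wl s * h ∈ WX S ↔ h ∈ WX S := by
  rw [Ne, Wone_eq] at h1 h2
  rcases Wl_mul s h with ⟨L, e1, e2⟩ | ⟨-, e⟩
  · rw [e2] at h2
    simp only [WX, Set.mem_ofPred_eq, e1, e2]
    rw [List.getLast?_cons_of_ne_nil h2]
  · simp only [WX, Set.mem_ofPred_eq, e]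
    rw [List.getLast?_cons_of_ne_nil h1]

lemma WX_cob (S : Set (Letter k)) (s : Letter k) (h : FG k) :
    ¬ (h ∈ WX S ↔ Wl s * h ∈ WX S) ↔ (h = 1 ∧ s ∈ S) ∨ (Wl s * h = 1 ∧ linv s ∈ S) := by
  by_cases h1 : h = 1
  · subst h1
    simp [WX_one, WX_l, Wl_ne_one]
  by_cases h2 : Wl s * h = 1
  · have : h = Wl (linv s) := by rw [Wl_linv]; exact eq_inv_of_mul_eq_one_right h2
    rw [h2, this]
    simp [WX_one, WX_l, Wl_ne_one]
  · simp [WX_iff S s h h1 h2, h1, h2]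

lemma WAI_of_letters {X : Set (FG k)} (hX : ∀ s, (WCob X (Wl s)).Finite) : WAI X := by
  intro g
  rw [← FreeGroup.mk_toWord (x := g)]
  induction g.toWord with
  | nil => 
    have : WCob X (FreeGroup.mk []) = ∅ := by
      ext h; simp [WCob, ← FreeGroup.one_eq_mk]
    rw [this]; exact Set.finite_empty
  | cons x L ih =>
    rw [Wmk_cons]
    exact (ih.union (Wfin_pre (Equiv.mulLeft (FreeGroup.mk L)) (hX x))).subset (WCob_mul_subset X _ _)

lemma WX_ai (S : Set (Letter k)) : WAI (WX S) := WAI_of_letters fun s => by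
  refine (Set.toFinite {1, (Wl s)⁻¹}).subset fun h hh => ?_
  rcases (WX_cob S s h).1 hh with h | h
  · left; exact h.1
  · right; exact eq_inv_of_mul_eq_one_right h.1

lemma Wi_same {P Q : Set (FG k)}
    (H : ∀ h (i : Fin k), ¬ (h ∈ P ↔ FreeGroup.of i * h ∈ P) ↔ ¬ (h ∈ Q ↔ FreeGroup.of i * h ∈ Q))
    (g : FG k) : Wi g P = Wi g Q := by
  have key : ∀ g h : FG k, (h ∈ P ↔ h ∈ Q) ↔ (g * h ∈ P ↔ g * h ∈ Q) := by
    intro g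
    refine FreeGroup.induction_on g ?_ ?_ ?_ ?_
    · simp
    · intro i h; have := H h i; change _ ↔ (FreeGroup.of i * h ∈ P ↔ FreeGroup.of i * h ∈ Q); tauto
    · intro i ih h
      have := ih ((FreeGroup.of i)⁻¹ * h)
      change _ ↔ (FreeGroup.of i * ((FreeGroup.of i)⁻¹ * h) ∈ P ↔
        FreeGroup.of i * ((FreeGroup.of i)⁻¹ * h) ∈ Q) at this
      rw [mul_inv_cancel_left] at this; exact this.symm
    · intro x y hx hy h; rw [hy h, hx, mul_assoc]
  by_cases h1 : (1 : FG k) ∈ P ↔ (1 : FG k) ∈ Q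
  · have : P = Q := by ext h; have := key h 1; rw [mul_one] at this; exact this.1 h1
    rw [this]
  · have : P = Qᶜ := by
      ext h; have := key h 1; rw [mul_one] at this
      have := mt this.2 h1
      simp only [Set.mem_compl_iff]; tauto
    rw [this, Wi_compl]

lemma Wlast_inv (h : FG k) (y : Letter k) :
    y ∈ (h⁻¹).toWord.getLast? ↔ linv y ∈ h.toWord.head? := by
  rw [FreeGroup.toWord_inv, FreeGroup.invRev]
  simp only [List.getLast?_reverse, List.head?_map, Option.mem_def, Option.map_eq_some_iff]
  constructor
  · rintro ⟨a, h1, rfl⟩; simpa [linv] using h1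
  · intro h1; exact ⟨_, h1, by simp [linv]⟩

lemma Wpsi_cons (i : Fin k) (x : Letter k) (g : FG k) (hx : ∀ y ∈ g.toWord.head?, y ≠ linv x) :
    Wpsi (Wl x * g) (WX {(i, true)}) = Wpsi g (WX {(i, true)}) + if x.1 = i then 1 else 0 := by
  set X := WX {((i, true) : Letter k)} with hXd
  have step : ∀ h0, (∀ h, ¬ (h ∈ X ↔ Wl x * h ∈ X) ↔ h = h0) → 
      ((g⁻¹ * h0 ∈ X) ↔ h0 ∈ X) → Wpsi (Wl x * g) X = Wpsi g X + 1 := by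
    intro h0 H1 H2
    have hni : g⁻¹ * h0 ∉ WCob X g := by simp [WCob, H2]
    have : WCob X (Wl x * g) = insert (g⁻¹ * h0) (WCob X g) := by
      ext h
      have := H1 (g * h)
      have e : g * h = h0 ↔ h = g⁻¹ * h0 := by rw [eq_inv_mul_iff_mul_eq]
      rw [e] at this
      by_cases hh : h = g⁻¹ * h0
      · subst hh
        simp only [WCob, Set.mem_ofPred_eq, Set.mem_insert_iff, mul_assoc, mul_inv_cancel_left, H2] at *
        tauto
      · simp only [WCob, Set.mem_ofPred_eq, Set.mem_insert_iff, mul_assoc, hh] at *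
        tauto
    rw [Wpsi, this, Set.ncard_insert_of_notMem hni (WX_ai _ g)]; rfl
  obtain ⟨j, b⟩ := x
  by_cases hj : j = i
  · subst hj
    simp only [if_true]
    cases b
    · apply step (Wl (j, true))
      · intro h
        rw [hXd, WX_cob]
        have : Wl (j, false) * h = 1 ↔ h = Wl (j, true) := by
          rw [mul_eq_one_iff_eq_inv', ← Wl_linv]; rfl
        simp [this, linv]
      · have h1 : Wl (j, true) ∈ X := by rw [hXd, WX_l]; rfl
        have h2 : g⁻¹ * Wl (j, true) ∈ X := by
          refine ⟨_, rfl, ?_⟩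
          have : g⁻¹ * Wl (j, true) = (Wl (j, false) * g)⁻¹ := by
            rw [mul_inv_rev, ← Wl_linv]; rfl
          rw [this, Wlast_inv]
          rcases Wl_mul (j, false) g with ⟨L, e1, e2⟩ | ⟨-, e⟩
          · exact absurd rfl (hx _ (by rw [e1]; rfl))
          · rw [e]; rfl
        simp [h1, h2]
    · apply step 1
      · intro h
        rw [hXd, WX_cob]
        simp [linv]
      · have h1 : (1 : FG k) ∉ X := WX_one _
        have h2 : g⁻¹ * 1 ∉ X := by
          rw [mul_one]
          rintro ⟨y, hy, h2⟩
          rw [Wlast_inv] at h2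
          have hy : y = _ := hy
          subst hy
          exact hx _ h2 rfl
        simp only [h1, h2]
  · simp only [hj, if_false, add_zero]
    unfold Wpsi
    congr 1
    ext h
    have := WX_cob {((i, true) : Letter k)} (j, b) (g * h)
    have e1 : ¬ ((j, b) : Letter k) ∈ ({(i, true)} : Set (Letter k)) := by simp [hj]
    have e2 : ¬ linv ((j, b) : Letter k) ∈ ({(i, true)} : Set (Letter k)) := by simp [hj, linv]
    simp only [e1, e2, and_false, or_false, iff_false, not_not] at this
    simp only [WCob, Set.mem_ofPred_eq, mul_assoc, this, hXd]

lemma Wpsi_sum (g : FG k) : ∑ i, Wpsi g (WX {(i, true)}) = g.toWord.length := by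
  generalize hL : g.toWord = L
  induction L generalizing g with
  | nil =>
    have : g = 1 := Wone_eq.2 hL
    subst this
    simp [Wpsi, WCob]
  | cons x L ih =>
    have hr : FreeGroup.IsReduced (x :: L) := hL ▸ FreeGroup.isReduced_toWord
    have hr' : FreeGroup.IsReduced L := hr.infix ⟨[x], [], by simp⟩
    have e : (FreeGroup.mk L).toWord = L := by rw [FreeGroup.toWord_mk]; exact hr'.reduce_eq
    have hg : g = Wl x * FreeGroup.mk L := by
      rw [← Wmk_cons, ← hL, FreeGroup.mk_toWord]
    have hx : ∀ y ∈ (FreeGroup.mk L).toWord.head?, y ≠ linv x := by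
      rw [e]
      rintro y hy rfl
      cases L with
      | nil => simp at hy
      | cons z L =>
        simp at hy
        subst hy
        rw [FreeGroup.isReduced_cons_cons] at hr
        have := hr.1 (by simp [linv])
        simp [linv] at this
    rw [hg]
    simp only [Wpsi_cons _ _ _ hx, Finset.sum_add_distrib, ih _ e]
    simp

noncomputable def Wt (g : FG k) : ℝ := ∑ i, Wi g (WX {(i, true)})

lemma Wt_tendsto (g : FG k) : Filter.Tendsto (fun n : ℕ => (wordLength (g ^ n) : ℝ) / n)
    Filter.atTop (nhds (Wt g)) := by
  have := tendsto_finsetSum (f := fun (i : Fin k) (n : ℕ) => (Wpsi (g ^ n) (WX {(i, true)}) : ℝ) / n)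
    Finset.univ (fun i _ => Wi_tendsto (WX_ai {((i, true) : Letter k)}) g)
  refine this.congr fun n => ?_
  rw [← Finset.sum_div, wordLength, ← Wpsi_sum]
  push_cast; rfl

lemma Wcyc_iff (u : FG k) : IsCyclicallyReduced u ↔ FreeGroup.IsCyclicallyReduced u.toWord := by
  unfold IsCyclicallyReduced CyclicallyReducedWord
  rw [← FreeGroup.isReduced_iff_reduce_eq, FreeGroup.IsReduced, List.isChain_append,
    FreeGroup.isCyclicallyReduced_iff, FreeGroup.IsReduced]
  tauto

lemma Wt_cyc {u : FG k} (hu : IsCyclicallyReduced u) : Wt u = wordLength u := by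
  rw [Wcyc_iff] at hu
  refine tendsto_nhds_unique (Wt_tendsto u) (tendsto_const_nhds.congr' ?_)
  filter_upwards [Filter.eventually_gt_atTop 0] with n hn
  have : wordLength (u ^ n) = n * wordLength u := by
    unfold wordLength
    rw [FreeGroup.toWord_pow, (hu.flatten_replicate n).isReduced.reduce_eq]
    simp
  rw [this]
  push_cast
  field_simp

lemma Wt_conj (g x : FG k) : Wt (x * g * x⁻¹) = Wt g := by
  unfold Wt
  exact Finset.sum_congr rfl fun i _ => Wi_conj (WX_ai _) g x

lemma Wexists_cyc (g : FG k) : ∃ x u : FG k, IsCyclicallyReduced u ∧ g = x * u * x⁻¹ ∧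
    wordLength g = wordLength u + 2 * wordLength x := by
  have hg : FreeGroup.IsReduced g.toWord := FreeGroup.isReduced_toWord
  have h1 := FreeGroup.reduceCyclically.conj_conjugator_reduceCyclically g.toWord
  have h2 := FreeGroup.reduceCyclically.isCyclicallyReduced hg
  set c := FreeGroup.reduceCyclically.conjugator g.toWord
  set r := FreeGroup.reduceCyclically g.toWord
  have hc : (FreeGroup.mk c).toWord = c := by
    rw [FreeGroup.toWord_mk]
    exact FreeGroup.IsReduced.reduce_eq (hg.infix ⟨[], r ++ FreeGroup.invRev c, by simpa using h1⟩)
  have hr : (FreeGroup.mk r).toWord = r := by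
    rw [FreeGroup.toWord_mk]
    exact h2.isReduced.reduce_eq
  refine ⟨FreeGroup.mk c, FreeGroup.mk r, ?_, ?_, ?_⟩
  · rw [Wcyc_iff, hr]; exact h2
  · rw [FreeGroup.inv_mk, FreeGroup.mul_mk, FreeGroup.mul_mk, h1, FreeGroup.mk_toWord]
  · unfold wordLength
    rw [hr, hc, ← h1]; simp; ring

lemma WcyclicLength_eq (g : FG k) : (cyclicLength g : ℝ) = Wt g := by
  obtain ⟨x, u, hu, hg, -⟩ := Wexists_cyc g
  have : cyclicLength g ∈
      {n | ∃ x u : FG k, IsCyclicallyReduced u ∧ g = x * u * x⁻¹ ∧ wordLength u = n} :=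
    Nat.sInf_mem ⟨_, x, u, hu, hg, rfl⟩
  obtain ⟨x', u', hu', hg', e⟩ := this
  rw [← e, ← Wt_cyc hu']
  conv_rhs => rw [hg', Wt_conj]

end WhFree

section WhMain
variable {k : ℕ}

structure WF (i : Set (FG k) → ℝ) : Prop where
  sub : ∀ X Y, WAI X → WAI Y → i (X ∩ Y) + i (X ∪ Y) ≤ i X + i Y
  compl : ∀ X, i Xᶜ = i X
  tr : ∀ X g, i (WT X g) = i X
  ae : ∀ X Y, WAI X → WAE X Y → i X = i Y
  same : ∀ P Q : Set (FG k), (∀ h (i : Fin k), ¬ (h ∈ P ↔ FreeGroup.of i * h ∈ P) ↔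
    ¬ (h ∈ Q ↔ FreeGroup.of i * h ∈ Q)) → i P = i Q
  min : ∀ (S : Set (Letter k)) (a : Fin k), ¬ ((a, true) ∈ S ↔ (a, false) ∈ S) →
    i (WX {(a, true)}) ≤ i (WX S)

lemma WF.letter {i : Set (FG k) → ℝ} (hi : WF i) (c : Letter k) :
    i (WX {c}) = i (WX {(c.1, true)}) := by
  obtain ⟨a, b⟩ := c
  cases b
  · simp only
    rw [← hi.tr (WX {(a, true)}) (Wl (a, true))]
    apply hi.same
    intro h j
    rw [← Wl_true, WX_cob]
    have := WX_cob {((a, true) : Letter k)} (j, true) (h * Wl (a, true))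
    simp only [WT, Set.mem_ofPred_eq, mul_assoc] at *
    rw [this]
    have e : Wl (a, true) * h = 1 ↔ h * Wl (a, true) = 1 := mul_eq_one_iff_eq_inv'.trans
      mul_eq_one_iff_eq_inv.symm
    simp only [linv, Set.mem_singleton_iff, Prod.mk.injEq]
    simp only [Bool.not_true, Bool.true_eq_false, Bool.false_eq_true, and_false, and_true, false_or, or_false]
    constructor
    · rintro ⟨h1, rfl⟩; exact ⟨e.1 h1, rfl⟩
    · rintro ⟨h1, rfl⟩; exact ⟨e.2 h1, rfl⟩
  · rfl

noncomputable def Wsi (S : Set (Letter k)) (x : Letter k) : ℤ := by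
  classical exact if x ∈ S then 1 else 0

lemma Wsi_congr {S T : Set (Letter k)} {x y : Letter k} (h : x ∈ S ↔ y ∈ T) : Wsi S x = Wsi T y := by
  unfold Wsi
  by_cases h1 : x ∈ S
  · rw [if_pos h1, if_pos (h.1 h1)]
  · rw [if_neg h1, if_neg (fun h2 => h1 (h.2 h2))]

lemma WnX (S : Set (Letter k)) (a : Fin k) :
    Wn (FreeGroup.of a) (WX S) = Wsi S (a, true) - Wsi S (a, false) := by
  classical
  unfold Wn
  have hne : (1 : FG k) ≠ (FreeGroup.of a)⁻¹ := by
    intro h; exact FreeGroup.of_ne_one a (by simpa using h.symm)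
  rw [finsum_eq_sum_of_support_subset (s := {1, (FreeGroup.of a)⁻¹})]
  · rw [Finset.sum_pair hne]
    have e1 : (1 : FG k) ∉ WX S := WX_one S
    have e2 : FreeGroup.of a ∈ WX S ↔ (a, true) ∈ S := WX_l S (a, true)
    have e3 : (FreeGroup.of a)⁻¹ ∈ WX S ↔ (a, false) ∈ S := WX_l S (a, false)
    simp [Wind, Wsi, e1, e2, e3, sub_eq_add_neg]
  · intro h hh
    have := Wn_supp _ _ hh
    rcases (WX_cob S (a, true) h).1 this with h' | h'
    · simp [h'.1]
    · have : h = (FreeGroup.of a)⁻¹ := eq_inv_of_mul_eq_one_right h'.1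
      simp [this]

lemma Wcone {X : Set (FG k)} (Q : Set (Letter k)) (v : FG k)
    (H : ∀ m x, m ≠ 1 → m ∈ WX Q → Wl x * m ≠ 1 → (m * v ∈ X ↔ Wl x * m * v ∈ X))
    (m : FG k) (y : Letter k) (hy : y ∈ Q) (hm : y ∈ m.toWord.getLast?) :
    m * v ∈ X ↔ Wl y * v ∈ X := by
  generalize hL : m.toWord = L
  induction L generalizing m with
  | nil => rw [hL] at hm; simp at hm
  | cons z L ih =>
    have hr : FreeGroup.IsReduced (z :: L) := hL ▸ FreeGroup.isReduced_toWord
    have hr' : FreeGroup.IsReduced L := hr.infix ⟨[z], [], by simp⟩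
    have e : (FreeGroup.mk L).toWord = L := by rw [FreeGroup.toWord_mk]; exact hr'.reduce_eq
    have hg : m = Wl z * FreeGroup.mk L := by
      rw [← Wmk_cons, ← hL, FreeGroup.mk_toWord]
    by_cases hn : L = []
    · subst hn
      rw [hL] at hm
      have : z = y := by simpa using hm
      rw [hg, this, ← FreeGroup.one_eq_mk, mul_one]
    · have hm' : y ∈ (FreeGroup.mk L).toWord.getLast? := by
        rw [e]; rw [hL, List.getLast?_cons_of_ne_nil hn] at hm; exact hm
      rw [hg, ← H (FreeGroup.mk L) z ?_ ⟨y, hy, hm'⟩ ?_]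
      · exact ih _ hm' e
      · rw [Ne, Wone_eq, e]; exact hn
      · rw [← hg, Ne, Wone_eq, hL]; simp

lemma Wappend (m v : FG k) (c : Letter k) (hv : linv c ∈ v.toWord.head?) (hm : m ∉ WX {c}) :
    (m * v).toWord = m.toWord ++ v.toWord := by
  rw [FreeGroup.toWord_mul]
  apply FreeGroup.IsReduced.reduce_eq
  rw [FreeGroup.IsReduced, List.isChain_append]
  refine ⟨FreeGroup.isReduced_toWord, FreeGroup.isReduced_toWord, ?_⟩
  intro x hx y hy h1
  by_contra h2
  apply hm
  have : y = linv c := by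
    simp only [Option.mem_def] at hv hy
    rw [hv] at hy; exact (Option.some.inj hy).symm
  subst this
  refine ⟨x, ?_, hx⟩
  simp only [linv] at h1 h2
  have : x.2 = c.2 := by cases hx2 : x.2 <;> cases hc2 : c.2 <;> simp_all
  exact Prod.ext h1 this

lemma Wexlast (m : FG k) (hm : m ≠ 1) : ∃ y, y ∈ m.toWord.getLast? := by
  rw [Ne, Wone_eq] at hm
  exact ⟨_, List.getLast?_eq_some_getLast hm⟩

lemma Wsi_ne (S S' : Set (Letter k)) (x y : Letter k) (h4 : x ∈ S → x ∉ S') (h5 : y ∈ S → y ∉ S')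
    (h3 : ¬ (x ∈ S ∪ S' ↔ y ∈ S ∪ S')) : Wsi S x - Wsi S y + (Wsi S' x - Wsi S' y) ≠ 0 := by
  classical
  simp only [Set.mem_union] at h3
  unfold Wsi
  by_cases p1 : x ∈ S <;> by_cases p2 : x ∈ S' <;>
    by_cases p3 : y ∈ S <;> by_cases p4 : y ∈ S' <;>
    simp [p1, p2, p3, p4] at h3 h4 h5 ⊢

set_option maxHeartbeats 1000000 in
lemma Wmain {i : Set (FG k) → ℝ} (hi : WF i) (n : ℕ) : ∀ (K : Finset (FG k)), K.card = n → 1 ∈ K →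
    (∀ h ∈ K, ∀ x L, h.toWord = x :: L → FreeGroup.mk L ∈ K) → ∀ X, WAI X →
    (∀ u, u ∉ K → ∀ x, Wl x * u ∉ K → (u ∈ X ↔ Wl x * u ∈ X)) →
    ∀ a, Wn (FreeGroup.of a) X ≠ 0 → i (WX {(a, true)}) ≤ i X := by
  classical
  induction n using Nat.strong_induction_on with
  | _ n IH =>
  intro K hKn hK1 hKp X hX hXK a ha
  obtain ⟨v, hvK, hvmax⟩ := K.exists_max_image (fun h => h.toWord.length) ⟨1, hK1⟩
  by_cases hv1 : v = 1
  · -- base case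
    have hK : ∀ h ∈ K, h = 1 := by
      intro h hh
      have := hvmax h hh
      rw [hv1] at this
      simp only [FreeGroup.toWord_one, List.length_nil, Nat.le_zero, List.length_eq_zero_iff] at this
      exact Wone_eq.2 this
    have hae : WAE X (WX {x | Wl x ∈ X}) := by
      refine (Set.finite_singleton (1 : FG k)).subset fun h hh => ?_
      by_contra h1
      apply hh
      obtain ⟨y, hy⟩ := Wexlast h h1
      have := Wcone (X := X) Set.univ 1 (fun m x h1 h2 h3 => by
        rw [mul_one, mul_one]
        exact hXK m (fun h => h1 (hK _ h)) x (fun h => h3 (hK _ h))) h y trivial hy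
      rw [mul_one, mul_one] at this
      rw [this]
      constructor
      · intro h; exact ⟨y, h, hy⟩
      · rintro ⟨z, hz, hz'⟩
        rwa [Option.mem_unique hy hz']
    rw [hi.ae _ _ hX hae]
    apply hi.min
    intro h
    apply ha
    rw [← Wn_ae hX hae, WnX]
    simp only [Wsi, h, sub_self]
  -- leaf
  have ⟨x, L, hvw⟩ : ∃ x L, v.toWord = x :: L := by
    cases h : v.toWord with
    | nil => exact absurd (Wone_eq.2 h) hv1
    | cons x L => exact ⟨x, L, rfl⟩
  set c := linv x with hc
  have hxc : linv c = x := by rw [hc, Wlinv_linv]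
  have hvp : Wl c * v ∈ K := by
    have : Wl c * v = FreeGroup.mk L := by
      rw [← FreeGroup.mk_toWord (x := v), hvw, Wmk_cons, hc, Wl_linv, inv_mul_cancel_left]
    rw [this]; exact hKp v hvK x L hvw
  have hvpne : Wl c * v ≠ v := by
    intro h; exact Wl_ne_one c (by simpa using h)
  have hlong : ∀ m, m ∉ WX {c} → m ≠ 1 → m * v ∉ K := by
    intro m h1 h2 h3
    have := hvmax _ h3
    rw [Wappend m v c (by rw [hvw, hxc]; rfl) h1] at this
    apply h2; rw [Wone_eq, ← List.length_eq_zero_iff]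
    simp at this; simpa using this
  set Y : Set (FG k) := WT (WX {c})ᶜ v⁻¹ with hY
  have hYai : WAI Y := (WX_ai _).compl.WT _
  have hvY : v ∈ Y := by
    change v * v⁻¹ ∉ WX {c}
    rw [mul_inv_cancel]; exact WX_one _
  have hYcob : ∀ u, u ∉ K.erase v → ∀ s, Wl s * u ∉ K.erase v → (u ∈ Y ↔ Wl s * u ∈ Y) := by
    intro u hu s hs
    by_contra hcon
    have : ¬ (u * v⁻¹ ∈ WX {c} ↔ Wl s * (u * v⁻¹) ∈ WX {c}) := by
      rw [← mul_assoc]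
      intro h; apply hcon
      change ¬ _ ↔ ¬ _
      rw [h]
    rw [WX_cob] at this
    rcases this with ⟨h1, h2⟩ | ⟨h1, h2⟩
    · have h2 : s = c := h2
      have h1 : u = v := by rwa [mul_inv_eq_one] at h1
      subst h2 h1
      exact hs (Finset.mem_erase.2 ⟨hvpne, hvp⟩)
    · have h2 : linv s = c := h2
      have h1 : Wl s * u = v := by rwa [← mul_assoc, mul_inv_eq_one] at h1
      have : u = Wl c * v := by rw [← h1, ← h2, Wl_linv, inv_mul_cancel_left]
      rw [this] at hu
      exact hu (Finset.mem_erase.2 ⟨hvpne, hvp⟩)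
  have hcard : (K.erase v).card < n := by
    rw [← hKn]; exact Finset.card_erase_lt_of_mem hvK
  have hK1' : 1 ∈ K.erase v := Finset.mem_erase.2 ⟨Ne.symm hv1, hK1⟩
  have hKp' : ∀ h ∈ K.erase v, ∀ x L, h.toWord = x :: L → FreeGroup.mk L ∈ K.erase v := by
    intro h hh x L hw
    have hhK := Finset.mem_of_mem_erase hh
    refine Finset.mem_erase.2 ⟨?_, hKp h hhK x L hw⟩
    intro e
    have h1 := hvmax h hhK
    rw [← e, FreeGroup.toWord_mk] at h1
    have h2 : (FreeGroup.reduce L).length ≤ L.length := FreeGroup.norm_mk_le (L₁ := L)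
    rw [hw] at h1
    simp at h1
    omega
  have hmem : ∀ u, u ∉ K.erase v → u ∉ Y → u ∉ K := by
    intro u h1 h2 h3
    exact h1 (Finset.mem_erase.2 ⟨fun h => h2 (h ▸ hvY), h3⟩)
  have IH1 : ∀ b, Wn (FreeGroup.of b) (X ∪ Y) ≠ 0 → i (WX {(b, true)}) ≤ i (X ∪ Y) := by
    refine IH _ hcard _ rfl hK1' hKp' _ (hX.union hYai) fun u hu s hs => ?_
    have h1 := hYcob u hu s hs
    by_cases h2 : u ∈ Y
    · simp only [Set.mem_union, h2, h1.1 h2, or_true]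
    · have h3 : Wl s * u ∉ Y := fun h => h2 (h1.2 h)
      simp only [Set.mem_union, h2, h3, or_false]
      exact hXK u (hmem _ hu h2) s (hmem _ hs h3)
  have IH2 : ∀ b, Wn (FreeGroup.of b) (X ∩ Yᶜ) ≠ 0 → i (WX {(b, true)}) ≤ i (X ∩ Yᶜ) := by
    refine IH _ hcard _ rfl hK1' hKp' _ (hX.inter hYai.compl) fun u hu s hs => ?_
    have h1 := hYcob u hu s hs
    by_cases h2 : u ∈ Y
    · simp only [Set.mem_inter_iff, Set.mem_compl_iff, h2, h1.1 h2, not_true, and_false]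
    · have h3 : Wl s * u ∉ Y := fun h => h2 (h1.2 h)
      simp only [Set.mem_inter_iff, Set.mem_compl_iff, h2, h3, not_false_eq_true, and_true]
      exact hXK u (hmem _ hu h2) s (hmem _ hs h3)
  set S : Set (Letter k) := {y | y ≠ c ∧ Wl y * v ∈ X} with hS
  set S' : Set (Letter k) := {y | y ≠ c ∧ Wl y * v ∉ X} with hS'
  have hcone : ∀ h y, y ≠ c → y ∈ (h * v⁻¹).toWord.getLast? → (h ∈ X ↔ Wl y * v ∈ X) := by
    intro h y hyc hy
    have hnot : ∀ m, m ∈ WX {y : Letter k | y ≠ c} → m ∉ WX {c} := by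
      rintro m ⟨y, h1, h2⟩ ⟨z, h3, h4⟩
      exact h1 ((Option.mem_unique h2 h4).trans h3)
    have := Wcone (X := X) {y | y ≠ c} v (fun m s h1 h2 h3 => by
      rw [mul_assoc]
      refine hXK _ (hlong m (hnot m h2) h1) s ?_
      rw [← mul_assoc]
      exact hlong _ (hnot _ ((WX_iff _ s m h1 h3).2 h2)) h3) (h * v⁻¹) y hyc hy
    rwa [inv_mul_cancel_right] at this
  have hYmem : ∀ h y, y ∈ (h * v⁻¹).toWord.getLast? → (h ∈ Y ↔ y ≠ c) := by
    intro h y hy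
    change ¬ _ ↔ _
    refine not_congr ⟨?_, ?_⟩
    · rintro ⟨z, hz, hz'⟩
      exact (Option.mem_unique hy hz').trans hz
    · intro h; exact ⟨y, h, hy⟩
  have hTmem : ∀ h y, y ∈ (h * v⁻¹).toWord.getLast? → ∀ S, (h ∈ WT (WX S) v⁻¹ ↔ y ∈ S) := by
    intro h y hy S
    constructor
    · rintro ⟨z, hz, hz'⟩
      rwa [Option.mem_unique hy hz']
    · intro h; exact ⟨y, h, hy⟩
  have hae1 : WAE (WT (WX S) v⁻¹) (X ∩ Y) := by
    refine (Set.finite_singleton v).subset fun h hh => ?_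
    by_contra h1
    apply hh
    obtain ⟨y, hy⟩ := Wexlast (h * v⁻¹) (fun h' => h1 (by rwa [mul_inv_eq_one] at h'))
    rw [hTmem h y hy, Set.mem_inter_iff, hYmem h y hy]
    constructor
    · rintro ⟨h2, h3⟩; exact ⟨(hcone h y h2 hy).2 h3, h2⟩
    · rintro ⟨h3, h2⟩; exact ⟨h2, (hcone h y h2 hy).1 h3⟩
  have hae2 : WAE (WT (WX S') v⁻¹) (X ∪ Yᶜ)ᶜ := by
    refine (Set.finite_singleton v).subset fun h hh => ?_
    by_contra h1
    apply hh
    obtain ⟨y, hy⟩ := Wexlast (h * v⁻¹) (fun h' => h1 (by rwa [mul_inv_eq_one] at h'))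
    rw [hTmem h y hy, Set.mem_compl_iff, Set.mem_union, Set.mem_compl_iff, hYmem h y hy]
    constructor
    · rintro ⟨h2, h3⟩
      have := (hcone h y h2 hy)
      tauto
    · intro h3
      have h2 : y ≠ c := by tauto
      have := (hcone h y h2 hy)
      exact ⟨h2, by tauto⟩
  have hS_ai : WAI (WT (WX S) v⁻¹) := (WX_ai _).WT _
  have hS'_ai : WAI (WT (WX S') v⁻¹) := (WX_ai _).WT _
  have iS : i (X ∩ Y) = i (WX S) := by rw [← hi.ae _ _ hS_ai hae1, hi.tr]
  have iS' : i (X ∪ Yᶜ) = i (WX S') := by rw [← hi.compl, ← hi.ae _ _ hS'_ai hae2, hi.tr]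
  have iY : i Y = i (WX {(c.1, true)}) := by rw [hY, hi.tr, hi.compl, hi.letter]
  have sub1 := hi.sub X Y hX hYai
  have sub2 := hi.sub X Yᶜ hX hYai.compl
  rw [iS, iY] at sub1
  rw [iS', hi.compl, iY] at sub2
  have n1 : ∀ b, Wn (FreeGroup.of b) (X ∪ Y) = Wn (FreeGroup.of b) X +
      (Wsi S' (b, true) - Wsi S' (b, false)) := by
    intro b
    rw [← WnX, ← Wn_WT (WX S') v⁻¹, ← Wn_ae hS'_ai hae2]
    refine Wn_union hX (hX.union hYai.compl).compl (fun h => ?_) _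
    simp only [Wind, Set.mem_union, Set.mem_compl_iff]
    by_cases h1 : h ∈ X <;> by_cases h2 : h ∈ Y <;> simp [h1, h2]
  have n2 : ∀ b, Wn (FreeGroup.of b) X = Wn (FreeGroup.of b) (X ∩ Yᶜ) +
      (Wsi S (b, true) - Wsi S (b, false)) := by
    intro b
    rw [← WnX, ← Wn_WT (WX S) v⁻¹, ← Wn_ae hS_ai hae1]
    refine Wn_union (hX.inter hYai.compl) (hX.inter hYai) (fun h => ?_) _
    simp only [Wind, Set.mem_inter_iff, Set.mem_compl_iff]
    by_cases h1 : h ∈ X <;> by_cases h2 : h ∈ Y <;> simp [h1, h2]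
  have hcS : c ∉ S := fun h => h.1 rfl
  have hcS' : c ∉ S' := fun h => h.1 rfl
  have hlc : linv c ∈ S ∨ linv c ∈ S' := by
    by_cases h : Wl (linv c) * v ∈ X
    · exact Or.inl ⟨Wlinv_ne c, h⟩
    · exact Or.inr ⟨Wlinv_ne c, h⟩
  have hdisj : ∀ y, y ∈ S → y ∉ S' := fun y h h' => h'.2 h.2
  have hSS : ∀ y, y ≠ c → (y ∈ S' ↔ y ∉ S) := by
    intro y hy
    simp only [hS, hS', Set.mem_ofPred_eq]
    tauto
  have hsplit : ∀ (T : Set (Letter k)), c ∉ T → linv c ∈ T →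
      ¬ ((c.1, true) ∈ T ↔ (c.1, false) ∈ T) := by
    intro T h1 h2
    obtain ⟨j, b⟩ := c
    cases b <;> simp only [linv, Bool.not_true, Bool.not_false] at h1 h2 <;> simp [h1, h2]
  -- c-count
  have ncc : Wn (FreeGroup.of c.1) (X ∪ Y) ≠ 0 ∨ Wn (FreeGroup.of c.1) (X ∩ Yᶜ) ≠ 0 := by
    by_contra hcon
    push Not at hcon
    have e1 := n1 c.1
    have e2 := n2 c.1
    rw [hcon.1] at e1
    rw [hcon.2] at e2
    have h3 : ¬ ((c.1, true) ∈ S ∪ S' ↔ (c.1, false) ∈ S ∪ S') :=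
      hsplit _ (fun h => h.elim hcS hcS') hlc
    exact Wsi_ne S S' _ _ (hdisj _) (hdisj _) h3 (by linarith)
  have fin : a ≠ c.1 → ¬ ((a, true) ∈ S ↔ (a, false) ∈ S) →
      i (WX {(a, true)}) ≤ i X := by
    intro hac h1
    have t1 := hSS (a, true) (fun h => hac (congrArg Prod.fst h))
    have t2 := hSS (a, false) (fun h => hac (congrArg Prod.fst h))
    have h2 : ¬ ((a, true) ∈ S' ↔ (a, false) ∈ S') := by rw [t1, t2]; tauto
    have m1 := hi.min S a h1
    have m2 := hi.min S' a h2
    rcases ncc with h | h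
    · have := IH1 _ h; linarith
    · have := IH2 _ h; linarith
  have hane : ∀ T : Set (Letter k), c ∉ T → linv c ∉ T → ¬ ((a, true) ∈ T ↔ (a, false) ∈ T) →
      a ≠ c.1 := by
    rintro T h1 h2 h3 rfl
    apply h3
    obtain ⟨j, b⟩ := c
    cases b <;> simp only [linv, Bool.not_true, Bool.not_false] at h1 h2 <;> simp [h1, h2]
  rcases hlc with hl | hl
  · by_cases hz : Wn (FreeGroup.of a) (X ∪ Y) = 0
    · have h2 : ¬ ((a, true) ∈ S' ↔ (a, false) ∈ S') := by
        intro h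
        have := n1 a
        have e : Wsi S' (a, true) = Wsi S' (a, false) := Wsi_congr h
        exact ha (by linarith)
      have hac := hane S' hcS' (hdisj _ hl) h2
      apply fin hac
      have t1 := hSS (a, true) (fun h => hac (congrArg Prod.fst h))
      have t2 := hSS (a, false) (fun h => hac (congrArg Prod.fst h))
      rw [t1, t2] at h2; tauto
    · have := IH1 a hz
      have := hi.min S c.1 (hsplit S hcS hl)
      linarith
  · by_cases hz : Wn (FreeGroup.of a) (X ∩ Yᶜ) = 0
    · have h2 : ¬ ((a, true) ∈ S ↔ (a, false) ∈ S) := by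
        intro h
        have := n2 a
        have e : Wsi S (a, true) = Wsi S (a, false) := Wsi_congr h
        exact ha (by linarith)
      exact fin (hane S hcS (fun h => hdisj _ h hl) h2) h2
    · have := IH2 a hz
      have := hi.min S' c.1 (hsplit S' hcS' hl)
      linarith

lemma Wmain' {i : Set (FG k) → ℝ} (hi : WF i) {X : Set (FG k)} (hX : WAI X) (a : Fin k)
    (ha : Wn (FreeGroup.of a) X ≠ 0) : i (WX {(a, true)}) ≤ i X := by
  classical
  have hfin : (⋃ x : Letter k, WCob X (Wl x)).Finite := Set.finite_iUnion fun x => hX _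
  let B := insert 1 hfin.toFinset
  let K := B.biUnion fun b => (b.toWord.tails.toFinset.image FreeGroup.mk)
  have hK : ∀ h, h ∈ K ↔ ∃ b ∈ B, ∃ t, t <:+ b.toWord ∧ FreeGroup.mk t = h := by
    intro h; simp [K]
  have hBK : ∀ b ∈ B, b ∈ K := fun b hb =>
    (hK b).2 ⟨b, hb, b.toWord, List.suffix_refl _, FreeGroup.mk_toWord⟩
  refine Wmain hi _ K rfl (hBK 1 (by simp [B])) ?_ X hX ?_ a ha
  · intro h hh x L hw
    obtain ⟨b, hb, t, ht, rfl⟩ := (hK h).1 hh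
    have hr : FreeGroup.IsReduced t := FreeGroup.isReduced_toWord.infix ht.isInfix
    rw [FreeGroup.toWord_mk, hr.reduce_eq] at hw
    refine (hK _).2 ⟨b, hb, L, ?_, rfl⟩
    rw [hw] at ht
    exact (List.suffix_cons x L).trans ht
  · intro u hu x _
    by_contra hcon
    apply hu
    apply hBK
    simp only [B, Finset.mem_insert, Set.Finite.mem_toFinset, Set.mem_iUnion]
    exact Or.inr ⟨x, hcon⟩

end WhMain

section WhPerm
variable {k : ℕ}

lemma Wn_one {X : Set (FG k)} (hX : WAI X) : Wn 1 X = 0 := by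
  have := Wn_mul hX 1 1
  rw [one_mul] at this; linarith

lemma Wn_inv {X : Set (FG k)} (hX : WAI X) (g : FG k) : Wn g⁻¹ X = - Wn g X := by
  have := Wn_mul hX g g⁻¹
  rw [mul_inv_cancel, Wn_one hX] at this; linarith

/-- exponent sum -/
noncomputable def We (b : Fin k) (g : FG k) : ℤ := Wn g (WX {(b, true)})

lemma We_mul (b : Fin k) (g h : FG k) : We b (g * h) = We b g + We b h := Wn_mul (WX_ai _) g h
lemma We_one (b : Fin k) : We b 1 = 0 := Wn_one (WX_ai _)
lemma We_inv (b : Fin k) (g : FG k) : We b g⁻¹ = - We b g := Wn_inv (WX_ai _) g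
lemma We_of (b a : Fin k) : We b (FreeGroup.of a) = if a = b then 1 else 0 := by
  classical
  rw [We, WnX]
  unfold Wsi
  by_cases h : a = b <;> simp [h]

lemma We_zpow (b : Fin k) (g : FG k) (n : ℤ) : We b (g ^ n) = n * We b g := by
  have hp : ∀ m : ℕ, We b (g ^ m) = m * We b g := by
    intro m
    induction m with
    | zero => simp [We_one]
    | succ m ih => rw [pow_succ, We_mul, ih]; push_cast; ring
  cases n with
  | ofNat m => simpa using hp m
  | negSucc m => rw [zpow_negSucc, We_inv, hp, Int.negSucc_eq]; push_cast; ring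

lemma We_conj (b : Fin k) (g h : FG k) : We b (g * h * g⁻¹) = We b h := by
  rw [We_mul, We_mul, We_inv]; ring

lemma We_aut (α : MulAut (FG k)) (b : Fin k) (g : FG k) :
    We b (α g) = ∑ c, We c g * We b (α (FreeGroup.of c)) := by
  refine FreeGroup.induction_on g ?_ ?_ ?_ ?_
  · simp [We_one]
  · intro i
    simp [We_of]
  · intro i _
    change We b (α (FreeGroup.of i)⁻¹) = ∑ c, We c (FreeGroup.of i)⁻¹ * _
    rw [map_inv, We_inv]
    simp [We_inv, We_of]
  · intro x y hx hy
    rw [map_mul, We_mul, hx, hy, ← Finset.sum_add_distrib]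
    exact Finset.sum_congr rfl fun c _ => by rw [We_mul]; ring

lemma Wperm (α : MulAut (FG k)) : ∃ σ : Equiv.Perm (Fin k), ∀ b, We b (α (FreeGroup.of (σ b))) ≠ 0 := by
  classical
  let M : MulAut (FG k) → Matrix (Fin k) (Fin k) ℤ := fun α => Matrix.of fun a b => We b (α (FreeGroup.of a))
  have h1 : M α⁻¹ * M α = 1 := by
    ext a b
    rw [Matrix.mul_apply]
    change ∑ c, We c (α⁻¹ (FreeGroup.of a)) * We b (α (FreeGroup.of c)) = _
    rw [← We_aut, MulAut.apply_inv_self, We_of, Matrix.one_apply]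
  have h2 : (M α).det ≠ 0 := by
    intro h
    have := congrArg Matrix.det h1
    rw [Matrix.det_mul, h, Matrix.det_one] at this
    simp at this
  by_contra hcon
  push Not at hcon
  apply h2
  rw [Matrix.det_apply]
  refine Finset.sum_eq_zero fun σ _ => ?_
  obtain ⟨b, hb⟩ := hcon σ
  rw [Finset.prod_eq_zero (Finset.mem_univ b) hb, smul_zero]

lemma Wsum_le {i : Set (FG k) → ℝ} (hi : WF i) (α : MulAut (FG k)) :
    ∑ a, i (WX {(a, true)}) ≤ ∑ b, i {h | α h ∈ WX {(b, true)}} := by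
  obtain ⟨σ, hσ⟩ := Wperm α
  rw [← Equiv.sum_comp σ]
  refine Finset.sum_le_sum fun b _ => Wmain' hi ((WX_ai _).pre α) _ ?_
  rw [Wn_pre]; exact hσ b

lemma Wt_inv (g : FG k) : Wt g⁻¹ = Wt g := by
  unfold Wt
  refine Finset.sum_congr rfl fun i _ => Wi_congr fun n => ?_
  rw [inv_pow, Wpsi_inv]

noncomputable def WwhF (S : Set (Letter k)) (i : Fin k) (e : ℤ) : FG k →* FG k :=
  FreeGroup.lift fun j => if j = i then FreeGroup.of i else
    FreeGroup.of i ^ (- e * Wsi S (j, false)) * FreeGroup.of j * FreeGroup.of i ^ (e * Wsi S (j, true))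

lemma WwhF_of (S : Set (Letter k)) (i : Fin k) (e : ℤ) (j : Fin k) :
    WwhF S i e (FreeGroup.of j) = if j = i then FreeGroup.of i else
    FreeGroup.of i ^ (- e * Wsi S (j, false)) * FreeGroup.of j * FreeGroup.of i ^ (e * Wsi S (j, true)) := by
  simp [WwhF]

lemma WwhF_inv (S : Set (Letter k)) (i : Fin k) (e : ℤ) :
    (WwhF S i e).comp (WwhF S i (-e)) = MonoidHom.id _ := by
  ext j
  simp only [MonoidHom.comp_apply, MonoidHom.id_apply]
  rw [WwhF_of]
  split_ifs with h
  · rw [WwhF_of, if_pos rfl, h]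
  · rw [map_mul, map_mul, map_zpow, map_zpow, WwhF_of, if_pos rfl, WwhF_of, if_neg h]
    simp only [neg_mul, neg_neg, mul_assoc]
    rw [← zpow_add, ← mul_assoc, ← zpow_add]
    simp

noncomputable def Wwh (S : Set (Letter k)) (i : Fin k) : MulAut (FG k) :=
  MonoidHom.toMulEquiv (WwhF S i 1) (WwhF S i (-1))
    (by have := WwhF_inv S i (-1); rwa [neg_neg] at this) (WwhF_inv S i 1)

lemma Wwh_self (S : Set (Letter k)) (i : Fin k) : Wwh S i (FreeGroup.of i) = FreeGroup.of i := by
  change WwhF S i 1 (FreeGroup.of i) = _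
  rw [WwhF_of, if_pos rfl]

lemma Wwh_of (S : Set (Letter k)) (i j : Fin k) (h : j ≠ i) : Wwh S i (FreeGroup.of j) =
    FreeGroup.of i ^ (- Wsi S (j, false)) * FreeGroup.of j * FreeGroup.of i ^ (Wsi S (j, true)) := by
  change WwhF S i 1 (FreeGroup.of j) = _
  rw [WwhF_of, if_neg h]; simp

lemma Wsi_cases (S : Set (Letter k)) (x : Letter k) :
    (x ∈ S ∧ Wsi S x = 1) ∨ (x ∉ S ∧ Wsi S x = 0) := by
  unfold Wsi
  by_cases h : x ∈ S <;> simp [h]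

lemma Wwh_wh (S : Set (Letter k)) (i : Fin k) : IsWhitehead2 (Wwh S i) := by
  refine ⟨FreeGroup.of i, ⟨i, Or.inl rfl⟩, Wwh_self S i, ?_⟩
  rintro x ⟨j, rfl | rfl⟩
  · by_cases h : j = i
    · left; rw [h, Wwh_self]
    · rw [Wwh_of _ _ _ h]
      rcases Wsi_cases S (j, true) with ⟨-, h1⟩ | ⟨-, h1⟩ <;>
      rcases Wsi_cases S (j, false) with ⟨-, h2⟩ | ⟨-, h2⟩ <;> simp [h1, h2]
  · by_cases h : j = i
    · left; rw [h, map_inv, Wwh_self]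
    · rw [map_inv, Wwh_of _ _ _ h]
      rcases Wsi_cases S (j, true) with ⟨-, h1⟩ | ⟨-, h1⟩ <;>
      rcases Wsi_cases S (j, false) with ⟨-, h2⟩ | ⟨-, h2⟩ <;> simp [h1, h2, mul_assoc]

lemma WL1 (i : Fin k) (H : FG k) : ¬ (H ∈ WX {(i, true)} ↔ FreeGroup.of i * H ∈ WX {(i, true)}) ↔ H = 1 := by
  rw [← Wl_true, WX_cob]; simp [linv]

lemma WL2 (i : Fin k) (H : FG k) :
    ¬ (H ∈ WX {(i, true)} ↔ (FreeGroup.of i)⁻¹ * H ∈ WX {(i, true)}) ↔ H = FreeGroup.of i := by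
  have := WL1 i ((FreeGroup.of i)⁻¹ * H)
  rw [mul_inv_cancel_left, inv_mul_eq_one] at this
  rw [eq_comm (a := H), ← this]
  tauto

lemma Wprop1 {p0 p1 p2 p3 a b : Prop} (l1 : ¬ (p0 ↔ p1) ↔ a) (l3 : p2 ↔ p1) (l2 : ¬ (p2 ↔ p3) ↔ b)
    (hne : ¬ (a ∧ b)) : ¬ (p0 ↔ p3) ↔ a ∨ b := by
  by_cases p0 <;> by_cases p1 <;> by_cases p2 <;> by_cases p3 <;> simp_all

lemma WL3 (i j : Fin k) (h : j ≠ i) (H : FG k) :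
    (FreeGroup.of j * H ∈ WX {(i, true)}) ↔ H ∈ WX {(i, true)} := by
  have := WX_cob {((i, true) : Letter k)} (j, true) H
  simp only [linv, Set.mem_singleton_iff, Prod.mk.injEq, h, false_and, and_false, or_false, iff_false,
    not_not] at this
  exact this.symm

lemma WL3z (i j : Fin k) (h : j ≠ i) (n : ℤ) (H : FG k) :
    (FreeGroup.of j ^ n * H ∈ WX {(i, true)}) ↔ H ∈ WX {(i, true)} := by
  induction n generalizing H with
  | zero => simp
  | succ n ih => rw [add_comm, zpow_add, mul_assoc, zpow_one, WL3 i j h, ih]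
  | pred n ih =>
    rw [sub_eq_add_neg, add_comm, zpow_add, mul_assoc, ← WL3 i j h, zpow_neg_one, mul_inv_cancel_left, ih]

lemma Wwh_i (S : Set (Letter k)) (i : Fin k) (h1 : (i, true) ∈ S) (h2 : (i, false) ∉ S) (u : FG k) :
    Wi u {h | Wwh S i h ∈ WX {(i, true)}} = Wi u (WX S) := by
  apply Wi_same
  intro h j
  rw [← Wl_true, WX_cob, Wl_true]
  simp only [Set.mem_ofPred_eq]
  have hH : Wwh S i h = 1 ↔ h = 1 := map_eq_one_iff _ (Wwh S i).injective
  have hH2 : Wwh S i (FreeGroup.of j * h) = 1 ↔ FreeGroup.of j * h = 1 :=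
    map_eq_one_iff _ (Wwh S i).injective
  by_cases hj : j = i
  · subst hj
    rw [map_mul, Wwh_self, WL1, hH]
    simp [linv, h1, h2]
  · have hne : ¬ (h = 1 ∧ FreeGroup.of j * h = 1) := by
      rintro ⟨rfl, h⟩; exact FreeGroup.of_ne_one j (by simp at h)
    rw [map_mul, Wwh_of _ _ _ hj] at hH2 ⊢
    have l1 := WL1 i (Wwh S i h)
    have l2 := WL2 i (FreeGroup.of j * (FreeGroup.of i ^ (Wsi S (j, true)) * Wwh S i h))
    have l3 := WL3 i j hj (FreeGroup.of i ^ (Wsi S (j, true)) * Wwh S i h)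
    rw [hH] at l1
    simp only [linv, Bool.not_true]
    rcases Wsi_cases S (j, false) with ⟨q2, h2⟩ | ⟨q2, h2⟩
    · rw [h2, zpow_neg_one, mul_assoc, mul_assoc] at hH2 ⊢
      rw [inv_mul_eq_one, eq_comm] at hH2
      rw [hH2] at l2
      rcases Wsi_cases S (j, true) with ⟨q1, h1⟩ | ⟨q1, h1⟩
      · rw [h1, zpow_one] at l2 l3 ⊢
        simp only [q1, q2, and_true]
        exact Wprop1 l1 l3 l2 hne
      · rw [h1, zpow_zero, one_mul] at l2 l3 ⊢
        simp only [q1, q2, and_true, and_false, false_or]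
        rw [l3] at l2
        exact l2
    · rw [h2, neg_zero, zpow_zero, one_mul, mul_assoc]
      rcases Wsi_cases S (j, true) with ⟨q1, h1⟩ | ⟨q1, h1⟩
      · rw [h1, zpow_one] at l3 ⊢
        simp only [q1, q2, and_true, and_false, or_false]
        rw [l3]; exact l1
      · rw [h1, zpow_zero, one_mul] at l3 ⊢
        simp only [q1, q2, and_false, or_false]
        rw [l3]; simp

lemma Wwh_j (S : Set (Letter k)) (i j : Fin k) (hj : j ≠ i) (u : FG k) :
    Wi u {h | Wwh S i h ∈ WX {(j, true)}} = Wi u (WX {(j, true)}) := by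
  rw [← Wi_WT (WX {(j, true)}) (FreeGroup.of i ^ (Wsi S (j, true)))]
  apply Wi_same
  intro h l
  simp only [WT, Set.mem_ofPred_eq, map_mul, mul_assoc]
  by_cases hl : l = j
  · subst hl
    rw [WL1, Wwh_of _ _ _ hj, mul_assoc, mul_assoc, WL3z _ _ hj.symm]
    have := WL1 l (FreeGroup.of i ^ Wsi S (l, true) * Wwh S i h)
    rw [WL3z _ _ hj.symm] at this
    rw [this]
    have e : FreeGroup.of i ^ Wsi S (l, true) * Wwh S i h = Wwh S i (FreeGroup.of i ^ Wsi S (l, true) * h) := by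
      rw [map_mul, map_zpow, Wwh_self]
    rw [e, map_eq_one_iff _ (Wwh S i).injective]
    exact mul_eq_one_iff_eq_inv'.trans mul_eq_one_iff_eq_inv.symm
  · rw [WL3 _ _ hl]
    by_cases hli : l = i
    · subst hli
      rw [Wwh_self, WL3 _ _ hl]; simp
    · rw [Wwh_of _ _ _ hli, mul_assoc, mul_assoc, WL3z _ _ hj.symm, WL3 _ _ hl, WL3z _ _ hj.symm]; simp

lemma Wwh_t (S : Set (Letter k)) (i : Fin k) (h1 : (i, true) ∈ S) (h2 : (i, false) ∉ S) (u : FG k) :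
    Wt (Wwh S i u) - Wt u = Wi u (WX S) - Wi u (WX {(i, true)}) := by
  classical
  unfold Wt
  rw [← Finset.sum_sub_distrib]
  simp only [← Wi_pre]
  rw [Finset.sum_eq_single i, Wwh_i S i h1 h2]
  · intro b _ hb
    rw [Wwh_j S i b hb, sub_self]
  · simp

lemma WX_compl (S : Set (Letter k)) (u : FG k) : Wi u (WX Sᶜ) = Wi u (WX S) := by
  rw [← Wi_compl u (WX S)]
  apply Wi_ae (WX_ai _)
  refine (Set.finite_singleton (1 : FG k)).subset fun h hh => ?_
  by_contra h1
  apply hh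
  obtain ⟨y, hy⟩ := Wexlast h h1
  constructor
  · rintro ⟨z, hz, hz'⟩ ⟨z2, hz2, hz2'⟩
    rw [Option.mem_unique hz' hz2'] at hz
    exact hz hz2
  · intro h; exact ⟨y, fun h' => h ⟨y, h', hy⟩, hy⟩

lemma Wdich {w : FG k} (hw : w ∈ SM k) (S : Set (Letter k)) (i : Fin k)
    (hS : ¬ ((i, true) ∈ S ↔ (i, false) ∈ S)) :
    (∀ u, Wi u (WX {(i, true)}) = Wi u (WX S)) ∨ Wi w (WX {(i, true)}) < Wi w (WX S) := by
  have main : ∀ S : Set (Letter k), (i, true) ∈ S → (i, false) ∉ S → 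
      (∀ u, Wi u (WX {(i, true)}) = Wi u (WX S)) ∨ Wi w (WX {(i, true)}) < Wi w (WX S) := by
    intro S h1 h2
    by_cases hin : IsInner (Wwh S i)
    · left
      intro u
      have := Wwh_t S i h1 h2 u
      obtain ⟨g, hg⟩ := hin
      rw [hg, MulAut.conj_apply, Wt_conj] at this
      linarith
    · right
      have := Wwh_t S i h1 h2 w
      have h3 := hw.2 _ (Wwh_wh S i) hin
      have h4 := WcyclicLength_eq (Wwh S i w)
      rw [← h4, Wt_cyc hw.1] at this
      have : (wordLength w : ℝ) < cyclicLength (Wwh S i w) := by exact_mod_cast h3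
      linarith
  by_cases h1 : (i, true) ∈ S
  · exact main S h1 (by tauto)
  · have := main Sᶜ h1 (by simp only [Set.mem_compl_iff]; tauto)
    simpa only [WX_compl] using this

lemma Wexists_WF {w : FG k} (hw : w ∈ SM k) (u : FG k) : ∃ N : ℝ, 0 ≤ N ∧
    WF (fun X => N * Wi w X + Wi u X) := by
  classical
  have hex : ∀ p : Set (Letter k) × Fin k, ∃ N : ℝ, 0 ≤ N ∧ ∀ N' ≥ N,
      ¬ ((p.2, true) ∈ p.1 ↔ (p.2, false) ∈ p.1) →
      N' * Wi w (WX {(p.2, true)}) + Wi u (WX {(p.2, true)}) ≤ N' * Wi w (WX p.1) + Wi u (WX p.1) := by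
    rintro ⟨S, i⟩
    by_cases hS : ¬ ((i, true) ∈ S ↔ (i, false) ∈ S)
    · rcases Wdich hw S i hS with h | h
      · exact ⟨0, le_rfl, fun N' _ _ => by rw [h, h]⟩
      · refine ⟨|Wi u (WX {(i, true)}) - Wi u (WX S)| / (Wi w (WX S) - Wi w (WX {(i, true)})), ?_, ?_⟩
        · have := sub_pos.2 h; positivity
        · intro N' hN' _
          have := sub_pos.2 h
          rw [ge_iff_le, div_le_iff₀ this] at hN'
          have := le_abs_self (Wi u (WX {(i, true)}) - Wi u (WX S))
          simp only; linarith
    · exact ⟨0, le_rfl, fun _ _ h => absurd h hS⟩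
  choose N hN0 hN using hex
  have := Fintype.ofFinite (Set (Letter k) × Fin k)
  have hM : 0 ≤ ∑ p, N p := Finset.sum_nonneg fun p _ => hN0 p
  refine ⟨∑ p, N p, hM, ?_, ?_, ?_, ?_, ?_, ?_⟩
  · intro X Y hX hY
    have h1 := Wi_submod hX hY w
    have h2 := Wi_submod hX hY u
    nlinarith [mul_le_mul_of_nonneg_left h1 hM]
  · intro X; simp only [Wi_compl]
  · intro X g; simp only [Wi_WT]
  · intro X Y hX h; simp only [Wi_ae hX h]
  · intro P Q H; simp only [Wi_same H]
  · intro S a h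
    exact hN (S, a) _ (Finset.single_le_sum (fun p _ => hN0 p) (Finset.mem_univ _)) h

lemma Wt_le {w : FG k} (hw : w ∈ SM k) (α : MulAut (FG k)) (hα : Wt (α w) = Wt w) (u : FG k) :
    Wt u ≤ Wt (α u) := by
  obtain ⟨N, -, hN⟩ := Wexists_WF hw u
  have := Wsum_le hN α
  simp only [Wi_pre, Finset.sum_add_distrib, ← Finset.mul_sum] at this
  change N * Wt w + Wt u ≤ N * Wt (α w) + Wt (α u) at this
  rw [hα] at this; linarith

lemma Wt_eq {w : FG k} (hw : w ∈ SM k) (α : MulAut (FG k)) (hα : Wt (α w) = Wt w) (u : FG k) :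
    Wt (α⁻¹ u) ≤ Wt u := by
  have := Wt_le hw α hα (α⁻¹ u)
  rwa [MulAut.apply_inv_self] at this

end WhPerm

section WhStruct
variable {k : ℕ}

lemma Wcat (g h : FG k) (H : ∀ x ∈ g.toWord.getLast?, ∀ y ∈ h.toWord.head?, y ≠ linv x) :
    (g * h).toWord = g.toWord ++ h.toWord := by
  rw [FreeGroup.toWord_mul]
  apply FreeGroup.IsReduced.reduce_eq
  rw [FreeGroup.IsReduced, List.isChain_append]
  refine ⟨FreeGroup.isReduced_toWord, FreeGroup.isReduced_toWord, ?_⟩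
  intro x hx y hy h1
  by_contra h2
  refine H x hx y hy (Prod.ext h1.symm ?_)
  simp only [linv]
  cases hx2 : x.2 <;> cases hy2 : y.2 <;> simp_all

lemma Whead_inv (g : FG k) (y : Letter k) : y ∈ (g⁻¹).toWord.head? ↔ linv y ∈ g.toWord.getLast? := by
  have := Wlast_inv g⁻¹ (linv y)
  rw [inv_inv, Wlinv_linv] at this
  exact this.symm

lemma Whead_dec (g : FG k) (hg : g ≠ 1) : ∃ s g', g = Wl s * g' ∧ g.toWord = s :: g'.toWord := by
  cases h : g.toWord with
  | nil => exact absurd (Wone_eq.2 h) hg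
  | cons s L =>
    have hr : FreeGroup.IsReduced (s :: L) := h ▸ FreeGroup.isReduced_toWord
    have hr' : FreeGroup.IsReduced L := hr.infix ⟨[s], [], by simp⟩
    refine ⟨s, FreeGroup.mk L, ?_, ?_⟩
    · rw [← Wmk_cons, ← h, FreeGroup.mk_toWord]
    · rw [FreeGroup.toWord_mk, hr'.reduce_eq]

lemma Wlast_dec (g : FG k) (hg : g ≠ 1) : ∃ s g', g = g' * Wl s ∧ g.toWord = g'.toWord ++ [s] := by
  have h0 : g.toWord ≠ [] := fun h => hg (Wone_eq.2 h)
  obtain ⟨L, s, h⟩ : ∃ L s, g.toWord = L ++ [s] :=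
    ⟨_, _, (List.dropLast_append_getLast h0).symm⟩
  have hr : FreeGroup.IsReduced (L ++ [s]) := h ▸ FreeGroup.isReduced_toWord
  have hr' : FreeGroup.IsReduced L := hr.infix ⟨[], [s], by simp⟩
  refine ⟨s, FreeGroup.mk L, ?_, ?_⟩
  · rw [Wl, FreeGroup.mul_mk, ← h, FreeGroup.mk_toWord]
  · rw [FreeGroup.toWord_mk, hr'.reduce_eq, h]

lemma Wt_le_len (g : FG k) : Wt g ≤ wordLength g := by
  obtain ⟨x, u, hu, hg, hl⟩ := Wexists_cyc g
  rw [hl, hg, Wt_conj, Wt_cyc hu]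
  push_cast
  have : (0 : ℝ) ≤ wordLength x := by positivity
  linarith

lemma WA (g : FG k) (h : Wt g ≤ 1) (hg : g ≠ 1) : ∃ x y, g = x * Wl y * x⁻¹ := by
  obtain ⟨x, u, hu, hgx, -⟩ := Wexists_cyc g
  rw [hgx, Wt_conj, Wt_cyc hu] at h
  have h1 : wordLength u ≤ 1 := by exact_mod_cast h
  have hu1 : u ≠ 1 := by
    rintro rfl; apply hg; rw [hgx]; simp
  obtain ⟨s, u', e1, e2⟩ := Whead_dec u hu1
  have : u'.toWord = [] := by
    unfold wordLength at h1; rw [e2] at h1; simpa using h1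
  rw [← Wone_eq] at this
  exact ⟨x, s, by rw [hgx, e1, this, mul_one]⟩

lemma Wsame_idx (s y : Letter k) (h : s.1 = y.1) : ∃ e : ℤ, Wl s = Wl y ^ e := by
  by_cases h2 : s.2 = y.2
  · exact ⟨1, by rw [Prod.ext h h2, zpow_one]⟩
  · refine ⟨-1, ?_⟩
    have : s = linv y := by
      refine Prod.ext h ?_
      simp only [linv]
      cases hs : s.2 <;> cases hy : y.2 <;> simp_all
    rw [this, Wl_linv, zpow_neg_one]

lemma WB (y z : Letter k) (hyz : y.1 ≠ z.1) (n : ℕ) : ∀ g : FG k, wordLength g = n →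
    Wt (Wl y * (g * Wl z * g⁻¹)) ≤ 2 → ∃ p q : ℤ, g = Wl y ^ p * Wl z ^ q := by
  induction n using Nat.strong_induction_on with
  | _ n IH =>
  intro g hgn ht
  by_cases hg : g = 1
  · exact ⟨0, 0, by simp [hg]⟩
  obtain ⟨s, g1, e1, e2⟩ := Whead_dec g hg
  obtain ⟨t, g2, f1, f2⟩ := Wlast_dec g hg
  by_cases hs : s.1 = y.1
  · obtain ⟨e, he⟩ := Wsame_idx s y hs
    obtain ⟨p, q, hpq⟩ := IH (wordLength g1) (by rw [← hgn]; unfold wordLength; rw [e2]; simp) g1 rfl (by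
      rw [← Wt_conj _ (Wl y ^ e)]
      rw [e1, he] at ht
      convert ht using 2
      have : Wl y ^ e * Wl y = Wl y * Wl y ^ e := (Commute.zpow_self (Wl y) e)
      simp only [mul_inv_rev, ← mul_assoc, this])
    exact ⟨e + p, q, by rw [e1, he, hpq, zpow_add, mul_assoc]⟩
  by_cases htz : t.1 = z.1
  · obtain ⟨e, he⟩ := Wsame_idx t z htz
    obtain ⟨p, q, hpq⟩ := IH (wordLength g2) (by rw [← hgn]; unfold wordLength; rw [f2]; simp) g2 rfl (by
      rw [f1, he] at ht
      convert ht using 3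
      have : Wl z ^ e * Wl z = Wl z * Wl z ^ e := (Commute.zpow_self (Wl z) e)
      rw [mul_assoc g2 (Wl z ^ e), this]
      group)
    exact ⟨p, q + e, by rw [f1, he, hpq, zpow_add, mul_assoc]⟩
  exfalso
  have hlast : g.toWord.getLast? = some t := by rw [f2]; simp
  have hhead : g.toWord.head? = some s := by rw [e2]; simp
  have c1 : (g * Wl z).toWord = g.toWord ++ [z] := by
    rw [Wcat, Wl_toWord]
    intro a ha b hb h
    rw [hlast] at ha
    rw [Wl_toWord] at hb
    simp only [Option.mem_def, Option.some.injEq, List.head?_cons] at ha hb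
    subst ha hb
    exact htz (by rw [h]; rfl)
  have c2 : (g * Wl z * g⁻¹).toWord = g.toWord ++ [z] ++ g⁻¹.toWord := by
    rw [Wcat, c1]
    intro a ha b hb h
    rw [c1] at ha
    rw [Whead_inv, hlast] at hb
    simp only [Option.mem_def, Option.some.injEq, List.getLast?_append, List.getLast?_singleton, Option.some_or] at ha hb
    subst ha
    rw [h, Wlinv_linv] at hb
    exact htz (by rw [hb])
  have c3 : (Wl y * (g * Wl z * g⁻¹)).toWord = [y] ++ (g.toWord ++ [z] ++ g⁻¹.toWord) := by
    rw [Wcat, c2, Wl_toWord]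
    intro a ha b hb h
    rw [c2, List.append_assoc, List.head?_append, hhead] at hb
    rw [Wl_toWord] at ha
    simp only [Option.mem_def, Option.some.injEq, List.getLast?_singleton, Option.some_or] at ha hb
    subst ha hb
    exact hs (by rw [h]; rfl)
  have hcyc : IsCyclicallyReduced (Wl y * (g * Wl z * g⁻¹)) := by
    rw [Wcyc_iff, FreeGroup.isCyclicallyReduced_iff]
    refine ⟨FreeGroup.isReduced_toWord, ?_⟩
    rw [c3]
    intro a ha b hb hab
    exfalso
    have hl : (g⁻¹).toWord.getLast? = some (linv s) := by
      have := (Wlast_inv g (linv s)).2 (by rw [Wlinv_linv, hhead]; rfl)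
      exact this
    simp only [List.getLast?_append, hl] at ha
    simp only [Option.mem_def, Option.some.injEq, Option.some_or, List.singleton_append, List.head?_cons] at ha hb
    subst ha hb
    exact hs hab
  rw [Wt_cyc hcyc] at ht
  have h3 : wordLength (Wl y * (g * Wl z * g⁻¹)) ≤ 2 := by exact_mod_cast ht
  unfold wordLength at h3
  rw [c3, e2] at h3
  simp [FreeGroup.toWord_inv, e2] at h3

lemma Wrot (a : Letter k) (R : List (Letter k)) : FreeGroup.IsCyclicallyReduced (a :: R) ↔
    FreeGroup.IsCyclicallyReduced (R ++ [a]) := by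
  rw [FreeGroup.isCyclicallyReduced_iff, FreeGroup.isCyclicallyReduced_iff, FreeGroup.IsReduced,
    FreeGroup.IsReduced, List.isChain_append, List.isChain_cons]
  cases hR : R with
  | nil => simp
  | cons b T =>
    rw [List.getLast?_cons_cons, List.getLast?_append]
    simp only [List.cons_append, List.head?_cons, List.getLast?_singleton, Option.some_or,
      Option.mem_def, Option.some.injEq, forall_eq', List.isChain_singleton, true_and]
    tauto

lemma WF_rot (n : ℕ) : ∀ h u v : FG k, wordLength h = n → IsCyclicallyReduced u → IsCyclicallyReduced v →
    v = h * u * h⁻¹ → List.IsRotated u.toWord v.toWord := by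
  induction n with
  | zero =>
    intro h u v hn _ _ e
    have : h = 1 := Wone_eq.2 (List.length_eq_zero_iff.1 hn)
    rw [e, this, one_mul, inv_one, mul_one]
  | succ n IH =>
    intro h u v hn hu hv e
    by_cases hu1 : u = 1
    · rw [e, hu1]; simp
    have hh : h ≠ 1 := by rintro rfl; simp [wordLength] at hn
    obtain ⟨t, h2, f1, f2⟩ := Wlast_dec h hh
    have hn2 : wordLength h2 = n := by
      unfold wordLength at hn ⊢; rw [f2] at hn; simpa using hn
    obtain ⟨p, u1, e1, e2⟩ := Whead_dec u hu1
    obtain ⟨q, u2, g1, g2⟩ := Wlast_dec u hu1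
    have hcu := (Wcyc_iff u).1 hu
    by_cases hp : p = linv t
    · have hw : (u1 * Wl p).toWord = u1.toWord ++ [p] := by
        rw [e2, Wrot] at hcu
        rw [FreeGroup.toWord_mul, Wl_toWord, hcu.1.reduce_eq]
      have hr : List.IsRotated u.toWord (u1 * Wl p).toWord := by
        rw [hw, e2]; exact ⟨1, by simp⟩
      refine hr.trans (IH h2 _ v hn2 ?_ hv ?_)
      · rw [Wcyc_iff, hw, ← Wrot, ← e2]; exact hcu
      · rw [e, f1, e1, hp, Wl_linv]; group
    by_cases hq : q = t
    · have hw : (Wl q * u2).toWord = q :: u2.toWord := by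
        rw [g2, ← Wrot] at hcu
        rw [FreeGroup.toWord_mul, Wl_toWord, List.singleton_append, hcu.1.reduce_eq]
      have hr : List.IsRotated u.toWord (Wl q * u2).toWord := by
        rw [hw, g2]; exact List.IsRotated.symm ⟨1, by simp⟩
      refine hr.trans (IH h2 _ v hn2 ?_ hv ?_)
      · rw [Wcyc_iff, hw, Wrot, ← g2]; exact hcu
      · rw [e, f1, g1, hq]; group
    exfalso
    have hlast : h.toWord.getLast? = some t := by rw [f2]; simp
    have c1 : (h * u).toWord = h.toWord ++ u.toWord := by
      rw [Wcat]
      intro a ha b hb hab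
      rw [hlast] at ha
      rw [e2] at hb
      simp only [Option.mem_def, Option.some.injEq, List.head?_cons] at ha hb
      subst ha hb
      exact hp hab
    have c2 : (h * u * h⁻¹).toWord = h.toWord ++ u.toWord ++ h⁻¹.toWord := by
      rw [Wcat, c1]
      intro a ha b hb hab
      rw [c1, g2] at ha
      rw [Whead_inv, hlast] at hb
      simp only [Option.mem_def, Option.some.injEq, List.getLast?_append, List.getLast?_singleton, Option.some_or] at ha hb
      subst ha
      rw [hab, Wlinv_linv] at hb
      exact hq hb.symm
    have hl : (wordLength v : ℝ) = wordLength u := by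
      rw [← Wt_cyc hv, ← Wt_cyc hu, e, Wt_conj]
    have hl : wordLength v = wordLength u := by exact_mod_cast hl
    rw [e] at hl
    unfold wordLength at hl
    rw [c2, f2] at hl
    simp at hl
    omega

lemma We_l (b : Fin k) (y : Letter k) : We b (Wl y) = if y.1 = b then (if y.2 then 1 else -1) else 0 := by
  obtain ⟨j, c⟩ := y
  cases c
  · have : Wl (j, false) = (FreeGroup.of j)⁻¹ := rfl
    rw [this, We_inv, We_of]; simp only; split_ifs <;> simp_all
  · rw [Wl_true, We_of]; simp

lemma We_l_ne (y : Letter k) : We y.1 (Wl y) ≠ 0 := by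
  rw [We_l]; simp; split_ifs <;> simp

lemma WC_inj (α : MulAut (FG k)) (x : Fin k → FG k) (y : Fin k → Letter k)
    (h : ∀ j, α (FreeGroup.of j) = x j * Wl (y j) * (x j)⁻¹) : Function.Injective fun j => (y j).1 := by
  intro j l hjl
  by_contra hne
  simp only at hjl
  obtain ⟨e, he⟩ := Wsame_idx (y j) (y l) hjl
  have h0 : ∀ b, We b (α (FreeGroup.of j * FreeGroup.of l ^ (-e))) = 0 := by
    intro b
    rw [map_mul, map_zpow, We_mul, We_zpow, h, h, We_conj, We_conj, he, We_zpow]; ring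
  have h1 : We j (FreeGroup.of j * FreeGroup.of l ^ (-e)) = 0 := by
    have := We_aut α⁻¹ j (α (FreeGroup.of j * FreeGroup.of l ^ (-e)))
    rw [MulAut.inv_apply_self] at this
    rw [this]; exact Finset.sum_eq_zero fun c _ => by rw [h0, zero_mul]
  rw [We_mul, We_zpow, We_of, We_of, if_pos rfl, if_neg (Ne.symm hne)] at h1
  simp at h1

lemma WC (hk : 2 ≤ k) (α : MulAut (FG k)) (hα : ∀ u, Wt (α u) ≤ Wt u) :
    ∃ (g : FG k) (y : Fin k → Letter k), Function.Injective (fun j => (y j).1) ∧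
      ∀ j, (MulAut.conj g⁻¹ * α) (FreeGroup.of j) = Wl (y j) := by
  have h1 : ∀ j, ∃ x y, α (FreeGroup.of j) = x * Wl y * x⁻¹ := by
    intro j
    apply WA
    · refine (hα _).trans ((Wt_le_len _).trans ?_)
      simp [wordLength]
    · rw [Ne, map_eq_one_iff _ α.injective]; exact FreeGroup.of_ne_one j
  choose x y hxy using h1
  have hinj := WC_inj α x y hxy
  have h2 : ∀ j l, Wt (α (FreeGroup.of j * FreeGroup.of l)) ≤ 2 := by
    intro j l
    refine (hα _).trans ((Wt_le_len _).trans ?_)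
    have : wordLength (FreeGroup.of j * FreeGroup.of l) ≤ 2 := by
      refine (FreeGroup.norm_mul_le (FreeGroup.of j) (FreeGroup.of l)).trans ?_
      simp
    exact_mod_cast this
  have hB : ∀ j l, j ≠ l → ∃ p q : ℤ, (x j)⁻¹ * x l = Wl (y j) ^ p * Wl (y l) ^ q := by
    intro j l hjl
    refine WB (y j) (y l) (fun h => hjl (hinj h)) _ _ rfl ?_
    have := h2 j l
    rw [map_mul, hxy, hxy, ← Wt_conj _ (x j)⁻¹] at this
    convert this using 2
    group
  let i0 : Fin k := ⟨0, by omega⟩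
  let i1 : Fin k := ⟨1, by omega⟩
  have h01 : i0 ≠ i1 := by simp [i0, i1]
  obtain ⟨p, q, hpq⟩ := hB i0 i1 h01
  set g := x i0 * Wl (y i0) ^ p with hg
  have hx0 : x i0 = g * Wl (y i0) ^ (-p) := by rw [hg]; group
  have hx1 : x i1 = g * Wl (y i1) ^ q := by
    rw [hg, mul_assoc, ← hpq]; group
  refine ⟨g, y, hinj, fun j => ?_⟩
  have hfin : ∀ n : ℤ, x j = g * Wl (y j) ^ n → (MulAut.conj g⁻¹ * α) (FreeGroup.of j) = Wl (y j) := by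
    intro n hn
    rw [MulAut.mul_apply, MulAut.conj_apply, hxy, hn]
    have : Wl (y j) ^ n * Wl (y j) = Wl (y j) * Wl (y j) ^ n := (Commute.zpow_self (Wl (y j)) n)
    rw [mul_assoc g, this]
    group
  by_cases hj0 : j = i0
  · exact hfin (-p) (by rw [hj0]; exact hx0)
  by_cases hj1 : j = i1
  · exact hfin q (by rw [hj1]; exact hx1)
  obtain ⟨a, b, hab⟩ := hB i0 j (Ne.symm hj0)
  obtain ⟨c, d, hcd⟩ := hB i1 j (Ne.symm hj1)
  have e1 : x j = g * (Wl (y i0) ^ (a - p) * Wl (y j) ^ b) := by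
    have : x j = x i0 * ((x i0)⁻¹ * x j) := by group
    rw [this, hab, hg, zpow_sub]; 
    have e := (Commute.refl (Wl (y i0))).zpow_zpow p a
    have e' : Wl (y i0) ^ a * (Wl (y i0) ^ p)⁻¹ = (Wl (y i0) ^ p)⁻¹ * Wl (y i0) ^ a := by
      rw [← zpow_neg, ← zpow_add, ← zpow_add, add_comm]
    rw [e']; group
  have e2 : x j = g * (Wl (y i1) ^ (q + c) * Wl (y j) ^ d) := by
    have : x j = x i1 * ((x i1)⁻¹ * x j) := by group
    rw [this, hcd, hx1, zpow_add]; group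
  have e3 := congrArg (We (y i0).1) (mul_left_cancel (e1.symm.trans e2))
  have z1 : We (y i0).1 (Wl (y j)) = 0 := by
    rw [We_l, if_neg]; exact fun h => hj0 (hinj h)
  have z2 : We (y i0).1 (Wl (y i1)) = 0 := by
    rw [We_l, if_neg]; exact fun h => h01 (hinj h).symm
  rw [We_mul, We_mul, We_zpow, We_zpow, We_zpow, We_zpow, z1, z2] at e3
  simp only [mul_zero, add_zero, mul_eq_zero, We_l_ne, or_false] at e3
  refine hfin b ?_
  rw [e1, e3]; simp

lemma WD (β : MulAut (FG k)) (y : Fin k → Letter k) (hinj : Function.Injective (fun j => (y j).1))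
    (hβ : ∀ j, β (FreeGroup.of j) = Wl (y j)) : IsRelabeling β := by
  have hl : ∀ y : Letter k, Wl y = FreeGroup.of y.1 ∨ Wl y = (FreeGroup.of y.1)⁻¹ := by
    rintro ⟨j, b⟩; cases b
    · right; rfl
    · left; rfl
  have hsurj := Finite.surjective_of_injective hinj
  ext g
  constructor
  · rintro ⟨h, ⟨j, rfl | rfl⟩, rfl⟩
    · rw [hβ]; exact ⟨_, hl _⟩
    · rw [map_inv, hβ]
      rcases hl (y j) with h | h
      · exact ⟨_, Or.inr (by rw [h])⟩
      · exact ⟨_, Or.inl (by rw [h, inv_inv])⟩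
  · rintro ⟨i, h⟩
    obtain ⟨j, rfl⟩ := hsurj i
    have m1 : FreeGroup.of j ∈ letterSet k := ⟨j, Or.inl rfl⟩
    have m2 : (FreeGroup.of j)⁻¹ ∈ letterSet k := ⟨j, Or.inr rfl⟩
    rcases hl (y j) with h1 | h1 <;> rcases h with rfl | rfl
    · exact ⟨_, m1, by rw [hβ, h1]⟩
    · exact ⟨_, m2, by rw [map_inv, hβ, h1]⟩
    · exact ⟨_, m2, by rw [map_inv, hβ, h1, inv_inv]⟩
    · exact ⟨_, m1, by rw [hβ, h1]⟩

lemma WE (β : MulAut (FG k)) (y : Fin k → Letter k)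
    (hβ : ∀ j, β (FreeGroup.of j) = Wl (y j)) (w : FG k) : wordLength (β w) ≤ wordLength w := by
  have h1 : ∀ s : Letter k, FreeGroup.norm (β (Wl s)) ≤ 1 := by
    rintro ⟨j, b⟩
    cases b
    · have : Wl (j, false) = (FreeGroup.of j)⁻¹ := rfl
      rw [this, map_inv, FreeGroup.norm_inv_eq, hβ, FreeGroup.norm, Wl_toWord]; simp
    · rw [Wl_true, hβ, FreeGroup.norm, Wl_toWord]; simp
  have h2 : ∀ L : List (Letter k), FreeGroup.norm (β (FreeGroup.mk L)) ≤ L.length := by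
    intro L
    induction L with
    | nil => rw [← FreeGroup.one_eq_mk, map_one]; simp
    | cons s L ih =>
      rw [Wmk_cons, map_mul]
      have := FreeGroup.norm_mul_le (β (Wl s)) (β (FreeGroup.mk L))
      have := h1 s
      simp only [List.length_cons]; omega
  have := h2 w.toWord
  rwa [FreeGroup.mk_toWord] at this

lemma Wcyc_inv {w : FG k} (hw : IsCyclicallyReduced w) : IsCyclicallyReduced w⁻¹ := by
  obtain ⟨x, u, hu, hg, hl⟩ := Wexists_cyc w⁻¹
  have h1 : (wordLength u : ℝ) = wordLength w := by
    rw [← Wt_cyc hu, ← Wt_cyc hw, ← Wt_inv w, hg, Wt_conj]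
  have h1 : wordLength u = wordLength w := by exact_mod_cast h1
  have h2 : wordLength w⁻¹ = wordLength w := FreeGroup.norm_inv_eq
  have : x = 1 := Wone_eq.2 (List.length_eq_zero_iff.1 (show wordLength x = 0 by omega))
  rw [hg, this]; simpa using hu

end WhStruct

/-- if `w ∈ Z` is nontrivial then no automorphism of `F_k` sends `w`
to `w⁻¹`. -/
theorem Zset_not_inverse (k : ℕ) (hk : 2 ≤ k) (w : FG k)
    (hw : w ∈ Zset k) (hne : w ≠ 1) :
    ∀ α : MulAut (FG k), α w ≠ w⁻¹ := by
  intro α hα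
  have hSM : w ∈ SM k := hw.1.1
  have hcw : IsCyclicallyReduced w := hSM.1
  have h1 : α⁻¹ w = w⁻¹ := by
    apply α.injective
    rw [MulAut.apply_inv_self, map_inv, hα, inv_inv]
  have h2 : ∀ u, Wt (α u) ≤ Wt u := by
    intro u
    have := Wt_eq hSM α⁻¹ (by rw [h1, Wt_inv]) u
    rwa [inv_inv] at this
  obtain ⟨g, y, hinj, hy⟩ := WC hk α h2
  apply hw.2
  refine ⟨MulAut.conj g⁻¹ * α, WD _ y hinj hy, ?_⟩
  have e : (MulAut.conj g⁻¹ * α) w = g⁻¹ * w⁻¹ * g⁻¹⁻¹ := by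
    rw [MulAut.mul_apply, hα, MulAut.conj_apply]
  have hlen := WE _ y hy w
  have hcyc : IsCyclicallyReduced ((MulAut.conj g⁻¹ * α) w) := by
    obtain ⟨x, u, hu, hx, hl⟩ := Wexists_cyc ((MulAut.conj g⁻¹ * α) w)
    have h3 : (wordLength u : ℝ) = wordLength w := by
      rw [← Wt_cyc hu, ← Wt_cyc hcw, ← Wt_inv w, ← Wt_conj u x, ← hx, e, Wt_conj]
    have h3 : wordLength u = wordLength w := by exact_mod_cast h3
    have : x = 1 := Wone_eq.2 (List.length_eq_zero_iff.1 (show wordLength x = 0 by omega))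
    rw [hx, this]; simpa using hu
  obtain ⟨n, hn⟩ := WF_rot _ g⁻¹ w⁻¹ _ rfl (Wcyc_inv hcw) hcyc e
  exact ⟨n, hn.symm⟩
end

section
/- The set Z is exponentially generic in the set C of all cyclically reduced words. -/
namespace ZG
open Finset

variable {k : ℕ}

lemma linv_linv (x : Letter k) : linv (linv x) = x := by simp [linv]

lemma linv_ne (x : Letter k) : linv x ≠ x := by
  intro h
  have := congrArg Prod.snd h
  simp [linv] at this

lemma rel_iff (x y : Letter k) : (x.1 = y.1 → x.2 = y.2) ↔ y ≠ linv x := by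
  obtain ⟨i, b⟩ := x
  obtain ⟨j, c⟩ := y
  simp only [linv, ne_eq, Prod.mk.injEq, not_and]
  cases b <;> cases c <;> simp [eq_comm]

lemma isReduced_cons_cons (x y : Letter k) (l : List (Letter k)) :
    FreeGroup.IsReduced (x :: y :: l) ↔ y ≠ linv x ∧ FreeGroup.IsReduced (y :: l) := by
  unfold FreeGroup.IsReduced
  rw [List.isChain_cons_cons, rel_iff]

/-- continuations of length n after the letter x -/
def red (k : ℕ) : ℕ → Letter k → Finset (List (Letter k))
  | 0, _ => {[]}
  | n+1, x => (univ.filter (fun y => y ≠ linv x)).biUnion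
      fun y => (red k n y).image (List.cons y)

lemma mem_red (n : ℕ) (x : Letter k) (l : List (Letter k)) :
    l ∈ red k n x ↔ l.length = n ∧ FreeGroup.IsReduced (x :: l) := by
  induction n generalizing x l with
  | zero =>
    simp only [red, mem_singleton, List.length_eq_zero_iff]
    constructor
    · rintro rfl
      exact ⟨rfl, by simp⟩
    · exact fun h => h.1
  | succ n ih =>
    simp only [red, mem_biUnion, mem_filter, mem_univ, true_and, mem_image]
    constructor
    · rintro ⟨y, hy, l', hl', rfl⟩
      rw [ih] at hl'
      rw [isReduced_cons_cons]
      exact ⟨by simp [hl'.1], hy, hl'.2⟩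
    · rintro ⟨h1, h2⟩
      cases l with
      | nil => simp at h1
      | cons y l' =>
        rw [isReduced_cons_cons] at h2
        exact ⟨y, h2.1, l', (ih y l').2 ⟨by simpa using h1, h2.2⟩, rfl⟩

lemma sum_red_succ (n : ℕ) (x : Letter k) (F : List (Letter k) → ℝ) :
    ∑ l ∈ red k (n+1) x, F l
      = ∑ y ∈ univ.filter (fun y => y ≠ linv x), ∑ l ∈ red k n y, F (y :: l) := by
  rw [red, sum_biUnion]
  · refine sum_congr rfl fun y _ => ?_
    rw [sum_image]
    intro a _ b _ h
    simpa using h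
  · intro y _ z _ hyz
    simp only [Function.onFun]
    rw [Finset.disjoint_left]
    intro l h1 h2
    simp only [mem_image] at h1 h2
    obtain ⟨a, _, rfl⟩ := h1
    obtain ⟨b, _, h⟩ := h2
    simp at h
    exact hyz h.1.symm

lemma card_filter_ne (x : Letter k) :
    ((univ.filter (fun y => y ≠ x)).card : ℝ) = 2 * k - 1 := by
  have h := Finset.filter_ne' (univ : Finset (Letter k)) x
  rw [h, Finset.card_erase_of_mem (mem_univ _)]
  have hp : 1 ≤ (univ : Finset (Letter k)).card := Finset.card_pos.2 ⟨x, mem_univ _⟩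
  rw [Nat.cast_sub hp]
  simp
  ring

lemma card_red (n : ℕ) (x : Letter k) : ((red k n x).card : ℝ) = (2 * k - 1) ^ n := by
  induction n generalizing x with
  | zero => simp [red]
  | succ n ih =>
    have := sum_red_succ n x (fun _ => 1)
    simp only [sum_const, nsmul_eq_mul, mul_one] at this
    rw [this, sum_congr rfl (fun y _ => ih y)]
    rw [sum_const, nsmul_eq_mul, card_filter_ne]
    ring

/-- sum along a path -/
def pathSum (c : Letter k → Letter k → ℝ) : Letter k → List (Letter k) → ℝ
  | _, [] => 0
  | x, y :: l => c x y + pathSum c y l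

lemma sum_red_exp (c : Letter k → Letter k → ℝ) (t lam : ℝ) (hl : 0 ≤ lam)
    (h : ∀ x, ∑ y ∈ univ.filter (fun y => y ≠ linv x), Real.exp (-t * c x y) ≤ lam)
    (n : ℕ) (x : Letter k) :
    ∑ l ∈ red k n x, Real.exp (-t * pathSum c x l) ≤ lam ^ n := by
  induction n generalizing x with
  | zero => simp [red, pathSum]
  | succ n ih =>
    rw [sum_red_succ]
    calc _ = ∑ y ∈ univ.filter (fun y => y ≠ linv x), Real.exp (-t * c x y) *
            ∑ l ∈ red k n y, Real.exp (-t * pathSum c y l) := by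
            refine sum_congr rfl fun y _ => ?_
            rw [mul_sum]
            refine sum_congr rfl fun l _ => ?_
            rw [← Real.exp_add, pathSum]
            ring_nf
      _ ≤ ∑ y ∈ univ.filter (fun y => y ≠ linv x), Real.exp (-t * c x y) * lam ^ n := by
            refine sum_le_sum fun y _ => ?_
            exact mul_le_mul_of_nonneg_left (ih y) (Real.exp_pos _).le
      _ ≤ lam ^ (n+1) := by
            rw [← sum_mul, pow_succ, mul_comm]
            exact mul_le_mul_of_nonneg_left (h x) (pow_nonneg hl n)

lemma exists_t (hk : 2 ≤ k) (c : Letter k → Letter k → ℝ)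
    (h : ∀ x, 0 < ∑ y ∈ univ.filter (fun y => y ≠ linv x), c x y) :
    ∃ t lam : ℝ, 0 < t ∧ 0 < lam ∧ lam < 2 * k - 1 ∧
      ∀ x, ∑ y ∈ univ.filter (fun y => y ≠ linv x), Real.exp (-t * c x y) ≤ lam := by
  have key : ∀ x, ∀ᶠ t in nhdsWithin (0:ℝ) (Set.Ioi 0),
      ∑ y ∈ univ.filter (fun y => y ≠ linv x), Real.exp (-t * c x y) < 2 * k - 1 := by
    intro x
    set φ : ℝ → ℝ := fun t => ∑ y ∈ univ.filter (fun y => y ≠ linv x), Real.exp (-t * c x y)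
    have hd : HasDerivAt φ (-∑ y ∈ univ.filter (fun y => y ≠ linv x), c x y) 0 := by
      rw [← sum_neg_distrib]
      apply HasDerivAt.fun_sum
      intro y _
      have h1 : HasDerivAt (fun t : ℝ => -t * c x y) (-1 * c x y) 0 :=
        ((hasDerivAt_id (0:ℝ)).neg).mul_const (c x y)
      have := h1.exp
      simpa using this
    have h0 : φ 0 = 2 * k - 1 := by
      simp only [φ]
      simp only [neg_zero, zero_mul, Real.exp_zero, sum_const, nsmul_eq_mul, mul_one]
      exact card_filter_ne _
    have hneg : (-∑ y ∈ univ.filter (fun y => y ≠ linv x), c x y) < 0 := by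
      have := h x
      linarith
    have h2 := (hasDerivAt_iff_tendsto_slope.1 hd).eventually (gt_mem_nhds hneg)
    have h3 := nhdsWithin_mono (0:ℝ) (show Set.Ioi (0:ℝ) ⊆ {0}ᶜ by
      intro t ht
      simp only [Set.mem_compl_iff, Set.mem_singleton_iff]
      exact (ne_of_gt ht)) h2
    filter_upwards [h3, self_mem_nhdsWithin] with t ht hpos
    simp only [slope_def_field, sub_zero, h0] at ht
    have hpos' : 0 < t := hpos
    rw [div_lt_iff₀ hpos', zero_mul] at ht
    change φ t < _
    linarith
  have hall : ∀ᶠ t in nhdsWithin (0:ℝ) (Set.Ioi 0), ∀ x : Letter k,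
      ∑ y ∈ univ.filter (fun y => y ≠ linv x), Real.exp (-t * c x y) < 2 * k - 1 :=
    Filter.eventually_all.2 key
  obtain ⟨t, ht, hpos⟩ := (hall.and self_mem_nhdsWithin).exists
  have hne : (univ : Finset (Letter k)).Nonempty := ⟨(⟨0, by omega⟩, true), mem_univ _⟩
  obtain ⟨x0, _, hx0⟩ := exists_max_image univ (fun x : Letter k =>
    ∑ y ∈ univ.filter (fun y => y ≠ linv x), Real.exp (-t * c x y)) hne
  refine ⟨t, _, hpos, ?_, ht x0, fun x => hx0 x (mem_univ _)⟩
  apply sum_pos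
  · intro y _
    exact Real.exp_pos _
  · refine ⟨x0, ?_⟩
    simp [(linv_ne x0).symm]

/-- exponentially negligible count -/
def Neg (k : ℕ) (S : Set (FG k)) : Prop :=
  ∃ K σ : ℝ, 0 ≤ K ∧ 0 < σ ∧ σ < 2 * k - 1 ∧
    ∀ n : ℕ, 1 ≤ n → ({g ∈ S | wordLength g = n}.ncard : ℝ) ≤ K * σ ^ n

lemma finite_len (n : ℕ) : {g : FG k | wordLength g = n}.Finite := by
  apply Set.Finite.of_finite_image (f := FreeGroup.toWord)
  · apply (List.finite_length_eq (Letter k) n).subset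
    rintro _ ⟨g, hg, rfl⟩
    exact hg
  · exact FreeGroup.toWord_injective.injOn

lemma finite_len_sep (S : Set (FG k)) (n : ℕ) : {g ∈ S | wordLength g = n}.Finite :=
  (finite_len n).subset fun _ h => h.2

lemma finite_le_sep (S : Set (FG k)) (n : ℕ) : {g ∈ S | wordLength g ≤ n}.Finite := by
  have : (⋃ m ∈ Set.Iic n, {g : FG k | wordLength g = m}).Finite :=
    (Set.finite_Iic n).biUnion fun m _ => finite_len m
  refine this.subset fun g h => ?_
  simp only [Set.mem_iUnion]
  exact ⟨wordLength g, h.2, rfl⟩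

lemma Neg.mono {S T : Set (FG k)} (hT : Neg k T) (h : S ⊆ T) : Neg k S := by
  obtain ⟨K, σ, h0, h1, h2, h3⟩ := hT
  refine ⟨K, σ, h0, h1, h2, fun n hn => le_trans ?_ (h3 n hn)⟩
  have hsub : {g ∈ S | wordLength g = n} ⊆ {g ∈ T | wordLength g = n} :=
    fun g hg => ⟨h hg.1, hg.2⟩
  exact_mod_cast Set.ncard_le_ncard hsub (finite_len_sep T n)

lemma Neg.empty (hk : 2 ≤ k) : Neg k ∅ := by
  refine ⟨0, 1, le_rfl, one_pos, ?_, fun n _ => by simp⟩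
  have : (2:ℝ) ≤ k := by exact_mod_cast hk
  linarith

lemma Neg.union {S T : Set (FG k)} (hS : Neg k S) (hT : Neg k T) : Neg k (S ∪ T) := by
  obtain ⟨K, σ, h0, h1, h2, h3⟩ := hS
  obtain ⟨K', σ', h0', h1', h2', h3'⟩ := hT
  refine ⟨K + K', max σ σ', add_nonneg h0 h0', lt_max_of_lt_left h1, max_lt h2 h2', fun n hn => ?_⟩
  have e : {g ∈ S ∪ T | wordLength g = n} =
      {g ∈ S | wordLength g = n} ∪ {g ∈ T | wordLength g = n} := by
    ext g
    simp only [Set.mem_ofPred_eq, Set.mem_union]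
    tauto
  rw [e]
  calc _ ≤ (({g ∈ S | wordLength g = n}.ncard + {g ∈ T | wordLength g = n}.ncard : ℕ) : ℝ) := by
          exact_mod_cast Set.ncard_union_le _ _
    _ ≤ K * σ ^ n + K' * σ' ^ n := by
          push_cast
          exact add_le_add (h3 n hn) (h3' n hn)
    _ ≤ K * (max σ σ') ^ n + K' * (max σ σ') ^ n := by
          gcongr
          · exact le_max_left _ _
          · exact le_max_right _ _
    _ = _ := by ring

lemma Neg.iUnion (hk : 2 ≤ k) {ι : Type*} [Finite ι] {S : ι → Set (FG k)}
    (h : ∀ i, Neg k (S i)) : Neg k (⋃ i, S i) := by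
  classical
  cases nonempty_fintype ι
  have : ∀ s : Finset ι, Neg k (⋃ i ∈ s, S i) := by
    intro s
    induction s using Finset.induction_on with
    | empty => simpa using Neg.empty hk
    | insert a s _ ih =>
      rw [Finset.set_biUnion_insert]
      exact (h a).union ih
  simpa using this univ

lemma pathSum_cob (f : Letter k → Letter k → ℝ) (h : Letter k → ℝ) (M : ℝ)
    (hM : ∀ x, |h x| ≤ M) (x : Letter k) (l : List (Letter k)) :
    pathSum (fun x y => f x y - h y + h x) x l ≤ pathSum f x l + h x + M := by
  induction l generalizing x with
  | nil =>
    simp only [pathSum]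
    have := neg_le_of_abs_le (hM x)
    linarith
  | cons y l ih =>
    simp only [pathSum]
    have := ih y
    linarith

lemma sum_filter_ne (g : Letter k → ℝ) (x : Letter k) :
    ∑ y ∈ univ.filter (fun y => y ≠ x), g y = ∑ y, g y - g x := by
  rw [Finset.filter_ne' univ x, ← Finset.sum_erase_add univ g (mem_univ x)]
  ring

lemma sum_linv (g : Letter k → ℝ) : ∑ x, g (linv x) = ∑ x, g x :=
  Fintype.sum_equiv ⟨linv, linv, linv_linv, linv_linv⟩ _ _ (fun _ => rfl)

/-- Large deviation bound. -/
lemma neg_of_sum (hk : 2 ≤ k) (f : Letter k → Letter k → ℝ) (B : ℝ)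
    (hf : 0 < ∑ x, ∑ y ∈ univ.filter (fun y => y ≠ linv x), f x y) :
    Neg k {g | ∃ x l, FreeGroup.toWord g = x :: l ∧ pathSum f x l ≤ B} := by
  have hkR : (2:ℝ) ≤ k := by exact_mod_cast hk
  set F : Letter k → ℝ := fun x => ∑ y ∈ univ.filter (fun y => y ≠ linv x), f x y with hF
  set δ : ℝ := (∑ x, F x) / (2 * k) with hδ
  have hδ0 : 0 < δ := div_pos hf (by linarith)
  set G : Letter k → ℝ := fun x => F x - δ with hG
  have hGs : ∑ x, G x = 0 := by
    simp only [hG, sum_sub_distrib, sum_const, nsmul_eq_mul]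
    simp only [card_univ, Fintype.card_prod, Fintype.card_fin, Fintype.card_bool]
    rw [hδ]
    push_cast
    field_simp
    ring
  set q : ℝ := 2 * k - 1 with hq
  have hq3 : 3 ≤ q := by rw [hq]; linarith
  have hqq : q ^ 2 - 1 ≠ 0 := by nlinarith
  set h : Letter k → ℝ := fun x => -(q * G x - G (linv x)) / (q ^ 2 - 1) with hh
  have hhs : ∑ x, h x = 0 := by
    simp only [hh]
    rw [← sum_div, sum_neg_distrib, sum_sub_distrib, ← mul_sum, sum_linv, hGs]
    simp
  set c : Letter k → Letter k → ℝ := fun x y => f x y - h y + h x with hc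
  have hcs : ∀ x, ∑ y ∈ univ.filter (fun y => y ≠ linv x), c x y = δ := by
    intro x
    simp only [hc, sum_add_distrib, sum_sub_distrib, sum_const, nsmul_eq_mul]
    rw [card_filter_ne, sum_filter_ne h, hhs]
    change F x - (0 - h (linv x)) + q * h x = δ
    have : F x = G x + δ := by simp [hG]
    rw [this]
    simp only [hh, linv_linv]
    field_simp
    ring
  obtain ⟨t, lam, ht, hl0, hl1, hsum⟩ := exists_t hk c (fun x => by rw [hcs x]; exact hδ0)
  obtain ⟨M, hM⟩ : ∃ M, ∀ x, |h x| ≤ M := by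
    refine ⟨∑ x, |h x|, fun x => ?_⟩
    exact single_le_sum (f := fun x => |h x|) (fun _ _ => abs_nonneg _) (mem_univ x)
  have hM0 : ∀ x, h x ≤ M := fun x => (le_abs_self _).trans (hM x)
  refine ⟨2 * k * Real.exp (t * (B + 2 * M)) / lam, lam, by positivity, hl0, hl1, fun n hn => ?_⟩
  obtain ⟨m, rfl⟩ := Nat.exists_eq_add_of_le' hn
  set T : Letter k → Finset (List (Letter k)) := fun x =>
    (red k m x).filter (fun l => pathSum f x l ≤ B) with hT
  have hcard : ∀ x, ((T x).card : ℝ) ≤ Real.exp (t * (B + 2 * M)) * lam ^ m := by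
    intro x
    calc ((T x).card : ℝ) = ∑ l ∈ T x, 1 := by simp
      _ ≤ ∑ l ∈ T x, Real.exp (t * (B + 2 * M)) * Real.exp (-t * pathSum c x l) := by
          refine sum_le_sum fun l hl => ?_
          rw [← Real.exp_add]
          apply Real.one_le_exp
          have h1 := pathSum_cob f h M hM x l
          have h2 := (mem_filter.1 hl).2
          have h3 := hM0 x
          change pathSum c x l ≤ _ at h1
          have : 0 ≤ t * (B + 2 * M - pathSum c x l) := mul_nonneg ht.le (by linarith)
          linarith
      _ ≤ ∑ l ∈ red k m x, Real.exp (t * (B + 2 * M)) * Real.exp (-t * pathSum c x l) := by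
          apply sum_le_sum_of_subset_of_nonneg (filter_subset _ _)
          intro _ _ _
          positivity
      _ ≤ _ := by
          rw [← mul_sum]
          exact mul_le_mul_of_nonneg_left (sum_red_exp c t lam hl0.le hsum m x) (Real.exp_pos _).le
  set U : Finset (List (Letter k)) := univ.biUnion fun x => (T x).image (List.cons x) with hU
  have hle : {g ∈ {g : FG k | ∃ x l, FreeGroup.toWord g = x :: l ∧ pathSum f x l ≤ B} |
      wordLength g = m + 1}.ncard ≤ U.card := by
    rw [← Set.ncard_coe_finset]
    apply Set.ncard_le_ncard_of_injOn FreeGroup.toWord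
    · rintro g ⟨⟨x, l, hg, hs⟩, hlen⟩
      rw [hg]
      have hr : FreeGroup.IsReduced (x :: l) := by
        rw [← hg]
        exact FreeGroup.isReduced_toWord
      have hl : l.length = m := by
        simpa [wordLength, hg] using hlen
      simp only [hU, mem_coe, mem_biUnion, mem_univ, true_and, mem_image]
      exact ⟨x, l, mem_filter.2 ⟨(mem_red m x l).2 ⟨hl, hr⟩, hs⟩, rfl⟩
    · exact FreeGroup.toWord_injective.injOn
  have hUc : (U.card : ℝ) ≤ 2 * k * (Real.exp (t * (B + 2 * M)) * lam ^ m) := by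
    calc (U.card : ℝ) ≤ ∑ x : Letter k, ((T x).card : ℝ) := by
          have : U.card ≤ ∑ x : Letter k, (T x).card :=
            card_biUnion_le.trans (sum_le_sum fun x _ => card_image_le)
          exact_mod_cast this
      _ ≤ ∑ x : Letter k, Real.exp (t * (B + 2 * M)) * lam ^ m := sum_le_sum fun x _ => hcard x
      _ = _ := by
          rw [sum_const, nsmul_eq_mul]
          simp only [card_univ, Fintype.card_prod, Fintype.card_fin, Fintype.card_bool]
          push_cast
          ring
  calc _ ≤ (U.card : ℝ) := by exact_mod_cast hle
    _ ≤ _ := hUc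
    _ = _ := by
      rw [pow_succ]
      field_simp

end ZG

namespace ZG
open Finset

variable {k : ℕ}

lemma cyc_iff (w : List (Letter k)) : CyclicallyReducedWord w ↔ FreeGroup.IsCyclicallyReduced w := by
  unfold CyclicallyReducedWord
  rw [← FreeGroup.isReduced_iff_reduce_eq, FreeGroup.isCyclicallyReduced_iff]
  unfold FreeGroup.IsReduced
  rw [List.isChain_append]
  tauto

lemma isReduced_append_singleton (l : List (Letter k)) (x z : Letter k)
    (h : FreeGroup.IsReduced (x :: l)) (hz : z ≠ linv ((x :: l).getLast (by simp))) :
    FreeGroup.IsReduced (x :: l ++ [z]) := by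
  unfold FreeGroup.IsReduced at *
  rw [List.isChain_append]
  refine ⟨h, by simp, ?_⟩
  intro a ha b hb
  rw [rel_iff]
  rw [List.getLast?_eq_getLast_of_ne_nil (by simp)] at ha
  simp only [Option.mem_def, Option.some.injEq, List.head?_cons] at ha hb
  rw [← ha, ← hb]
  exact hz

lemma gamma_C_lower (hk : 2 ≤ k) (m : ℕ) :
    ((2 * k - 1 : ℝ)) ^ m ≤ ({g ∈ Cset k | wordLength g = m + 2}.ncard : ℝ) := by
  classical
  let x : Letter k := (⟨0, by omega⟩, true)
  have hz : ∀ y : Letter k, ∃ z : Letter k, z ≠ linv y ∧ z ≠ linv x := by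
    intro y
    by_contra! hcon
    have : (univ : Finset (Letter k)) ⊆ {linv y, linv x} := by
      intro z _
      simp only [mem_insert, mem_singleton]
      by_contra! hh
      exact hh.2 (hcon z hh.1)
    have h1 := (card_le_card this).trans card_le_two
    simp at h1
    omega
  choose z hz1 hz2 using hz
  let φ : List (Letter k) → List (Letter k) := fun l => x :: l ++ [z ((x :: l).getLast (by simp))]
  rw [← card_red m x]
  have : (red k m x).card ≤ {g ∈ Cset k | wordLength g = m + 2}.ncard := by
    rw [← Set.ncard_coe_finset]
    have hred : ∀ l ∈ red k m x, FreeGroup.toWord (FreeGroup.mk (φ l)) = φ l := by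
      intro l hl
      rw [FreeGroup.toWord_mk, ← FreeGroup.isReduced_iff_reduce_eq]
      exact isReduced_append_singleton l x _ ((mem_red m x l).1 hl).2 (hz1 _)
    apply Set.ncard_le_ncard_of_injOn (fun l => FreeGroup.mk (φ l)) (ht := finite_len_sep _ _)
    · intro l hl
      have h1 := hred l hl
      refine ⟨?_, ?_⟩
      · change CyclicallyReducedWord _
        rw [cyc_iff, h1]
        simp only [φ]
        rw [FreeGroup.isCyclicallyReduced_cons_append_iff, rel_iff]
        refine ⟨isReduced_append_singleton l x _ ((mem_red m x l).1 hl).2 (hz1 _), ?_⟩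
        intro h
        apply hz2 ((x :: l).getLast (by simp))
        exact (linv_linv _).symm.trans (congrArg linv h.symm)
      · simp only [wordLength, h1]
        simp [φ, ((mem_red m x l).1 hl).1]
    · intro l hl l' hl' h
      have h2 : φ l = φ l' := by
        rw [← hred l hl, ← hred l' hl']
        exact congrArg _ h
      simp only [φ, List.cons_append, List.cons.injEq, true_and] at h2
      exact (List.append_inj' h2 rfl).1
  exact_mod_cast this

lemma rho_C_lower (hk : 2 ≤ k) (n : ℕ) :
    ((2 * k - 1 : ℝ)) ^ n / (2 * k - 1) ^ 2 ≤ (rhoC (Cset k) n : ℝ) := by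
  have hkR : (2:ℝ) ≤ k := by exact_mod_cast hk
  have hq : (1:ℝ) ≤ 2 * k - 1 := by linarith
  by_cases hn : 2 ≤ n
  · obtain ⟨m, rfl⟩ := Nat.exists_eq_add_of_le' hn
    rw [pow_add, mul_div_assoc, div_self (by positivity), mul_one]
    refine (gamma_C_lower hk m).trans ?_
    unfold rhoC
    have hsub : {g ∈ Cset k | wordLength g = m + 2} ⊆ {g ∈ Cset k | wordLength g ≤ m + 2} :=
      fun g hg => ⟨hg.1, hg.2.le⟩
    exact_mod_cast Set.ncard_le_ncard hsub (finite_le_sep _ _)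
  · have h1 : 1 ≤ rhoC (Cset k) n := by
      unfold rhoC
      rw [Nat.succ_le_iff, Set.ncard_pos (finite_le_sep _ _)]
      refine ⟨1, ?_, ?_⟩
      · change CyclicallyReducedWord _
        rw [FreeGroup.toWord_one, cyc_iff]
        simp
      · simp [wordLength]
    have h2 : (2 * k - 1 : ℝ) ^ n / (2 * k - 1) ^ 2 ≤ 1 := by
      rw [div_le_one (by positivity)]
      exact pow_le_pow_right₀ hq (by omega)
    have : (1:ℝ) ≤ rhoC (Cset k) n := by exact_mod_cast h1
    linarith

lemma geom_le (σ : ℝ) (h : 2 ≤ σ) (n : ℕ) : ∑ m ∈ range (n + 1), σ ^ m ≤ 2 * σ ^ n := by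
  induction n with
  | zero => simp
  | succ n ih =>
    rw [sum_range_succ, pow_succ]
    have : 0 < σ ^ n := by positivity
    nlinarith

lemma expGeneric_of_neg (hk : 2 ≤ k) (B : Set (FG k)) (hB : B ⊆ Cset k)
    (hN : Neg k (Cset k \ B)) : ExpGenericIn B (Cset k) := by
  obtain ⟨K, σ, h0, h1, h2, h3⟩ := hN
  have hkR : (2:ℝ) ≤ k := by exact_mod_cast hk
  set q : ℝ := 2 * k - 1 with hq
  have hq3 : 3 ≤ q := by rw [hq]; linarith
  set s : ℝ := max σ 2 with hs
  have hs2 : 2 ≤ s := le_max_right _ _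
  have hsq : s < q := max_lt h2 (by linarith)
  have hγ : ∀ n, ({g ∈ Cset k \ B | wordLength g = n}.ncard : ℝ) ≤ (K + 1) * s ^ n := by
    intro n
    rcases Nat.eq_zero_or_pos n with rfl | hn
    · have : {g ∈ Cset k \ B | wordLength g = 0}.ncard ≤ ({1} : Set (FG k)).ncard := by
        apply Set.ncard_le_ncard _ (Set.finite_singleton _)
        intro g hg
        have := hg.2
        simp only [wordLength, List.length_eq_zero_iff, FreeGroup.toWord_eq_nil_iff] at this
        exact this
      rw [Set.ncard_singleton] at this
      have h' : ({g ∈ Cset k \ B | wordLength g = 0}.ncard : ℝ) ≤ 1 := by exact_mod_cast this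
      simp only [pow_zero, mul_one]
      linarith
    · refine (h3 n hn).trans ?_
      have : σ ^ n ≤ s ^ n := by
        gcongr
        exact le_max_left _ _
      have : 0 < σ ^ n := by positivity
      nlinarith
  have hρ : ∀ n, ({g ∈ Cset k \ B | wordLength g ≤ n}.ncard : ℝ) ≤ 2 * (K + 1) * s ^ n := by
    intro n
    have e : {g ∈ Cset k \ B | wordLength g ≤ n} ⊆
        ⋃ m ∈ range (n+1), {g ∈ Cset k \ B | wordLength g = m} := by
      intro g hg
      simp only [Set.mem_iUnion, mem_range]
      exact ⟨wordLength g, Nat.lt_succ_of_le hg.2, hg.1, rfl⟩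
    have h4 : {g ∈ Cset k \ B | wordLength g ≤ n}.ncard ≤
        ∑ m ∈ range (n+1), {g ∈ Cset k \ B | wordLength g = m}.ncard := by
      refine (Set.ncard_le_ncard e ?_).trans (Finset.set_ncard_biUnion_le _ _)
      exact (range (n+1)).finite_toSet.biUnion fun m _ => finite_len_sep _ m
    calc _ ≤ ∑ m ∈ range (n+1), ({g ∈ Cset k \ B | wordLength g = m}.ncard : ℝ) := by
            exact_mod_cast h4
      _ ≤ ∑ m ∈ range (n+1), (K + 1) * s ^ m := sum_le_sum fun m _ => hγ m
      _ ≤ _ := by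
            rw [← mul_sum]
            have := geom_le s hs2 n
            nlinarith
  refine ⟨hB, 2 * (K + 1) * q ^ 2, by positivity, s / q, by positivity, ?_, fun n => ?_⟩
  · rw [div_lt_one (by linarith)]
    exact hsq
  · have hlow := rho_C_lower hk n
    rw [← hq] at hlow
    have hpos : 0 < q ^ n / q ^ 2 := by positivity
    have hC : 0 < (rhoC (Cset k) n : ℝ) := lt_of_lt_of_le hpos hlow
    have hsplit : (rhoC (Cset k) n : ℝ) = rhoC B n +
        ({g ∈ Cset k \ B | wordLength g ≤ n}.ncard : ℝ) := by
      have : rhoC (Cset k) n = rhoC B n + {g ∈ Cset k \ B | wordLength g ≤ n}.ncard := by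
        unfold rhoC
        rw [← Set.ncard_union_eq _ (finite_le_sep _ _) (finite_le_sep _ _)]
        · congr 1
          ext g
          have := @hB g
          simp only [Set.mem_ofPred_eq, Set.mem_union, Set.mem_sdiff]
          tauto
        · rw [Set.disjoint_left]
          intro g hg hg'
          exact hg'.1.2 hg.1
      exact_mod_cast this
    have e1 : 1 - (rhoC B n : ℝ) / rhoC (Cset k) n =
        ({g ∈ Cset k \ B | wordLength g ≤ n}.ncard : ℝ) / rhoC (Cset k) n := by
      rw [eq_div_iff hC.ne', sub_mul, div_mul_cancel₀ _ hC.ne', one_mul, hsplit]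
      ring
    rw [e1, abs_of_nonneg (by positivity), div_le_iff₀ hC]
    refine (hρ n).trans ?_
    calc 2 * (K + 1) * s ^ n = 2 * (K + 1) * q ^ 2 * (s / q) ^ n * (q ^ n / q ^ 2) := by
          rw [div_pow]
          field_simp
      _ ≤ _ := by
          apply mul_le_mul_of_nonneg_left hlow
          positivity

end ZG

namespace ZG
open Finset

variable {k : ℕ}

lemma neg_of_det (hk : 2 ≤ k) (x0 : Letter k) (S : Set (FG k)) (P : ℕ → List (Letter k) → Prop)
    (T : ℕ → ℕ → Finset ℕ)
    (hS : ∀ g ∈ S, 1 ≤ wordLength g → ∃ s < wordLength g, P s (FreeGroup.toWord g))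
    (hcard : ∀ n s, s < n → (T n s).card ≤ n / 2 + 1)
    (hdet : ∀ n s (w w' : List (Letter k)), s < n → w.length = n → w'.length = n → P s w → P s w' →
      (∀ i ∈ T n s, w.getD i x0 = w'.getD i x0) → ∀ i < n, w.getD i x0 = w'.getD i x0) :
    Neg k S := by
  classical
  have hkR : (2:ℝ) ≤ k := by exact_mod_cast hk
  set r : ℝ := Real.sqrt (2 * k) with hr
  have hr2 : r ^ 2 = 2 * k := Real.sq_sqrt (by linarith)
  have hr0 : 0 < r := Real.sqrt_pos.2 (by linarith)
  have hr1 : 1 ≤ r := by nlinarith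
  refine ⟨5 * k, 1.4 * r, by positivity, by positivity, ?_, fun n hn => ?_⟩
  · apply lt_of_pow_lt_pow_left₀ 2 (by linarith)
    rw [mul_pow, hr2]
    nlinarith
  set A : ℕ → Set (FG k) := fun s => {g | wordLength g = n ∧ P s (FreeGroup.toWord g)} with hA
  have hfin : ∀ s, (A s).Finite := fun s => (finite_len n).subset fun g h => h.1
  have hAc : ∀ s ∈ range n, (A s).ncard ≤ (2 * k) ^ (n / 2 + 1) := by
    intro s hs
    rw [mem_range] at hs
    have h1 : (A s).ncard ≤ (Set.univ : Set (T n s → Letter k)).ncard := by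
      apply Set.ncard_le_ncard_of_injOn
        (fun g (i : T n s) => (FreeGroup.toWord g).getD i.1 x0)
      · intro _ _
        exact Set.mem_univ _
      · intro g hg g' hg' h
        apply FreeGroup.toWord_injective
        have h2 := hdet n s _ _ hs hg.1 hg'.1 hg.2 hg'.2
          (fun i hi => congrFun h ⟨i, hi⟩)
        have l1 : (FreeGroup.toWord g).length = n := hg.1
        have l2 : (FreeGroup.toWord g').length = n := hg'.1
        apply List.ext_getElem (by rw [l1, l2])
        intro i hi hi'
        have := h2 i (by omega)
        rwa [List.getD_eq_getElem _ _ hi, List.getD_eq_getElem _ _ hi'] at this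
    rw [Set.ncard_univ, Nat.card_eq_fintype_card, Fintype.card_fun] at h1
    simp only [Fintype.card_prod, Fintype.card_fin, Fintype.card_bool, Fintype.card_coe] at h1
    refine h1.trans ?_
    rw [mul_comm k 2]
    exact Nat.pow_le_pow_right (by omega) (hcard n s hs)
  have h1 : {g ∈ S | wordLength g = n}.ncard ≤ n * (2 * k) ^ (n / 2 + 1) := by
    have hsub : {g ∈ S | wordLength g = n} ⊆ ⋃ s ∈ range n, A s := by
      rintro g ⟨hg, hl⟩
      obtain ⟨s, hs, hp⟩ := hS g hg (by omega)
      simp only [Set.mem_iUnion, mem_range]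
      exact ⟨s, by omega, hl, hp⟩
    refine (Set.ncard_le_ncard hsub ?_).trans ((Finset.set_ncard_biUnion_le _ _).trans ?_)
    · exact (range n).finite_toSet.biUnion fun m _ => hfin m
    · refine (sum_le_sum hAc).trans ?_
      simp
  have h2 : ({g ∈ S | wordLength g = n}.ncard : ℝ) ≤ n * (2 * k) ^ (n / 2 + 1) := by
    exact_mod_cast h1
  refine h2.trans ?_
  have h3 : (2 * k : ℝ) ^ (n / 2) ≤ r ^ n := by
    rw [← hr2, ← pow_mul]
    exact pow_le_pow_right₀ hr1 (by omega)
  have h4 : (n : ℝ) ≤ 2.5 * 1.4 ^ n := by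
    have := one_add_mul_le_pow (a := (0.4:ℝ)) (by norm_num) n
    norm_num at this ⊢
    linarith
  have h5 : 0 < r ^ n := by positivity
  calc (n : ℝ) * (2 * k) ^ (n / 2 + 1) = n * (2 * k) ^ (n / 2) * (2 * k) := by ring
    _ ≤ (2.5 * 1.4 ^ n) * r ^ n * (2 * k) := by gcongr
    _ = _ := by rw [mul_pow]; ring

lemma neg_rotation (hk : 2 ≤ k) (x0 : Letter k) (τ : Letter k → Letter k) :
    Neg k {g | ∃ s, 0 < s ∧ 2 * s ≤ wordLength g ∧ ∀ i, s ≤ i → i < wordLength g →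
      (FreeGroup.toWord g).getD i x0 = τ ((FreeGroup.toWord g).getD (i - s) x0)} := by
  apply neg_of_det hk x0 _ (fun s w => 0 < s ∧ 2 * s ≤ w.length ∧ ∀ i, s ≤ i → i < w.length →
      w.getD i x0 = τ (w.getD (i - s) x0)) (fun n s => range (n / 2))
  · rintro g ⟨s, h0, h1, h2⟩ hl
    exact ⟨s, by omega, h0, h1, h2⟩
  · intro n s _
    simp
  · rintro n s w w' hs hw hw' ⟨h0, h1, h2⟩ ⟨_, _, h2'⟩ hT i
    induction i using Nat.strong_induction_on with
    | _ i ih =>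
      intro hi
      by_cases hin : i < n / 2
      · exact hT i (mem_range.2 hin)
      · rw [h2 i (by omega) (by omega), h2' i (by omega) (by omega),
          ih (i - s) (by omega) (by omega)]

lemma neg_reflection (hk : 2 ≤ k) (x0 : Letter k) (τ : Letter k → Letter k) :
    Neg k {g | ∃ s, s < wordLength g ∧ ∀ i < wordLength g,
      (i + s < wordLength g → (FreeGroup.toWord g).getD (wordLength g - 1 - s - i) x0 =
        τ ((FreeGroup.toWord g).getD i x0)) ∧
      (wordLength g ≤ i + s → (FreeGroup.toWord g).getD (2 * wordLength g - 1 - s - i) x0 =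
        τ ((FreeGroup.toWord g).getD i x0))} := by
  apply neg_of_det hk x0 _ (fun s w => ∀ i < w.length,
      (i + s < w.length → w.getD (w.length - 1 - s - i) x0 = τ (w.getD i x0)) ∧
      (w.length ≤ i + s → w.getD (2 * w.length - 1 - s - i) x0 = τ (w.getD i x0)))
    (fun n s => range ((n - 1 - s) / 2 + 1) ∪ Ico (n - s) ((2 * n - 1 - s) / 2 + 1))
  · rintro g ⟨s, h0, h1⟩ hl
    exact ⟨s, h0, h1⟩
  · intro n s hs
    refine (card_union_le _ _).trans ?_
    rw [card_range, Nat.card_Ico]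
    omega
  · intro n s w w' hs hw hw' h h' hT i hi
    rw [hw] at h
    rw [hw'] at h'
    by_cases hin : i ∈ range ((n - 1 - s) / 2 + 1) ∪ Ico (n - s) ((2 * n - 1 - s) / 2 + 1)
    · exact hT i hin
    · simp only [mem_union, mem_range, mem_Ico] at hin
      by_cases hc : i + s < n
      · have e : n - 1 - s - (n - 1 - s - i) = i := by omega
        have a1 := (h (n - 1 - s - i) (by omega)).1 (by omega)
        have a2 := (h' (n - 1 - s - i) (by omega)).1 (by omega)
        rw [e] at a1 a2
        rw [a1, a2, hT]
        simp only [mem_union, mem_range, mem_Ico]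
        omega
      · have e : 2 * n - 1 - s - (2 * n - 1 - s - i) = i := by omega
        have a1 := (h (2 * n - 1 - s - i) (by omega)).2 (by omega)
        have a2 := (h' (2 * n - 1 - s - i) (by omega)).2 (by omega)
        rw [e] at a1 a2
        rw [a1, a2, hT]
        simp only [mem_union, mem_range, mem_Ico]
        omega

end ZG

namespace ZG
open Finset

variable {k : ℕ}

lemma mk_cons (x : Letter k) (l : List (Letter k)) :
    (FreeGroup.mk (x :: l) : FG k) = FreeGroup.mk [x] * FreeGroup.mk l := by
  rw [FreeGroup.mul_mk]
  rfl

lemma mk_linv (x : Letter k) : (FreeGroup.mk [linv x] : FG k) = (FreeGroup.mk [x])⁻¹ := by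
  rw [FreeGroup.inv_mk]
  rfl

lemma mem_letterSet (g : FG k) : g ∈ letterSet k ↔ ∃ x : Letter k, g = FreeGroup.mk [x] := by
  constructor
  · rintro ⟨i, rfl | rfl⟩
    · exact ⟨(i, true), rfl⟩
    · exact ⟨(i, false), by rw [FreeGroup.of, FreeGroup.inv_mk]; rfl⟩
  · rintro ⟨⟨i, b⟩, rfl⟩
    refine ⟨i, ?_⟩
    cases b
    · right
      rw [FreeGroup.of, FreeGroup.inv_mk]; rfl
    · left; rfl

lemma mk_single_inj {x y : Letter k} (h : (FreeGroup.mk [x] : FG k) = FreeGroup.mk [y]) :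
    x = y := by
  have := congrArg FreeGroup.toWord h
  simpa [FreeGroup.toWord_mk, FreeGroup.reduce_singleton] using this

lemma relabel_exists (τ : MulAut (FG k)) (h : IsRelabeling τ) :
    ∃ t : Letter k → Letter k, Function.Injective t ∧
      (∀ w, FreeGroup.toWord (τ w) = (FreeGroup.toWord w).map t) ∧ (τ ≠ 1 → ∃ x, t x ≠ x) := by
  have h1 : ∀ x : Letter k, ∃ y : Letter k, τ (FreeGroup.mk [x]) = FreeGroup.mk [y] := by
    intro x
    rw [← mem_letterSet]
    have : τ (FreeGroup.mk [x]) ∈ (⇑τ) '' letterSet k :=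
      ⟨_, (mem_letterSet _).2 ⟨x, rfl⟩, rfl⟩
    rw [h] at this
    exact this
  choose t ht using h1
  have hinj : Function.Injective t := by
    intro x y hxy
    apply mk_single_inj
    apply τ.injective
    rw [ht, ht, hxy]
  have hlinv : ∀ x, t (linv x) = linv (t x) := by
    intro x
    apply mk_single_inj
    rw [← ht, mk_linv, mk_linv, map_inv, ht]
  have hmk : ∀ l, τ (FreeGroup.mk l) = FreeGroup.mk (l.map t) := by
    intro l
    induction l with
    | nil => exact map_one τ
    | cons x l ih =>
      rw [mk_cons, map_mul, ht, ih, List.map_cons, ← mk_cons]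
  refine ⟨t, hinj, ?_, ?_⟩
  · intro w
    conv_lhs => rw [← FreeGroup.mk_toWord (x := w), hmk, FreeGroup.toWord_mk]
    rw [← FreeGroup.isReduced_iff_reduce_eq]
    have hw : FreeGroup.IsReduced (FreeGroup.toWord w) := FreeGroup.isReduced_toWord
    unfold FreeGroup.IsReduced at *
    refine List.isChain_map_of_isChain t ?_ hw
    intro a b
    rw [rel_iff, rel_iff, ← hlinv]
    exact fun hab hab' => hab (hinj hab')
  · intro hne
    by_contra! hcon
    apply hne
    ext w
    rw [← FreeGroup.mk_toWord (x := w), hmk]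
    have : t = id := funext hcon
    simp [this]

lemma cyc_swap {A B : List (Letter k)} (h : FreeGroup.IsCyclicallyReduced (A ++ B)) :
    FreeGroup.IsCyclicallyReduced (B ++ A) := by
  have h3 := (h.flatten_replicate 3).isReduced
  rw [← cyc_iff]
  unfold CyclicallyReducedWord
  rw [← FreeGroup.isReduced_iff_reduce_eq]
  refine h3.infix ⟨A, B, ?_⟩
  simp [List.replicate_succ]

lemma isReduced_append_iff (A B : List (Letter k)) : FreeGroup.IsReduced (A ++ B) ↔
    FreeGroup.IsReduced A ∧ FreeGroup.IsReduced B ∧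
      ∀ x ∈ A.getLast?, ∀ y ∈ B.head?, y ≠ linv x := by
  unfold FreeGroup.IsReduced
  rw [List.isChain_append]
  simp only [rel_iff]

lemma invRev_concat (P : List (Letter k)) (c : Letter k) :
    FreeGroup.invRev (P ++ [c]) = linv c :: FreeGroup.invRev P := by
  simp [FreeGroup.invRev, linv]

lemma not_cyc (P H : List (Letter k)) (hP : P ≠ []) :
    ¬ FreeGroup.IsCyclicallyReduced (P ++ H ++ FreeGroup.invRev P) := by
  intro h
  cases P with
  | nil => exact hP rfl
  | cons x P =>
    have e : x :: P ++ H ++ FreeGroup.invRev (x :: P) =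
        x :: (P ++ H ++ FreeGroup.invRev P) ++ [linv x] := by
      simp [FreeGroup.invRev, linv]
    rw [e, FreeGroup.isCyclicallyReduced_cons_append_iff, rel_iff, linv_linv] at h
    exact h.2 rfl

lemma conj_rot (P : List (Letter k)) : ∀ (G H : List (Letter k)), FreeGroup.IsReduced P →
    FreeGroup.IsCyclicallyReduced G → FreeGroup.IsCyclicallyReduced H →
    (FreeGroup.mk G : FG k) = FreeGroup.mk P * FreeGroup.mk H * (FreeGroup.mk P)⁻¹ →
    G ~r H := by
  induction P using List.reverseRecOn with
  | nil =>
    intro G H _ hG hH h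
    have h1 : (FreeGroup.mk G : FG k) = FreeGroup.mk H := by
      rw [h, ← FreeGroup.one_eq_mk]
      simp
    have h2 := congrArg FreeGroup.toWord h1
    rw [FreeGroup.toWord_mk, FreeGroup.toWord_mk, hG.isReduced.reduce_eq,
      hH.isReduced.reduce_eq] at h2
    rw [h2]
  | append_singleton P c ih =>
    intro G H hP hG hH h
    have hP' : FreeGroup.IsReduced P := ((isReduced_append_iff _ _).1 hP).1
    by_cases hH0 : H = []
    · subst hH0
      have h1 : (FreeGroup.mk G : FG k) = 1 := by
        rw [h, ← FreeGroup.one_eq_mk, mul_one, mul_inv_cancel]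
      have h2 := congrArg FreeGroup.toWord h1
      rw [FreeGroup.toWord_mk, hG.isReduced.reduce_eq, FreeGroup.toWord_one] at h2
      rw [h2]
    by_cases c1 : H.head? = some (linv c)
    · obtain ⟨H', rfl⟩ : ∃ H', H = [linv c] ++ H' := by
        cases H with
        | nil => simp at c1
        | cons y H' =>
          simp at c1
          exact ⟨H', by simp [c1]⟩
      have := ih G (H' ++ [linv c]) hP' hG (cyc_swap hH) (by
        rw [h]
        simp only [← FreeGroup.mul_mk, mk_linv]
        group)
      exact this.trans List.isRotated_append
    by_cases c2 : H.getLast? = some c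
    · obtain ⟨H', rfl⟩ : ∃ H', H = H' ++ [c] := by
        rw [List.getLast?_eq_some_iff] at c2
        exact c2
      have := ih G ([c] ++ H') hP' hG (cyc_swap hH) (by
        rw [h]
        simp only [← FreeGroup.mul_mk]
        group)
      exact this.trans List.isRotated_append
    exfalso
    have hred : FreeGroup.IsReduced ((P ++ [c]) ++ H ++ FreeGroup.invRev (P ++ [c])) := by
      apply FreeGroup.IsReduced.append_overlap _ _ hH0
      · rw [isReduced_append_iff]
        refine ⟨hP, hH.isReduced, ?_⟩
        intro x hx y hy hxy
        simp at hx
        subst hx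
        rw [hxy] at hy
        exact c1 hy
      · rw [isReduced_append_iff]
        refine ⟨hH.isReduced, ?_, ?_⟩
        · rw [FreeGroup.isReduced_iff_reduce_eq, FreeGroup.reduce_invRev, hP.reduce_eq]
        · intro x hx y hy hxy
          rw [invRev_concat] at hy
          simp at hy
          have : c = x := by
            rw [← linv_linv c, hy, hxy, linv_linv]
          subst this
          exact c2 hx
    have hGe : G = (P ++ [c]) ++ H ++ FreeGroup.invRev (P ++ [c]) := by
      have h2 := congrArg FreeGroup.toWord h
      rw [FreeGroup.inv_mk, FreeGroup.mul_mk, FreeGroup.mul_mk, FreeGroup.toWord_mk,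
        FreeGroup.toWord_mk, hG.isReduced.reduce_eq, hred.reduce_eq] at h2
      exact h2
    rw [hGe] at hG
    exact not_cyc _ _ (by simp) hG

lemma isConj_rot {g h : FG k} (hg : g ∈ Cset k) (hh : h ∈ Cset k) (hc : IsConj g h) :
    FreeGroup.toWord g ~r FreeGroup.toWord h := by
  obtain ⟨p, hp⟩ := isConj_iff.1 hc
  apply List.IsRotated.symm
  apply conj_rot (FreeGroup.toWord p) _ _ FreeGroup.isReduced_toWord ((cyc_iff _).1 hh)
    ((cyc_iff _).1 hg)
  rw [FreeGroup.mk_toWord, FreeGroup.mk_toWord, FreeGroup.mk_toWord, hp]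

end ZG

namespace ZG
open Finset

variable {k : ℕ}

def RotS (x0 : Letter k) (τ : Letter k → Letter k) : Set (FG k) :=
  {g | ∃ s, 0 < s ∧ 2 * s ≤ wordLength g ∧ ∀ i, s ≤ i → i < wordLength g →
      (FreeGroup.toWord g).getD i x0 = τ ((FreeGroup.toWord g).getD (i - s) x0)}

def ReflS (x0 : Letter k) (τ : Letter k → Letter k) : Set (FG k) :=
  {g | ∃ s, s < wordLength g ∧ ∀ i < wordLength g,
      (i + s < wordLength g → (FreeGroup.toWord g).getD (wordLength g - 1 - s - i) x0 =
        τ ((FreeGroup.toWord g).getD i x0)) ∧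
      (wordLength g ≤ i + s → (FreeGroup.toWord g).getD (2 * wordLength g - 1 - s - i) x0 =
        τ ((FreeGroup.toWord g).getD i x0))}

def MissS (z : Letter k) : Set (FG k) :=
  {g | ∃ x l, FreeGroup.toWord g = x :: l ∧ pathSum (fun _ y => if y = z then 1 else 0) x l ≤ 0}

lemma neg_miss (hk : 2 ≤ k) (z : Letter k) : Neg k (MissS z) := by
  apply neg_of_sum hk
  apply sum_pos' (fun x _ => sum_nonneg fun y _ => by split_ifs <;> norm_num)
  refine ⟨z, mem_univ _, ?_⟩
  apply sum_pos' (fun y _ => by split_ifs <;> norm_num)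
  refine ⟨z, ?_, by simp⟩
  simp [(linv_ne z).symm]

lemma mem_miss (z : Letter k) (g : FG k) (hl : 1 ≤ wordLength g)
    (h : z ∉ FreeGroup.toWord g) : g ∈ MissS z := by
  have aux : ∀ (l : List (Letter k)) (x : Letter k), z ∉ l →
      pathSum (fun _ y => if y = z then 1 else 0) x l ≤ 0 := by
    intro l
    induction l with
    | nil => intro x _; simp [pathSum]
    | cons y l ih =>
      intro x hx
      simp only [List.mem_cons, not_or] at hx
      simp only [pathSum]
      rw [if_neg (fun h => hx.1 h.symm), zero_add]
      exact ih y hx.2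
  cases hw : FreeGroup.toWord g with
  | nil => simp [wordLength, hw] at hl
  | cons x l =>
    refine ⟨x, l, hw, aux l x ?_⟩
    rw [hw] at h
    exact fun h' => h (List.mem_cons_of_mem _ h')

lemma relabel_cyc (τ : MulAut (FG k)) (h : IsRelabeling τ) (w : FG k) (hw : w ∈ Cset k) :
    τ w ∈ Cset k := by
  obtain ⟨t, _, ht, _⟩ := relabel_exists τ h
  change FreeGroup.reduce (_ ++ _) = _
  have hw' : FreeGroup.reduce (_ ++ _) = _ := hw
  rw [← FreeGroup.toWord_mul, ← map_mul, ht, ht, FreeGroup.toWord_mul, hw', List.map_append]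

lemma power_mem (x0 : Letter k) (w : FG k) (hw : w ∈ Cset k) (hl : 1 ≤ wordLength w)
    (hp : IsProperPower w) : w ∈ RotS x0 id := by
  obtain ⟨u, d, hd, rfl⟩ := hp
  obtain ⟨e, rfl⟩ := Nat.exists_eq_add_of_le' hd
  have h1 : FreeGroup.toWord (u ^ (e + 2)) = _ := FreeGroup.toWord_pow u (e + 2)
  rw [show e + 2 = (e + 1) + 1 by rfl,
    FreeGroup.reduceCyclically.reduce_flatten_replicate_succ FreeGroup.isReduced_toWord] at h1
  set P := FreeGroup.reduceCyclically.conjugator u.toWord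
  set c := FreeGroup.reduceCyclically u.toWord
  have hc : FreeGroup.IsCyclicallyReduced (FreeGroup.toWord (u ^ (e + 2))) := (cyc_iff _).1 hw
  have hP : P = [] := by
    by_contra hP
    rw [h1] at hc
    exact not_cyc _ _ hP hc
  rw [hP] at h1
  simp only [FreeGroup.invRev_empty, List.append_nil, List.nil_append] at h1
  have h2 : FreeGroup.toWord (u ^ (e + 2)) = c ++ (List.replicate (e+1) c).flatten := by
    rw [h1, List.replicate_succ, List.flatten_cons]
  have h3 : FreeGroup.toWord (u ^ (e + 2)) = (List.replicate (e+1) c).flatten ++ c := by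
    rw [h1, List.replicate_succ', List.flatten_concat]
  have hlen : wordLength (u ^ (e + 2)) = (e + 2) * c.length := by
    rw [wordLength, h1]
    simp
  refine ⟨c.length, ?_, ?_, ?_⟩
  · by_contra h0
    have : c.length = 0 := by omega
    rw [this] at hlen
    omega
  · rw [hlen]
    exact Nat.mul_le_mul_right _ (by omega)
  · intro i hi hi'
    rw [id]
    conv_lhs => rw [h2]
    conv_rhs => rw [h3]
    have hl2 : (List.replicate (e+1) c).flatten.length = (e + 1) * c.length := by simp
    have : (e + 2) * c.length = (e + 1) * c.length + c.length := by ring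
    rw [List.getD_append_right _ _ _ _ hi, List.getD_append _ _ _ _ (by omega)]

lemma conj_mem (x0 : Letter k) (w : FG k) (hw : w ∈ Cset k) (hl : 1 ≤ wordLength w)
    (τ : MulAut (FG k)) (hτ : IsRelabeling τ) (hne : τ ≠ 1) (hc : IsConj (τ w) w) :
    (∃ σ, w ∈ RotS x0 σ) ∨ ∃ z, w ∈ MissS z := by
  have hrot := isConj_rot (relabel_cyc τ hτ w hw) hw hc
  obtain ⟨t, hinj, ht, hx⟩ := relabel_exists τ hτ
  obtain ⟨z, hz⟩ := hx hne
  rw [ht] at hrot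
  obtain ⟨m, hm⟩ := hrot.symm
  set W := FreeGroup.toWord w with hW
  set n := W.length with hn
  have hl' : 1 ≤ n := hl
  rw [← List.rotate_mod] at hm
  set s := m % n with hs
  have hsn : s < n := Nat.mod_lt _ (by omega)
  have key : ∀ i < n, t (W.getD i x0) = W.getD ((i + s) % n) x0 := by
    intro i hi
    have h1 := congrArg (fun l => l[i]?) hm
    have hmod : (i + s) % W.length < W.length := Nat.mod_lt _ (by omega)
    rw [List.getElem?_eq_getElem (by simpa using hi),
      List.getElem?_eq_getElem (by simpa using hi), List.getElem_rotate, List.getElem_map] at h1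
    rw [List.getD_eq_getElem _ _ hi, List.getD_eq_getElem _ _ hmod]
    exact (Option.some_injective _ h1).symm
  by_cases h0 : s = 0
  · right
    refine ⟨z, mem_miss z w hl ?_⟩
    intro hmem
    obtain ⟨i, hi, hiz⟩ := List.getElem_of_mem hmem
    have h2 := key i hi
    rw [h0, add_zero, Nat.mod_eq_of_lt hi, List.getD_eq_getElem _ _ hi] at h2
    rw [← hiz] at hz
    exact hz h2
  left
  by_cases h2s : 2 * s ≤ n
  · refine ⟨t, s, by omega, h2s, ?_⟩
    intro i hi hi'
    have hi'' : i < n := hi'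
    have := key (i - s) (by omega)
    rw [Nat.sub_add_cancel hi, Nat.mod_eq_of_lt hi''] at this
    exact this.symm
  · have : Nonempty (Letter k) := ⟨x0⟩
    refine ⟨Function.invFun t, n - s, by omega, ?_, ?_⟩
    · change 2 * (n - s) ≤ n
      omega
    intro i hi hi'
    have hi'' : i < n := hi'
    have := key i hi''
    have e : (i + s) % n = i - (n - s) := by
      rw [Nat.mod_eq_sub_mod (by omega), Nat.mod_eq_of_lt (by omega)]
      omega
    rw [e] at this
    rw [← this, Function.leftInverse_invFun hinj]

lemma refl_mem (x0 : Letter k) (w : FG k) (hl : 1 ≤ wordLength w)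
    (τ : MulAut (FG k)) (hτ : IsRelabeling τ) (hc : IsCyclicPerm (τ w) w⁻¹) :
    ∃ σ, w ∈ ReflS x0 σ := by
  obtain ⟨t, hinj, ht, -⟩ := relabel_exists τ hτ
  obtain ⟨m, hm⟩ := hc
  rw [ht, FreeGroup.toWord_inv] at hm
  set W := FreeGroup.toWord w with hW
  set n := W.length with hn
  have hl' : 1 ≤ n := hl
  have hinvlen : (FreeGroup.invRev W).length = n := FreeGroup.invRev_length
  rw [← List.rotate_mod, hinvlen] at hm
  set s := m % n with hs
  have hsn : s < n := Nat.mod_lt _ (by omega)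
  have key : ∀ i < n, linv (t (W.getD i x0)) = W.getD (n - 1 - (i + s) % n) x0 := by
    intro i hi
    have h1 := congrArg (fun l => l[i]?) hm
    have hmod : (i + s) % n < n := Nat.mod_lt _ (by omega)
    rw [List.getElem?_eq_getElem (by simpa using hi),
      List.getElem?_eq_getElem (by simpa using hi), List.getElem_rotate, List.getElem_map] at h1
    rw [List.getD_eq_getElem _ _ hi, List.getD_eq_getElem _ _ (by omega), Option.some_injective _ h1]
    simp only [FreeGroup.invRev, List.getElem_reverse, List.getElem_map, linv]
    simp [hn]
  refine ⟨fun x => linv (t x), s, hsn, fun i hi => ⟨fun h => ?_, fun h => ?_⟩⟩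
  · have hi' : i < n := hi
    have h' : i + s < n := h
    have := key i hi'
    rw [Nat.mod_eq_of_lt h'] at this
    refine Eq.trans ?_ this.symm
    change W.getD (n - 1 - s - i) x0 = _
    congr 1
    omega
  · have hi' : i < n := hi
    have h' : n ≤ i + s := h
    have := key i hi'
    rw [Nat.mod_eq_sub_mod h', Nat.mod_eq_of_lt (by omega)] at this
    refine Eq.trans ?_ this.symm
    change W.getD (2 * n - 1 - s - i) x0 = _
    congr 1
    omega

end ZG

namespace ZG
open Finset

variable {k : ℕ}

/-- indicator -/
def ind (b : Bool) : ℝ := if b then 1 else 0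

/-- local contribution of a two-letter subword to the change of length -/
def wf (a : Letter k) (R : Letter k → Bool) (x y : Letter k) : ℝ :=
  if y = a then ind (R x) else if y = linv a then -ind (R x) else
  if x = a then -ind (R (linv y)) else if x = linv a then ind (R (linv y)) else
  |ind (R x) - ind (R (linv y))|

lemma ind_nonneg (b : Bool) : 0 ≤ ind b := by cases b <;> simp [ind]
lemma ind_le (b : Bool) : ind b ≤ 1 := by cases b <;> simp [ind]

lemma wf_ge (a : Letter k) (R : Letter k → Bool) (x y : Letter k) : -1 ≤ wf a R x y := by
  have h1 := ind_nonneg (R x)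
  have h2 := ind_le (R x)
  have h3 := ind_nonneg (R (linv y))
  have h4 := ind_le (R (linv y))
  have h5 := abs_nonneg (ind (R x) - ind (R (linv y)))
  unfold wf
  split_ifs <;> linarith

def Valid (a : Letter k) (R : Letter k → Bool) : Prop :=
  R a = false ∧ R (linv a) = false

lemma wf_sum_pos (a : Letter k) (R : Letter k → Bool) (hv : Valid a R)
    (h1 : ∃ x, x ≠ a ∧ x ≠ linv a ∧ R x = true) (h2 : ∃ x, x ≠ a ∧ x ≠ linv a ∧ R x = false) :
    0 < ∑ x, ∑ y ∈ univ.filter (fun y => y ≠ linv x), wf a R x y := by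
  obtain ⟨ha, hb⟩ := hv
  have hne := linv_ne a
  have e1 : ∀ x, wf a R x (linv x) = 0 := by
    intro x
    unfold wf
    by_cases c1 : linv x = a
    · have : x = linv a := by rw [← c1, linv_linv]
      rw [if_pos c1, this, hb]; simp [ind]
    · by_cases c2 : linv x = linv a
      · have : x = a := by rw [← linv_linv x, c2, linv_linv]
        rw [if_neg c1, if_pos c2, this, ha]; simp [ind]
      · have c3 : x ≠ a := fun h => c2 (by rw [h])
        have c4 : x ≠ linv a := fun h => c1 (by rw [h, linv_linv])
        simp [c1, c2, c3, c4, linv_linv]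
  have e2 : ∀ x, ∑ y ∈ univ.filter (fun y => y ≠ linv x), wf a R x y = ∑ y, wf a R x y := by
    intro x
    rw [sum_filter_ne, e1, sub_zero]
  rw [sum_congr rfl fun x _ => e2 x]
  set p : Letter k → Letter k → ℝ := fun x y =>
    if y = a ∨ y = linv a ∨ x = a ∨ x = linv a then 0 else |ind (R x) - ind (R (linv y))| with hp
  have e3 : ∀ x y, wf a R x y = p x y + ((if y = a then ind (R x) else 0) -
      (if y = linv a then ind (R x) else 0) - (if x = a then ind (R (linv y)) else 0) +
      (if x = linv a then ind (R (linv y)) else 0)) := by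
    intro x y
    simp only [wf, hp]
    have i0 : ind false = 0 := by simp [ind]
    by_cases c1 : y = a
    · subst c1
      simp [hne.symm, hb, i0]
    · by_cases c2 : y = linv a
      · subst c2
        simp [hne, linv_linv, ha, i0]
      · by_cases c3 : x = a
        · subst c3
          simp [c1, c2, hne.symm]
        · by_cases c4 : x = linv a
          · subst c4
            simp [c1, c2, hne]
          · simp [c1, c2, c3, c4]
  simp_rw [e3]
  simp only [sum_add_distrib, sum_sub_distrib]
  have s1 : ∀ b : Letter k, ∑ x : Letter k, ∑ y, (if y = b then ind (R x) else 0)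
      = ∑ x, ind (R x) := by
    intro b
    simp
  have s2 : ∀ b : Letter k, ∑ x : Letter k, ∑ y, (if x = b then ind (R (linv y)) else 0)
      = ∑ y, ind (R (linv y)) := by
    intro b
    rw [sum_comm]
    simp
  rw [s1, s1, s2, s2]
  have hpn : ∀ x y, 0 ≤ p x y := by
    intro x y
    simp only [hp]
    split_ifs
    · exact le_rfl
    · exact abs_nonneg _
  have : 0 < ∑ x, ∑ y, p x y := by
    obtain ⟨x, hx1, hx2, hx3⟩ := h1
    obtain ⟨z, hz1, hz2, hz3⟩ := h2
    apply sum_pos' (fun x _ => sum_nonneg fun y _ => hpn x y)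
    refine ⟨x, mem_univ _, ?_⟩
    apply sum_pos' (fun y _ => hpn x y)
    refine ⟨linv z, mem_univ _, ?_⟩
    have c1 : linv z ≠ a := fun h => hz2 (by rw [← h, linv_linv])
    have c2 : linv z ≠ linv a := fun h => hz1 (by rw [← linv_linv z, h, linv_linv])
    simp [hp, c1, c2, hx1, hx2, hx3, hz3, linv_linv, ind]
  linarith

def WhS (a : Letter k) (R : Letter k → Bool) : Set (FG k) :=
  {g | ∃ x l, FreeGroup.toWord g = x :: l ∧ pathSum (wf a R) x l ≤ 1}

lemma neg_Wh (hk : 2 ≤ k) (a : Letter k) (R : Letter k → Bool) (hv : Valid a R)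
    (h1 : ∃ x, x ≠ a ∧ x ≠ linv a ∧ R x = true) (h2 : ∃ x, x ≠ a ∧ x ≠ linv a ∧ R x = false) :
    Neg k (WhS a R) :=
  neg_of_sum hk _ 1 (wf_sum_pos a R hv h1 h2)

/-- power `a` or `1` -/
def pw (A : FG k) (b : Bool) : FG k := if b then A else 1

def HeadCond (a : Letter k) (R : Letter k → Bool) (y : Letter k) (L : List (Letter k)) : Prop :=
  (y ≠ a → y ≠ linv a → L.head? = some y) ∧
  (y = a → ∀ z ∈ L.head?, z = a ∨ (z ≠ linv a ∧ R (linv z) = true)) ∧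
  (y = linv a → ∃ L', L = linv a :: L' ∧
    ∀ z ∈ L'.head?, z = linv a ∨ (z ≠ a ∧ R (linv z) = false))

lemma isReduced_cons (x : Letter k) (L : List (Letter k)) (h : FreeGroup.IsReduced L)
    (h' : ∀ z ∈ L.head?, z ≠ linv x) : FreeGroup.IsReduced (x :: L) := by
  cases L with
  | nil => simp
  | cons y L =>
    rw [isReduced_cons_cons]
    exact ⟨h' y (by simp), h⟩

lemma wh_word (a : Letter k) (R : Letter k → Bool) (hv : Valid a R) (τ : MulAut (FG k))
    (hτ : ∀ x, τ (FreeGroup.mk [x]) = (pw (FreeGroup.mk [a]) (R (linv x)))⁻¹ *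
      FreeGroup.mk [x] * pw (FreeGroup.mk [a]) (R x)) :
    ∀ (l : List (Letter k)) (y : Letter k), FreeGroup.IsReduced (y :: l) →
    ∃ (L : List (Letter k)) (b : Bool), FreeGroup.IsReduced L ∧
      FreeGroup.mk L = pw (FreeGroup.mk [a]) (R (linv y)) * τ (FreeGroup.mk (y :: l)) *
        (pw (FreeGroup.mk [a]) b)⁻¹ ∧
      (L.length : ℝ) = 1 + l.length + pathSum (wf a R) y l ∧ HeadCond a R y L := by
  obtain ⟨ha, hb⟩ := hv
  have hne := linv_ne a
  intro l
  induction l with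
  | nil =>
    intro y _
    refine ⟨[y], R y, by simp, ?_, by simp [pathSum], fun _ _ => rfl, ?_, ?_⟩
    · rw [hτ y]; group
    · rintro rfl z hz
      simp at hz
      exact Or.inl hz.symm
    · rintro rfl
      exact ⟨[], rfl, by simp⟩
  | cons y l ih =>
    intro x hxy
    rw [isReduced_cons_cons] at hxy
    obtain ⟨hyx, hred⟩ := hxy
    obtain ⟨L, b, hL1, hL2, hL3, hc1, hc2, hc3⟩ := ih y hred
    have hmk : ∀ M : List (Letter k), FreeGroup.mk M = FreeGroup.mk [x] * pw (FreeGroup.mk [a]) (R x)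
        * (pw (FreeGroup.mk [a]) (R (linv y)))⁻¹ * FreeGroup.mk L →
        FreeGroup.mk M = pw (FreeGroup.mk [a]) (R (linv x)) *
          τ (FreeGroup.mk (x :: y :: l)) * (pw (FreeGroup.mk [a]) b)⁻¹ := by
      intro M hM
      rw [hM, hL2, mk_cons x (y :: l), map_mul, hτ x]
      group
    have hlen : ∀ M : List (Letter k), (M.length : ℝ) = L.length + 1 + wf a R x y →
        (M.length : ℝ) = 1 + (y :: l).length + pathSum (wf a R) x (y :: l) := by
      intro M hM
      rw [hM, hL3, pathSum, List.length_cons]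
      push_cast
      ring
    have fin : ∀ M : List (Letter k), FreeGroup.IsReduced M →
        FreeGroup.mk M = FreeGroup.mk [x] * pw (FreeGroup.mk [a]) (R x)
        * (pw (FreeGroup.mk [a]) (R (linv y)))⁻¹ * FreeGroup.mk L →
        (M.length : ℝ) = L.length + 1 + wf a R x y → HeadCond a R x M →
        ∃ (L : List (Letter k)) (b : Bool), FreeGroup.IsReduced L ∧
      FreeGroup.mk L = pw (FreeGroup.mk [a]) (R (linv x)) * τ (FreeGroup.mk (x :: y :: l)) *
        (pw (FreeGroup.mk [a]) b)⁻¹ ∧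
      (L.length : ℝ) = 1 + (y :: l).length + pathSum (wf a R) x (y :: l) ∧ HeadCond a R x L :=
      fun M h1 h2 h3 h4 => ⟨M, b, h1, hmk M h2, hlen M h3, h4⟩
    have hother : ∀ M, x ≠ a → x ≠ linv a → HeadCond a R x (x :: M) := by
      intro M h1 h2
      exact ⟨fun _ _ => rfl, fun h => absurd h h1, fun h => absurd h h2⟩
    have hca : ∀ M, x = a → (∀ z ∈ M.head?, z = a ∨ (z ≠ linv a ∧ R (linv z) = true)) →
        HeadCond a R x M := by
      rintro M rfl h
      exact ⟨fun h => absurd rfl h, fun _ => h, fun h => absurd h.symm hne⟩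
    have hcb : ∀ M, x = linv a → (∀ z ∈ M.head?, z = linv a ∨ (z ≠ a ∧ R (linv z) = false)) →
        HeadCond a R x (linv a :: M) := by
      rintro M rfl h
      exact ⟨fun _ h => absurd rfl h, fun h => absurd h hne, fun _ => ⟨M, rfl, h⟩⟩
    have hlx : x ≠ linv a → a ≠ linv x := fun h h' => h (by rw [h', linv_linv])
    have hlx' : x ≠ a → linv a ≠ linv x := fun h h' => h (by rw [← linv_linv x, ← h', linv_linv])
    by_cases ya : y = a
    · subst ya
      by_cases xa : x = y
      · subst xa
        refine fin (x :: L) ?_ ?_ ?_ ?_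
        · apply isReduced_cons _ _ hL1
          intro z hz
          rcases hc2 rfl z hz with rfl | h
          · exact hne.symm
          · exact h.1
        · rw [mk_cons]; simp [pw, ha, hb]
        · simp [wf, ha, ind]
        · exact hca _ rfl (by simp)
      · have xb : x ≠ linv y := fun h => hyx (by rw [h, linv_linv])
        cases hR : R x
        · refine fin (x :: L) ?_ ?_ ?_ (hother _ xa xb)
          · apply isReduced_cons _ _ hL1
            intro z hz
            rcases hc2 rfl z hz with rfl | h
            · exact hlx xb
            · intro h'
              rw [h', linv_linv, hR] at h
              simp at h
          · rw [mk_cons]; simp [pw, hR, hb]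
          · simp [wf, hR, ind]
        · refine fin (x :: y :: L) ?_ ?_ ?_ (hother _ xa xb)
          · rw [isReduced_cons_cons]
            refine ⟨hyx, isReduced_cons _ _ hL1 ?_⟩
            intro z hz
            rcases hc2 rfl z hz with rfl | h
            · exact hne.symm
            · exact h.1
          · rw [mk_cons, mk_cons y]; simp [pw, hR, hb]
          · simp [wf, hR, ind]
    by_cases yb : y = linv a
    · obtain ⟨L', rfl, hL'⟩ := hc3 yb
      subst yb
      have xa : x ≠ a := fun h => hyx (by rw [h])
      by_cases xb : x = linv a
      · refine fin (linv a :: linv a :: L') ?_ ?_ ?_ (hcb _ xb (by simp))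
        · rw [isReduced_cons_cons]
          exact ⟨by rw [linv_linv]; exact hne, hL1⟩
        · rw [mk_cons, xb]; simp [pw, ha, hb, linv_linv]
        · simp [wf, hne, xb, hb, ind]
      · cases hR : R x
        · refine fin (x :: linv a :: L') ?_ ?_ ?_ (hother _ xa xb)
          · rw [isReduced_cons_cons]
            exact ⟨hyx, hL1⟩
          · rw [mk_cons]; simp [pw, hR, ha, linv_linv]
          · simp [wf, hne, hR, ind]
        · refine fin (x :: L') ?_ ?_ ?_ (hother _ xa xb)
          · apply isReduced_cons
            · exact hL1.infix ⟨[linv a], [], by simp⟩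
            intro z hz
            rcases hL' z hz with rfl | h
            · exact hyx
            · intro h'
              rw [h', linv_linv, hR] at h
              simp at h
          · rw [mk_cons, mk_cons (linv a), mk_linv]
            simp only [pw, hR, ha, linv_linv]
            simp [-FreeGroup.mul_mk, -FreeGroup.inv_mk, mul_assoc]
          · simp [wf, hne, hR, ind]
    · have hhead := hc1 ya yb
      obtain ⟨L', rfl⟩ : ∃ L', L = y :: L' := by
        cases L with
        | nil => simp at hhead
        | cons u L' => 
          simp at hhead
          exact ⟨L', by rw [hhead]⟩
      by_cases xa : x = a
      · subst xa
        cases hR : R (linv y)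
        · refine fin (x :: y :: L') ?_ ?_ ?_ (hca _ rfl (by simp))
          · rw [isReduced_cons_cons]
            exact ⟨hyx, hL1⟩
          · rw [mk_cons]; simp [pw, hR, ha]
          · simp [wf, ya, yb, hR, ind]
        · refine fin (y :: L') hL1 ?_ ?_ (hca _ rfl (by simp [yb, hR]))
          · simp only [pw, hR, ha]
            simp [-FreeGroup.mul_mk, -FreeGroup.inv_mk]
          · simp [wf, ya, yb, hR, ind]
      by_cases xb : x = linv a
      · cases hR : R (linv y)
        · refine fin (linv a :: y :: L') ?_ ?_ ?_ (hcb _ xb (by simp [ya, hR]))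
          · rw [isReduced_cons_cons]
            exact ⟨by rw [linv_linv]; exact ya, hL1⟩
          · rw [mk_cons, xb]; simp [pw, hR, hb]
          · simp [wf, ya, yb, hne, xb, hR, ind]
        · refine fin (linv a :: linv a :: y :: L') ?_ ?_ ?_ (hcb _ xb (by simp))
          · rw [isReduced_cons_cons, isReduced_cons_cons, linv_linv]
            exact ⟨hne, ya, hL1⟩
          · rw [mk_cons (linv a) (linv a :: y :: L'), mk_cons (linv a) (y :: L'), xb, mk_linv]
            simp only [pw, hR, hb]
            simp [-FreeGroup.mul_mk, -FreeGroup.inv_mk, mul_assoc]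
          · simp [wf, ya, yb, hne, xb, hR, ind]
      have base : R x = R (linv y) → FreeGroup.IsReduced (x :: y :: L') ∧
          ((x :: y :: L').length : ℝ) = (y :: L').length + 1 + wf a R x y := by
        intro h
        refine ⟨by rw [isReduced_cons_cons]; exact ⟨hyx, hL1⟩, ?_⟩
        simp [wf, ya, yb, xa, xb, h]
      cases hRx : R x <;> cases hRy : R (linv y)
      · obtain ⟨b1, b2⟩ := base (by rw [hRx, hRy])
        refine fin _ b1 ?_ b2 (hother _ xa xb)
        rw [mk_cons]; simp [pw, hRx, hRy]
      · refine fin (x :: linv a :: y :: L') ?_ ?_ ?_ (hother _ xa xb)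
        · rw [isReduced_cons_cons, isReduced_cons_cons, linv_linv]
          exact ⟨hlx' xa, ya, hL1⟩
        · rw [mk_cons, mk_cons (linv a), mk_linv]
          simp only [pw, hRx, hRy]
          simp [-FreeGroup.mul_mk, -FreeGroup.inv_mk, mul_assoc]
        · simp [wf, ya, yb, xa, xb, hRx, hRy, ind]
      · refine fin (x :: a :: y :: L') ?_ ?_ ?_ (hother _ xa xb)
        · rw [isReduced_cons_cons, isReduced_cons_cons]
          exact ⟨hlx xb, yb, hL1⟩
        · rw [mk_cons, mk_cons a]
          simp only [pw, hRx, hRy]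
          simp [-FreeGroup.mul_mk, -FreeGroup.inv_mk, mul_assoc]
        · simp [wf, ya, yb, xa, xb, hRx, hRy, ind]
      · obtain ⟨b1, b2⟩ := base (by rw [hRx, hRy])
        refine fin _ b1 ?_ b2 (hother _ xa xb)
        rw [mk_cons]
        simp only [pw, hRx, hRy]
        simp [-FreeGroup.mul_mk, -FreeGroup.inv_mk, mul_assoc]

end ZG

namespace ZG
open Finset

variable {k : ℕ}

lemma pathSum_append (f : Letter k → Letter k → ℝ) (l V : List (Letter k)) (x y : Letter k) :
    pathSum f x (l ++ y :: V) = pathSum f x (l ++ [y]) + pathSum f y V := by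
  induction l generalizing x with
  | nil => simp [pathSum]
  | cons z l ih =>
    simp only [List.cons_append, pathSum]
    rw [ih]; ring

lemma pathSum_snoc (f : Letter k → Letter k → ℝ) (hf : ∀ x y, -1 ≤ f x y)
    (l : List (Letter k)) (x y : Letter k) :
    pathSum f x l - 1 ≤ pathSum f x (l ++ [y]) := by
  induction l generalizing x with
  | nil => simp [pathSum]; linarith [hf x y]
  | cons z l ih =>
    simp only [List.cons_append, pathSum]
    linarith [ih z]

/-- periodic continuation -/
def U (y : Letter k) (l : List (Letter k)) : ℕ → List (Letter k)
  | 0 => []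
  | m+1 => l ++ y :: U y l m

lemma U_flat (y : Letter k) (l : List (Letter k)) (m : ℕ) :
    y :: U y l m ++ l = (List.replicate (m+1) (y :: l)).flatten := by
  induction m with
  | zero => simp [U]
  | succ m ih =>
    rw [List.replicate_succ, List.flatten_cons, ← ih]
    simp [U]

lemma U_red (y : Letter k) (l : List (Letter k)) (h : FreeGroup.IsCyclicallyReduced (y :: l))
    (m : ℕ) : FreeGroup.IsReduced (y :: U y l m) := by
  have := (h.flatten_replicate (m+1)).1
  rw [← U_flat] at this
  exact this.infix ⟨[], l, by simp⟩

lemma U_mk (y : Letter k) (l : List (Letter k)) (m : ℕ) :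
    FreeGroup.mk (y :: U y l m) = (FreeGroup.mk (y :: l)) ^ m * FreeGroup.mk [y] := by
  induction m with
  | zero => simp [U]
  | succ m ih =>
    rw [pow_succ', mul_assoc, ← ih, FreeGroup.mul_mk]
    simp [U]

lemma U_sum (f : Letter k → Letter k → ℝ) (y : Letter k) (l : List (Letter k)) (m : ℕ) :
    pathSum f y (U y l m) = m * pathSum f y (l ++ [y]) := by
  induction m with
  | zero => simp [U, pathSum]
  | succ m ih =>
    rw [U, pathSum_append, ih]; push_cast; ring

lemma U_len (y : Letter k) (l : List (Letter k)) (m : ℕ) :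
    ((U y l m).length : ℝ) = m * (y :: l).length := by
  induction m with
  | zero => simp [U]
  | succ m ih =>
    rw [U, List.length_append, List.length_cons]; push_cast; rw [ih]
    simp; ring

lemma norm_pow_le (g : FG k) (m : ℕ) : (g ^ m).norm ≤ m * g.norm := by
  induction m with
  | zero => simp
  | succ m ih =>
    rw [pow_succ]
    refine (FreeGroup.norm_mul_le _ _).trans ?_
    rw [add_mul, one_mul]; omega

lemma wh_len (a : Letter k) (R : Letter k → Bool) (hv : Valid a R) (τ : MulAut (FG k))
    (hτ : ∀ x, τ (FreeGroup.mk [x]) = (pw (FreeGroup.mk [a]) (R (linv x)))⁻¹ *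
      FreeGroup.mk [x] * pw (FreeGroup.mk [a]) (R x))
    (w : FG k) (y : Letter k) (l : List (Letter k)) (hw : w.toWord = y :: l)
    (hc : w ∈ Cset k) (p u : FG k) (hu : τ w = p * u * p⁻¹) :
    (wordLength w : ℝ) + pathSum (wf a R) y (l ++ [y]) ≤ wordLength u := by
  have hcyc : FreeGroup.IsCyclicallyReduced (y :: l) := by
    rw [← hw]; exact (cyc_iff _).1 hc
  have hwm : FreeGroup.mk (y :: l) = w := by rw [← hw, FreeGroup.mk_toWord]
  set A : FG k := FreeGroup.mk [a] with hA
  have hpw : ∀ b, (pw A b).norm ≤ 1 := by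
    intro b
    cases b
    · simp [pw]
    · simp only [pw, hA, if_true]
      exact FreeGroup.norm_mk_le
  set D : ℕ := 2 * p.norm + (τ (FreeGroup.mk [y])).norm + 2 with hD
  have key : ∀ m : ℕ, (m : ℝ) * (wordLength w + pathSum (wf a R) y (l ++ [y])) ≤
      D + m * wordLength u := by
    intro m
    obtain ⟨L, b, h1, h2, h3, -⟩ := wh_word a R hv τ hτ (U y l m) y (U_red y l hcyc m)
    have hn : (FreeGroup.mk L).norm = L.length := by
      rw [FreeGroup.norm, FreeGroup.toWord_mk, h1.reduce_eq]
    have hb : (FreeGroup.mk L).norm ≤ D + m * u.norm := by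
      rw [h2, ← hA, U_mk, hwm, map_mul, map_pow, hu, conj_pow]
      have e1 := FreeGroup.norm_mul_le (pw A (R (linv y)) * (p * u ^ m * p⁻¹ * τ (FreeGroup.mk [y])))
        (pw A b)⁻¹
      have e2 := FreeGroup.norm_mul_le (pw A (R (linv y))) (p * u ^ m * p⁻¹ * τ (FreeGroup.mk [y]))
      have e3 := FreeGroup.norm_mul_le (p * u ^ m * p⁻¹) (τ (FreeGroup.mk [y]))
      have e4 := FreeGroup.norm_mul_le (p * u ^ m) p⁻¹
      have e5 := FreeGroup.norm_mul_le p (u ^ m)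
      have e6 := norm_pow_le u m
      have e7 := hpw b
      have e8 := hpw (R (linv y))
      rw [FreeGroup.norm_inv_eq] at e1 e4
      omega
    rw [hn] at hb
    have hb' : (L.length : ℝ) ≤ D + m * wordLength u := by exact_mod_cast hb
    rw [h3, U_len, U_sum, ← hw] at hb'
    have : ((w.toWord).length : ℝ) = wordLength w := rfl
    rw [this] at hb'
    linarith
  by_contra hlt
  push Not at hlt
  obtain ⟨m, hm⟩ := exists_nat_gt ((D : ℝ) /
    (wordLength w + pathSum (wf a R) y (l ++ [y]) - wordLength u))
  rw [div_lt_iff₀ (by linarith)] at hm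
  have := key m
  nlinarith

lemma cyc_nonempty (g : FG k) :
    ∃ x u : FG k, IsCyclicallyReduced u ∧ g = x * u * x⁻¹ := by
  have hr : FreeGroup.IsReduced g.toWord := FreeGroup.isReduced_toWord
  have h1 := FreeGroup.reduceCyclically.isCyclicallyReduced hr
  refine ⟨FreeGroup.mk (FreeGroup.reduceCyclically.conjugator g.toWord),
    FreeGroup.mk (FreeGroup.reduceCyclically g.toWord), ?_, ?_⟩
  · unfold IsCyclicallyReduced
    rw [cyc_iff, FreeGroup.toWord_mk, h1.1.reduce_eq]
    exact h1
  · rw [FreeGroup.inv_mk, FreeGroup.mul_mk, FreeGroup.mul_mk,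
      FreeGroup.reduceCyclically.conj_conjugator_reduceCyclically, FreeGroup.mk_toWord]

lemma wh_lt (a : Letter k) (R : Letter k → Bool) (hv : Valid a R) (τ : MulAut (FG k))
    (hτ : ∀ x, τ (FreeGroup.mk [x]) = (pw (FreeGroup.mk [a]) (R (linv x)))⁻¹ *
      FreeGroup.mk [x] * pw (FreeGroup.mk [a]) (R x))
    (w : FG k) (hl : 1 ≤ wordLength w) (hc : w ∈ Cset k) (hw : w ∉ WhS a R) :
    wordLength w < cyclicLength (τ w) := by
  cases h : w.toWord with
  | nil => simp [wordLength, h] at hl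
  | cons y l =>
    have hne : {n | ∃ x u : FG k, IsCyclicallyReduced u ∧ τ w = x * u * x⁻¹ ∧
        wordLength u = n}.Nonempty := by
      obtain ⟨x, u, h1, h2⟩ := cyc_nonempty (τ w)
      exact ⟨_, x, u, h1, h2, rfl⟩
    obtain ⟨x, u, h1, h2, h3⟩ := Nat.sInf_mem hne
    have := wh_len a R hv τ hτ w y l h hc x u h2
    have h4 := pathSum_snoc (wf a R) (wf_ge a R) l y y
    have h5 : 1 < pathSum (wf a R) y l := by
      by_contra h6
      exact hw ⟨y, l, h, not_lt.1 h6⟩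
    unfold cyclicLength
    rw [← h3]
    have h7 : (wordLength w : ℝ) < wordLength u := by linarith
    exact_mod_cast h7

lemma mul_aut_ext (τ σ : MulAut (FG k))
    (h : ∀ x, τ (FreeGroup.mk [x]) = σ (FreeGroup.mk [x])) : τ = σ := by
  have : τ.toMonoidHom = σ.toMonoidHom := by
    apply FreeGroup.ext_hom
    intro i
    exact h (i, true)
  ext g
  exact DFunLike.congr_fun this g

lemma wh_form (τ : MulAut (FG k)) (h : IsWhitehead2 τ) (hi : ¬ IsInner τ) :
    ∃ (a : Letter k) (R : Letter k → Bool), Valid a R ∧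
      (∀ x, τ (FreeGroup.mk [x]) = (pw (FreeGroup.mk [a]) (R (linv x)))⁻¹ *
      FreeGroup.mk [x] * pw (FreeGroup.mk [a]) (R x)) ∧
      (∃ x, x ≠ a ∧ x ≠ linv a ∧ R x = true) ∧ (∃ x, x ≠ a ∧ x ≠ linv a ∧ R x = false) := by
  obtain ⟨A, hA, hAA, hx⟩ := h
  obtain ⟨a, rfl⟩ := (mem_letterSet A).1 hA
  have h1 : ∀ i : Fin k, ∃ l r : Bool, τ (FreeGroup.mk [(i, true)]) =
      (pw (FreeGroup.mk [a]) l)⁻¹ * FreeGroup.mk [(i, true)] * pw (FreeGroup.mk [a]) r ∧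
      (i = a.1 → l = false ∧ r = false) := by
    intro i
    by_cases hia : i = a.1
    · refine ⟨false, false, ?_, fun _ => ⟨rfl, rfl⟩⟩
      have e : τ (FreeGroup.mk [(i, true)]) = FreeGroup.mk [(i, true)] := by
        obtain ⟨j, b⟩ := a
        simp only at hia
        subst hia
        cases b
        · have e2 : FreeGroup.mk [(i, true)] = (FreeGroup.mk [(i, false)])⁻¹ := mk_linv (x := (i, false))
          rw [e2, map_inv, hAA]
        · exact hAA
      simp only [pw, e]; simp
    · rcases hx (FreeGroup.mk [(i, true)]) ((mem_letterSet _).2 ⟨_, rfl⟩) with e | e | e | e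
      · exact ⟨false, false, by rw [e]; simp [pw], fun h => absurd h hia⟩
      · exact ⟨false, true, by rw [e]; simp [pw], fun h => absurd h hia⟩
      · exact ⟨true, false, by rw [e]; simp [pw], fun h => absurd h hia⟩
      · exact ⟨true, true, by rw [e]; simp [pw], fun h => absurd h hia⟩
  choose l r hlr hlr0 using h1
  set R : Letter k → Bool := fun x => if x.2 then r x.1 else l x.1 with hR
  have hτ : ∀ x, τ (FreeGroup.mk [x]) = (pw (FreeGroup.mk [a]) (R (linv x)))⁻¹ *
      FreeGroup.mk [x] * pw (FreeGroup.mk [a]) (R x) := by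
    rintro ⟨i, b⟩
    cases b
    · have e2 : FreeGroup.mk [(i, false)] = (FreeGroup.mk [(i, true)])⁻¹ := mk_linv (x := (i, true))
      rw [e2, map_inv, hlr i]
      simp only [hR, linv, Bool.not_false, if_true]
      simp only [Bool.false_eq_true, if_false]
      group
    · rw [hlr i]
      simp [hR, linv]
  have hv : Valid a R := by
    obtain ⟨j, b⟩ := a
    have := hlr0 j rfl
    cases b <;> simp [Valid, hR, linv, this]
  refine ⟨a, R, hv, hτ, ?_, ?_⟩
  · by_contra hcon
    push Not at hcon
    have hall : ∀ x, R x = false := by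
      intro x
      by_cases c1 : x = a
      · rw [c1]; exact hv.1
      by_cases c2 : x = linv a
      · rw [c2]; exact hv.2
      simpa using hcon x c1 c2
    apply hi
    refine ⟨1, mul_aut_ext _ _ fun x => ?_⟩
    rw [hτ, hall, hall]
    simp only [pw]
    simp
  · by_contra hcon
    push Not at hcon
    apply hi
    refine ⟨(FreeGroup.mk [a])⁻¹, mul_aut_ext _ _ fun x => ?_⟩
    rw [MulAut.conj_apply, inv_inv]
    by_cases c1 : x = a
    · rw [c1, hAA]; group
    by_cases c2 : x = linv a
    · rw [c2, mk_linv, map_inv, hAA]; group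
    have d1 : linv x ≠ a := fun h => c2 (by rw [← h, linv_linv])
    have d2 : linv x ≠ linv a := fun h => c1 (by rw [← linv_linv x, h, linv_linv])
    have f1 : R x = true := by simpa using hcon x c1 c2
    have f2 : R (linv x) = true := by simpa using hcon _ d1 d2
    rw [hτ, f1, f2]
    simp only [pw, if_true]

lemma neg_zero (hk : 2 ≤ k) : Neg k {g | wordLength g = 0} := by
  refine ⟨0, 1, le_rfl, one_pos, ?_, fun n hn => ?_⟩
  · have : (2:ℝ) ≤ k := by exact_mod_cast hk
    linarith
  · have : {g ∈ {g : FG k | wordLength g = 0} | wordLength g = n} = ∅ := by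
      ext g
      simp only [Set.mem_setOf_eq, Set.mem_empty_iff_false, iff_false, not_and]
      omega
    rw [this]; simp

lemma final_neg (hk : 2 ≤ k) : Neg k (Cset k \ Zset k) := by
  classical
  set x0 : Letter k := (⟨0, by omega⟩, true)
  let ι := {q : Letter k × (Letter k → Bool) // Valid q.1 q.2 ∧
    (∃ x, x ≠ q.1 ∧ x ≠ linv q.1 ∧ q.2 x = true) ∧ (∃ x, x ≠ q.1 ∧ x ≠ linv q.1 ∧ q.2 x = false)}
  have n1 : Neg k (⋃ σ, RotS x0 σ) := Neg.iUnion hk fun σ => neg_rotation hk x0 σ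
  have n2 : Neg k (⋃ σ, ReflS x0 σ) := Neg.iUnion hk fun σ => neg_reflection hk x0 σ
  have n3 : Neg k (⋃ z, MissS z) := Neg.iUnion hk fun z => neg_miss hk z
  have n4 : Neg k (⋃ q : ι, WhS q.1.1 q.1.2) := Neg.iUnion hk fun q =>
    neg_Wh hk q.1.1 q.1.2 q.2.1 q.2.2.1 q.2.2.2
  refine ((((neg_zero hk).union n1).union n2).union (n3.union n4)).mono ?_
  rintro w ⟨hw, hz⟩
  by_contra hcon
  simp only [Set.mem_union, Set.mem_iUnion, not_or, not_exists, Set.mem_setOf_eq] at hcon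
  obtain ⟨⟨⟨c0, c1⟩, c2⟩, c3, c4⟩ := hcon
  have hl : 1 ≤ wordLength w := by omega
  apply hz
  refine ⟨⟨⟨hw, ?_⟩, ?_, ?_⟩, ?_⟩
  · intro τ h2 hi
    obtain ⟨a, R, hv, hτ, h3, h4⟩ := wh_form τ h2 hi
    exact wh_lt a R hv τ hτ w hl hw (c4 ⟨(a, R), hv, h3, h4⟩)
  · intro hp
    exact c1 _ (power_mem x0 w hw hl hp)
  · intro τ hτ hne hc
    rcases conj_mem x0 w hw hl τ hτ hne hc with ⟨σ, h⟩ | ⟨z, h⟩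
    · exact c1 _ h
    · exact c3 _ h
  · rintro ⟨τ, hτ, hc⟩
    obtain ⟨σ, h⟩ := refl_mem x0 w hl τ hτ hc
    exact c2 _ h

end ZG

/-- the set `Z` is exponentially generic in `C`. -/
theorem Zset_expGeneric (k : ℕ) (hk : 2 ≤ k) :
    ExpGenericIn (Zset k) (Cset k) := by
  exact ZG.expGeneric_of_neg hk (Zset k) (fun _ h => h.1.1.1) (ZG.final_neg hk)
end
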